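/- Let n > 2, let Ω ⊂ ℝⁿ be open, and let F : ℝⁿ → ℝ be convex and C² on ℝⁿ∖{0}, satisfying for exponents 1 < p ≤ q, constants 0 < ν ≤ 1 ≤ L, μ ∈ [0,1], and all z ≠ 0, ξ ∈ ℝⁿ: ν(|z|²+μ²)^{p/2} ≤ F(z) ≤ L(|z|²+μ²)^{q/2} + L(|z|²+μ²)^{p/2}; (|z|²+μ²)|∂²F(z)| ≤ L(|z|²+μ²)^{q/2} + L(|z|²+μ²)^{p/2}; and ν(|z|²+μ²)^{(p−2)/2}|ξ|² ≤ ⟨∂²F(z)ξ,ξ⟩. Assume the gap bound q/p < 1 + min{2/n, 4(p−1)/(p(n−2))} and let f : Ω → ℝ be measurable with ‖f‖_{L(n,1)(Ω)} < ∞. Let u : Ω → ℝ be locally Lipschitz and a local minimizer of w ↦ ∫ [F(Dw) − f·w] dx. Then there is a constant c = c(n,p,q,ν,L) such that for every ball B = B_r(x₀) with B ⋐ Ω, writing M := ⨍_B F(Du) dx + ‖f‖_{L(n,1)(B)}^{p/(p−1)}, one has ‖Du‖_{L^∞(B_{r/2}(x₀))} ≤ c·M^{1/p} + c·M^{2/((n+2)p−nq)}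 + c·‖f‖_{L(n,1)(B)}^{4/(4(p−1)−(n−2)(q−p))}. -/

import Mathlib

open MeasureTheory Metric Set
open scoped ENNReal NNReal
noncomputable section

/-- `u` is locally Lipschitz on `s`: Lipschitz on every compact subset of `s`. -/
def LocLipOn {n : ℕ} {F : Type*} [PseudoMetricSpace F]
    (s : Set (EuclideanSpace ℝ (Fin n))) (u : EuclideanSpace ℝ (Fin n) → F) : Prop :=
  ∀ K : Set (EuclideanSpace ℝ (Fin n)), IsCompact K → K ⊆ s → ∃ C : ℝ≥0, LipschitzOnWith C u K

/-- The Lorentz `L(n,1)`-functional `‖f‖_{L(n,1)(Ω)} = ∫₀^∞ |{x ∈ Ω : |f(x)| > λ}|^{1/n} dλ`. -/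
def lorentzNorm {n : ℕ} {F : Type*} [NormedAddCommGroup F]
    (Ω : Set (EuclideanSpace ℝ (Fin n))) (f : EuclideanSpace ℝ (Fin n) → F) : ℝ≥0∞ :=
  ∫⁻ lam in Ioi (0:ℝ), (volume {x | x ∈ Ω ∧ lam < ‖f x‖}) ^ (1 / (n : ℝ))

/-- `u` is a local minimizer of `w ↦ ∫ [Fi(Dw) − f·w] dx` on `Ω` among locally Lipschitz
maps. -/
def IsLocMinimizer {n : ℕ} (Ω : Set (EuclideanSpace ℝ (Fin n)))
    (Fi : EuclideanSpace ℝ (Fin n) → ℝ) (f : EuclideanSpace ℝ (Fin n) → ℝ)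
    (u : EuclideanSpace ℝ (Fin n) → ℝ) : Prop :=
  ∀ B' : Set (EuclideanSpace ℝ (Fin n)), IsOpen B' → IsCompact (closure B') →
    closure B' ⊆ Ω →
    ∀ w : EuclideanSpace ℝ (Fin n) → ℝ, LocLipOn Ω w →
      IsCompact (closure {x | w x ≠ u x}) → closure {x | w x ≠ u x} ⊆ B' →
      ∫ x in B', (Fi (gradient u x) - f x * u x) ≤ ∫ x in B', (Fi (gradient w x) - f x * w x)

/-- Euclidean space of dimension `n`. -/
abbrev Eucl (n : ℕ) := EuclideanSpace ℝ (Fin n)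

theorem exists_norm_le_one_enorm_apply_eq {n : ℕ} (l : Eucl n →L[ℝ] ℝ) :
    ∃ e : Eucl n, ‖e‖ ≤ 1 ∧ ‖l e‖ₑ = ‖l‖ₑ := by
  set g := (InnerProductSpace.toDual ℝ (Eucl n)).symm l with hg
  have hl : ∀ x, l x = inner ℝ g x := fun x => by
    rw [hg, InnerProductSpace.toDual_symm_apply]
  have hn : ‖l‖ = ‖g‖ := by rw [hg, LinearIsometryEquiv.norm_map]
  refine ⟨(‖g‖⁻¹ : ℝ) • g, ?_, ?_⟩
  · rw [norm_smul, norm_inv, norm_norm]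
    exact inv_mul_le_one
  · have : ‖l ((‖g‖⁻¹ : ℝ) • g)‖ = ‖l‖ := by
      rw [hl, real_inner_smul_right, real_inner_self_eq_norm_sq, hn]
      rcases eq_or_ne ‖g‖ 0 with h | h
      · simp [h]
      · field_simp
        simp
    rw [← ofReal_norm, ← ofReal_norm, this]

section Mollification

variable {n : ℕ}

theorem lintegral_ofReal_normed_sub (ρ : ContDiffBump (0 : Eucl n)) (x : Eucl n) :
    ∫⁻ y, ENNReal.ofReal (ρ.normed volume (x - y)) = 1 := by
  rw [lintegral_sub_left_eq_self (fun y => ENNReal.ofReal (ρ.normed volume y)) x,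
    ← ofReal_integral_eq_lintegral_ofReal ρ.integrable_normed
      (Filter.Eventually.of_forall fun y => ρ.nonneg_normed y), ρ.integral_normed,
    ENNReal.ofReal_one]

theorem sq_lintegral_mul_le_of_lintegral_eq_one {α : Type*} [MeasurableSpace α] {μ : Measure α}
    {w G : α → ℝ≥0∞} (hw : Measurable w) (hG : Measurable G) (h1 : ∫⁻ y, w y ∂μ = 1) :
    (∫⁻ y, w y * G y ∂μ) ^ 2 ≤ ∫⁻ y, w y * G y ^ 2 ∂μ := by
  have h := ENNReal.lintegral_mul_le_Lp_mul_Lq μ Real.HolderConjugate.two_two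
    (f := fun y => w y ^ (1 / 2 : ℝ)) (g := fun y => w y ^ (1 / 2 : ℝ) * G y)
    (by fun_prop) (by fun_prop)
  have e1 : ∫⁻ y, ((fun y => w y ^ (1 / 2 : ℝ)) * fun y => w y ^ (1 / 2 : ℝ) * G y) y ∂μ
      = ∫⁻ y, w y * G y ∂μ := by
    refine lintegral_congr fun y => ?_
    simp only [Pi.mul_apply, ← mul_assoc]
    rw [← ENNReal.rpow_add_of_nonneg _ _ (by norm_num) (by norm_num)]
    norm_num
  have e2 : ∫⁻ y, (w y ^ (1 / 2 : ℝ)) ^ (2 : ℝ) ∂μ = 1 := by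
    rw [← h1]
    refine lintegral_congr fun y => ?_
    rw [← ENNReal.rpow_mul]; norm_num
  have e3 : ∫⁻ y, (w y ^ (1 / 2 : ℝ) * G y) ^ (2 : ℝ) ∂μ = ∫⁻ y, w y * G y ^ 2 ∂μ := by
    refine lintegral_congr fun y => ?_
    rw [ENNReal.mul_rpow_of_nonneg _ _ (by norm_num), ← ENNReal.rpow_mul]
    norm_num
  rw [e1, e2, e3] at h
  calc (∫⁻ y, w y * G y ∂μ) ^ 2 ≤ ((1 : ℝ≥0∞) ^ (1 / 2 : ℝ) *
        (∫⁻ y, w y * G y ^ 2 ∂μ) ^ (1 / 2 : ℝ)) ^ 2 := by gcongr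
    _ = _ := by
      rw [ENNReal.one_rpow, one_mul, ← ENNReal.rpow_natCast, ← ENNReal.rpow_mul]; norm_num

/-- Differentiating a mollified Lipschitz function. -/
theorem integral_fderiv_normed_sub_mul (ρ : ContDiffBump (0 : Eucl n)) {K : ℝ≥0}
    {g : Eucl n → ℝ} (hg : LipschitzWith K g) (x e : Eucl n) :
    ∫ y, fderiv ℝ (ρ.normed volume) (x - y) e * g y =
      ∫ y, lineDeriv ℝ g y e * ρ.normed volume (x - y) := by
  have hsm : ContDiff ℝ 1 (ρ.normed volume) := ρ.contDiff_normed
  have hcs : HasCompactSupport (ρ.normed volume) := ρ.hasCompactSupport_normed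
  obtain ⟨D, hD⟩ := hsm.lipschitzWith_of_hasCompactSupport hcs one_ne_zero
  have h2 : LipschitzWith D (fun y => ρ.normed volume (x - y)) := by
    refine LipschitzWith.of_dist_le_mul fun a b => ?_
    refine (hD.dist_le_mul _ _).trans ?_
    rw [dist_sub_left]
  have h3 : HasCompactSupport (fun y => ρ.normed volume (x - y)) :=
    hcs.comp_homeomorph (Homeomorph.subLeft x)
  rw [hg.integral_lineDeriv_mul_eq h2 h3 e]
  refine integral_congr_ae (Filter.Eventually.of_forall fun y => ?_)
  simp only
  congr 1
  have hd : HasFDerivAt (fun y => ρ.normed volume (x - y))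
      ((fderiv ℝ (ρ.normed volume) (x - y)).comp (-ContinuousLinearMap.id ℝ (Eucl n))) y := by
    refine HasFDerivAt.comp y (hsm.differentiable one_ne_zero _).hasFDerivAt ?_
    exact (hasFDerivAt_id y).const_sub x
  have := hd.hasLineDerivAt (-e)
  rw [this.lineDeriv]
  simp

theorem fderiv_normed_convolution_apply (ρ : ContDiffBump (0 : Eucl n)) {g : Eucl n → ℝ}
    (hg : LocallyIntegrable g) (x e : Eucl n) :
    fderiv ℝ (convolution (ρ.normed volume) g (ContinuousLinearMap.lsmul ℝ ℝ) volume) x e =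
      ∫ y, fderiv ℝ (ρ.normed volume) (x - y) e * g y := by
  have hsm : ContDiff ℝ 1 (ρ.normed volume) := ρ.contDiff_normed
  have hcs : HasCompactSupport (ρ.normed volume) := ρ.hasCompactSupport_normed
  rw [(hcs.hasFDerivAt_convolution_left _ hsm hg x).fderiv]
  rw [convolution_def, ContinuousLinearMap.integral_apply]
  · rw [← integral_sub_left_eq_self _ _ x]
    refine integral_congr_ae (Filter.Eventually.of_forall fun y => ?_)
    simp [ContinuousLinearMap.precompL_apply]
  · have := (hcs.fderiv ℝ).convolutionExists_left
      (ContinuousLinearMap.precompL (Eucl n) (ContinuousLinearMap.lsmul ℝ ℝ (E := ℝ)))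
      (hsm.continuous_fderiv one_ne_zero) hg x
    exact this

end Mollification

section SobolevLimit

variable {n : ℕ}

theorem integrable_of_abs_le_of_support {g : Eucl n → ℝ} {A R : ℝ} {z : Eucl n}
    (hg : AEStronglyMeasurable g) (hA : ∀ᵐ x, |g x| ≤ A)
    (hs : ∀ x, x ∉ closedBall z R → g x = 0) : Integrable g := by
  rw [← integrableOn_iff_integrable_of_support_subset (s := closedBall z R)
    (fun x hx => by by_contra h; exact hx (hs x h))]
  exact Measure.integrableOn_of_bounded (M := A) measure_closedBall_lt_top.ne hg
    (ae_restrict_of_ae (by simpa [Real.norm_eq_abs] using hA))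

/-- If Lipschitz functions `gj j` tend to `g` and their gradients are bounded by `G j + B j`
with `B j → 0` in `L¹`, then the gradient of a mollification of `g` is controlled by `G j`. -/
theorem enorm_sq_fderiv_normed_convolution_le (ρ : ContDiffBump (0 : Eucl n))
    {g : Eucl n → ℝ} {gj : ℕ → Eucl n → ℝ} {A R : ℝ} {z : Eucl n} {K : ℕ → ℝ≥0}
    (hg : Measurable g) (hlip : ∀ j, LipschitzWith (K j) (gj j))
    (hA : ∀ j x, |gj j x| ≤ A) (hs : ∀ j x, x ∉ closedBall z R → gj j x = 0)
    (hs' : ∀ x, x ∉ closedBall z R → g x = 0)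
    (hlim : ∀ᵐ x, Filter.Tendsto (fun j => gj j x) Filter.atTop (nhds (g x)))
    {G B : ℕ → Eucl n → ℝ≥0∞} (hG : ∀ j, Measurable (G j))
    (hGB : ∀ j, ∀ᵐ x, ‖fderiv ℝ (gj j) x‖ₑ ≤ G j x + B j x)
    (hB : Filter.Tendsto (fun j => ∫⁻ x, B j x) Filter.atTop (nhds 0)) (x : Eucl n) :
    ‖fderiv ℝ (convolution (ρ.normed volume) g (ContinuousLinearMap.lsmul ℝ ℝ) volume) x‖ₑ ^ 2 ≤
      Filter.liminf (fun j => ∫⁻ y, ENNReal.ofReal (ρ.normed volume (x - y)) * G j y ^ 2)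
        Filter.atTop := by
  have hgA : ∀ᵐ x, |g x| ≤ A := by
    filter_upwards [hlim] with x hx
    exact le_of_tendsto hx.abs (Filter.Eventually.of_forall fun j => hA j x)
  have hgi : Integrable g := integrable_of_abs_le_of_support hg.aestronglyMeasurable hgA hs'
  obtain ⟨e, he, hle⟩ := exists_norm_le_one_enorm_apply_eq
    (fderiv ℝ (convolution (ρ.normed volume) g (ContinuousLinearMap.lsmul ℝ ℝ) volume) x)
  rw [← hle, fderiv_normed_convolution_apply ρ hgi.locallyIntegrable]
  have hsm : ContDiff ℝ 1 (ρ.normed volume) := ρ.contDiff_normed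
  have hcs : HasCompactSupport (ρ.normed volume) := ρ.hasCompactSupport_normed
  have hw : Measurable fun y => ENNReal.ofReal (ρ.normed volume (x - y)) := by
    have := hsm.continuous
    fun_prop
  obtain ⟨W, hW⟩ := hcs.exists_bound_of_continuous hsm.continuous
  obtain ⟨W', hW'⟩ := (hcs.fderiv ℝ).exists_bound_of_continuous
    (hsm.continuous_fderiv one_ne_zero)
  have hWnn : 0 ≤ W' := (norm_nonneg _).trans (hW' 0)
  have hAnn : 0 ≤ A := (abs_nonneg _).trans (hA 0 0)
  -- the integrals converge
  have hT : Filter.Tendsto (fun j => ∫ y, fderiv ℝ (ρ.normed volume) (x - y) e * gj j y)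
      Filter.atTop (nhds (∫ y, fderiv ℝ (ρ.normed volume) (x - y) e * g y)) := by
    have hc : Continuous fun y => fderiv ℝ (ρ.normed volume) (x - y) e := by
      have := hsm.continuous_fderiv one_ne_zero
      fun_prop
    refine tendsto_integral_of_dominated_convergence
      ((closedBall z R).indicator fun _ => W' * A) ?_ ?_ ?_ ?_
    · intro j
      exact (hc.mul (hlip j).continuous).aestronglyMeasurable
    · rw [integrable_indicator_iff measurableSet_closedBall]
      exact integrableOn_const measure_closedBall_lt_top.ne
    · intro j
      refine Filter.Eventually.of_forall fun y => ?_
      by_cases hy : y ∈ closedBall z R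
      · rw [indicator_of_mem hy, norm_mul]
        refine mul_le_mul ?_ (hA j y) (norm_nonneg _) hWnn
        calc ‖fderiv ℝ (ρ.normed volume) (x - y) e‖
            ≤ ‖fderiv ℝ (ρ.normed volume) (x - y)‖ * ‖e‖ := ContinuousLinearMap.le_opNorm _ _
          _ ≤ W' * 1 := mul_le_mul (hW' _) he (norm_nonneg _) hWnn
          _ = W' := mul_one _
      · rw [indicator_of_notMem hy, hs j y hy]
        simp
    · filter_upwards [hlim] with y hy
      exact hy.const_mul _
  -- upper bound for each index
  have hub : ∀ j, ‖∫ y, fderiv ℝ (ρ.normed volume) (x - y) e * gj j y‖ₑ ≤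
      (∫⁻ y, ENNReal.ofReal (ρ.normed volume (x - y)) * G j y) +
        ENNReal.ofReal W * ∫⁻ y, B j y := by
    intro j
    rw [integral_fderiv_normed_sub_mul ρ (hlip j)]
    refine (enorm_integral_le_lintegral_enorm _).trans ?_
    have hadd := lintegral_add_left (μ := volume) (hw.mul (hG j))
      (fun y => ENNReal.ofReal W * B j y)
    simp only [Pi.mul_apply] at hadd
    rw [← lintegral_const_mul' _ _ ENNReal.ofReal_ne_top, ← hadd]
    refine lintegral_mono_ae ?_
    filter_upwards [hGB j, (hlip j).ae_differentiableAt] with y hy hyd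
    rw [hyd.lineDeriv_eq_fderiv, enorm_mul, Real.enorm_of_nonneg (ρ.nonneg_normed _), mul_comm]
    have h1 : ‖fderiv ℝ (gj j) y e‖ₑ ≤ G j y + B j y := by
      refine le_trans ?_ hy
      rw [← ofReal_norm, ← ofReal_norm]
      refine ENNReal.ofReal_le_ofReal ?_
      calc ‖fderiv ℝ (gj j) y e‖ ≤ ‖fderiv ℝ (gj j) y‖ * ‖e‖ :=
            ContinuousLinearMap.le_opNorm _ _
        _ ≤ ‖fderiv ℝ (gj j) y‖ := mul_le_of_le_one_right (norm_nonneg _) he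
    calc _ ≤ ENNReal.ofReal (ρ.normed volume (x - y)) * (G j y + B j y) := by gcongr
      _ ≤ _ := by
        rw [mul_add]
        gcongr
        exact (le_abs_self _).trans (hW _)
  set a : ℕ → ℝ≥0∞ := fun j => ‖∫ y, fderiv ℝ (ρ.normed volume) (x - y) e * gj j y‖ₑ with ha
  have hT2 : Filter.Tendsto (fun j => (a j - ENNReal.ofReal W * ∫⁻ y, B j y) ^ 2) Filter.atTop
      (nhds (‖∫ y, fderiv ℝ (ρ.normed volume) (x - y) e * g y‖ₑ ^ 2)) := by
    have h1 : Filter.Tendsto (fun j => a j - ENNReal.ofReal W * ∫⁻ y, B j y) Filter.atTop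
        (nhds (‖∫ y, fderiv ℝ (ρ.normed volume) (x - y) e * g y‖ₑ - 0)) := by
      refine ENNReal.Tendsto.sub hT.enorm ?_ (Or.inl enorm_ne_top)
      have := ENNReal.Tendsto.const_mul (a := ENNReal.ofReal W) hB
        (Or.inr ENNReal.ofReal_ne_top)
      simpa using this
    rw [tsub_zero] at h1
    exact ENNReal.Tendsto.pow h1
  rw [← hT2.liminf_eq]
  refine Filter.liminf_le_liminf (Filter.Eventually.of_forall fun j => ?_)
  refine le_trans ?_ (sq_lintegral_mul_le_of_lintegral_eq_one hw (hG j)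
    (lintegral_ofReal_normed_sub ρ x))
  gcongr
  exact tsub_le_iff_right.2 (hub j)

/-- Sobolev inequality for almost everywhere limits of Lipschitz functions. -/
theorem eLpNorm_le_of_tendsto_of_fderiv_le (hn : 2 < n) {p' : ℝ≥0}
    (hp' : (p' : ℝ)⁻¹ = (2 : ℝ)⁻¹ - (n : ℝ)⁻¹)
    {g : Eucl n → ℝ} {gj : ℕ → Eucl n → ℝ} {A R : ℝ} {z : Eucl n} {K : ℕ → ℝ≥0}
    (hg : Measurable g) (hlip : ∀ j, LipschitzWith (K j) (gj j))
    (hA : ∀ j x, |gj j x| ≤ A) (hs : ∀ j x, x ∉ closedBall z R → gj j x = 0)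
    (hs' : ∀ x, x ∉ closedBall z R → g x = 0)
    (hlim : ∀ᵐ x, Filter.Tendsto (fun j => gj j x) Filter.atTop (nhds (g x)))
    {G B : ℕ → Eucl n → ℝ≥0∞} (hG : ∀ j, Measurable (G j))
    (hGB : ∀ j, ∀ᵐ x, ‖fderiv ℝ (gj j) x‖ₑ ≤ G j x + B j x)
    (hB : Filter.Tendsto (fun j => ∫⁻ x, B j x) Filter.atTop (nhds 0))
    {D : ℕ → ℝ≥0∞} {D' : ℝ≥0∞} (hD : ∀ j, ∫⁻ x, G j x ^ 2 ≤ D j)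
    (hD' : Filter.Tendsto D Filter.atTop (nhds D')) :
    eLpNorm g p' volume ≤
      SNormLESNormFDerivOfEqConst ℝ (volume : Measure (Eucl n)) 2 * D' ^ (1 / 2 : ℝ) := by
  have hgA : ∀ᵐ x, |g x| ≤ A := by
    filter_upwards [hlim] with x hx
    exact le_of_tendsto hx.abs (Filter.Eventually.of_forall fun j => hA j x)
  have hgi : Integrable g := integrable_of_abs_le_of_support hg.aestronglyMeasurable hgA hs'
  have hgc : HasCompactSupport g := HasCompactSupport.intro (isCompact_closedBall z R) hs'
  let ρ : ℕ → ContDiffBump (0 : Eucl n) := fun m =>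
    ⟨1 / ((m : ℝ) + 1), 2 / ((m : ℝ) + 1), by positivity, by gcongr; norm_num⟩
  let gm : ℕ → Eucl n → ℝ := fun m =>
    convolution ((ρ m).normed volume) g (ContinuousLinearMap.lsmul ℝ ℝ) volume
  have hgm : ∀ m, ContDiff ℝ 1 (gm m) := fun m =>
    (ρ m).hasCompactSupport_normed.contDiff_convolution_left _ (ρ m).contDiff_normed
      hgi.locallyIntegrable
  have hconv : ∀ᵐ x, Filter.Tendsto (fun m => gm m x) Filter.atTop (nhds (g x)) := by
    refine ContDiffBump.ae_convolution_tendsto_right_of_locallyIntegrable (K := 2) ?_ ?_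
      hgi.locallyIntegrable
    · have := tendsto_one_div_add_atTop_nhds_zero_nat (𝕜 := ℝ)
      have := this.const_mul 2
      simpa [ρ, div_eq_mul_inv] using this
    · refine Filter.Eventually.of_forall fun m => ?_
      simp only [ρ]
      exact le_of_eq (by ring)
  have hgrad : ∀ m, ∫⁻ x, ‖fderiv ℝ (gm m) x‖ₑ ^ 2 ≤ D' := by
    intro m
    have hmeas : ∀ j, Measurable fun q : Eucl n × Eucl n =>
        ENNReal.ofReal ((ρ m).normed volume (q.1 - q.2)) * G j q.2 ^ 2 := by
      intro j
      have h1 : Continuous ((ρ m).normed (volume : Measure (Eucl n))) :=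
        ((ρ m).contDiff_normed (n := 0)).continuous
      have := hG j
      fun_prop
    calc ∫⁻ x, ‖fderiv ℝ (gm m) x‖ₑ ^ 2
        ≤ ∫⁻ x, Filter.liminf (fun j => ∫⁻ y,
            ENNReal.ofReal ((ρ m).normed volume (x - y)) * G j y ^ 2) Filter.atTop :=
          lintegral_mono fun x => enorm_sq_fderiv_normed_convolution_le (ρ m) hg hlip hA hs hs'
            hlim hG hGB hB x
      _ ≤ Filter.liminf (fun j => ∫⁻ x, ∫⁻ y,
            ENNReal.ofReal ((ρ m).normed volume (x - y)) * G j y ^ 2) Filter.atTop :=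
          lintegral_liminf_le fun j => (hmeas j).lintegral_prod_right'
      _ ≤ Filter.liminf D Filter.atTop := by
          refine Filter.liminf_le_liminf (Filter.Eventually.of_forall fun j => ?_)
          refine le_trans (le_of_eq ?_) (hD j)
          rw [lintegral_lintegral_swap (hmeas j).aemeasurable]
          refine lintegral_congr fun y => ?_
          have h1 : Continuous ((ρ m).normed (volume : Measure (Eucl n))) :=
            ((ρ m).contDiff_normed (n := 0)).continuous
          rw [lintegral_mul_const _ (by fun_prop)]
          rw [lintegral_sub_right_eq_self (fun x => ENNReal.ofReal ((ρ m).normed volume x)) y]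
          have := lintegral_ofReal_normed_sub (ρ m) 0
          simp only [zero_sub, ContDiffBump.normed_neg] at this
          rw [this, one_mul]
      _ = D' := hD'.liminf_eq
  have hsob : ∀ m, eLpNorm (gm m) p' volume ≤
      SNormLESNormFDerivOfEqConst ℝ (volume : Measure (Eucl n)) 2 * D' ^ (1 / 2 : ℝ) := by
    intro m
    have h1 := eLpNorm_le_eLpNorm_fderiv_of_eq (volume : Measure (Eucl n)) (hgm m)
      ((ρ m).hasCompactSupport_normed.convolution _ hgc) (p := 2) (p' := p')
      (by norm_num) (by simp; omega) (by simpa using hp')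
    refine h1.trans ?_
    refine mul_le_mul' (by norm_num) ?_
    rw [eLpNorm_eq_lintegral_rpow_enorm_toReal (by norm_num) (by norm_num)]
    simp only [ENNReal.coe_ofNat, ENNReal.toReal_ofNat]
    gcongr
    simpa using hgrad m
  refine (Lp.eLpNorm_lim_le_liminf_eLpNorm (fun m => (hgm m).continuous.aestronglyMeasurable)
    g hconv).trans ?_
  refine Filter.liminf_le_of_frequently_le' ?_
  exact Filter.Frequently.of_forall hsob

end SobolevLimit

section OneDim

variable {n : ℕ}

theorem lipschitzWith_comp_line {φ : Eucl n → ℝ} {K : ℝ≥0} (hφ : LipschitzWith K φ)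
    (y e : Eucl n) : LipschitzWith (K * ‖e‖₊) fun s : ℝ => φ (y + s • e) := by
  refine LipschitzWith.of_dist_le_mul fun s t => (hφ.dist_le_mul _ _).trans ?_
  rw [dist_add_left, dist_eq_norm, ← sub_smul, norm_smul, dist_eq_norm]
  push_cast
  exact le_of_eq (by ring)

theorem deriv_comp_line (φ : Eucl n → ℝ) (y e : Eucl n) (s : ℝ) :
    deriv (fun s : ℝ => φ (y + s • e)) s = lineDeriv ℝ φ (y + s • e) e := by
  rw [lineDeriv]
  have := deriv_comp_const_add (f := fun s : ℝ => φ (y + s • e)) s 0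
  rw [add_zero] at this
  rw [← this]
  congr 1
  ext t
  rw [add_smul, add_assoc]

theorem sub_eq_integral_lineDeriv {φ : Eucl n → ℝ} {K : ℝ≥0} (hφ : LipschitzWith K φ)
    (y e : Eucl n) (h : ℝ) :
    φ (y + h • e) - φ y = ∫ s in (0 : ℝ)..h, lineDeriv ℝ φ (y + s • e) e := by
  have h1 : AbsolutelyContinuousOnInterval (fun s : ℝ => φ (y + s • e)) 0 h :=
    ((lipschitzWith_comp_line hφ y e).lipschitzOnWith).absolutelyContinuousOnInterval
  have h2 := h1.integral_deriv_eq_sub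
  simp only [deriv_comp_line] at h2
  rw [h2]
  simp

theorem enorm_sub_le_lintegral_lineDeriv {φ : Eucl n → ℝ} {K : ℝ≥0} (hφ : LipschitzWith K φ)
    (y e : Eucl n) {h : ℝ} (hh : 0 ≤ h) :
    ‖φ (y - h • e) - φ y‖ₑ ≤ ∫⁻ s in Ioc 0 h, ‖lineDeriv ℝ φ (y - s • e) e‖ₑ := by
  have h1 := sub_eq_integral_lineDeriv hφ y (-e) h
  simp only [smul_neg, ← sub_eq_add_neg, lineDeriv_neg] at h1
  rw [h1, intervalIntegral.integral_of_le hh]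
  refine (enorm_integral_le_lintegral_enorm _).trans (le_of_eq ?_)
  simp

theorem lintegral_enorm_mul_enorm_sub_le {φ : Eucl n → ℝ} {K : ℝ≥0} (hφ : LipschitzWith K φ)
    {f : Eucl n → ℝ} (hf : Measurable f) (e : Eucl n) {h : ℝ} (hh : 0 ≤ h) :
    ∫⁻ y, ‖f y‖ₑ * ‖φ (y - h • e) - φ y‖ₑ ≤
      ∫⁻ y, (∫⁻ s in Ioc 0 h, ‖f (y + s • e)‖ₑ) * ‖lineDeriv ℝ φ y e‖ₑ := by
  have hm : Measurable fun y => lineDeriv ℝ φ y e := measurable_lineDeriv hφ.continuous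
  calc ∫⁻ y, ‖f y‖ₑ * ‖φ (y - h • e) - φ y‖ₑ
      ≤ ∫⁻ y, ∫⁻ s in Ioc 0 h, ‖f y‖ₑ * ‖lineDeriv ℝ φ (y - s • e) e‖ₑ := by
        refine lintegral_mono fun y => ?_
        rw [lintegral_const_mul' _ _ enorm_ne_top]
        gcongr
        exact enorm_sub_le_lintegral_lineDeriv hφ y e hh
    _ = ∫⁻ s in Ioc 0 h, ∫⁻ y, ‖f y‖ₑ * ‖lineDeriv ℝ φ (y - s • e) e‖ₑ := by
        rw [lintegral_lintegral_swap]
        refine Measurable.aemeasurable ?_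
        fun_prop
    _ = ∫⁻ s in Ioc 0 h, ∫⁻ y, ‖f (y + s • e)‖ₑ * ‖lineDeriv ℝ φ y e‖ₑ := by
        refine lintegral_congr fun s => ?_
        rw [← lintegral_add_right_eq_self _ (s • e)]
        simp
    _ = ∫⁻ y, ∫⁻ s in Ioc 0 h, ‖f (y + s • e)‖ₑ * ‖lineDeriv ℝ φ y e‖ₑ := by
        rw [lintegral_lintegral_swap]
        refine Measurable.aemeasurable ?_
        fun_prop
    _ = _ := by
        refine lintegral_congr fun y => ?_
        rw [lintegral_mul_const' _ _ enorm_ne_top]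

/-- If the slope of `u` over `[0, h]` exceeds `k > k'`, then the set of times at which both the
slope from `0` and the derivative exceed `k'` has measure comparable to `h`. -/
theorem ofReal_le_volume_lineDeriv_gt {u : Eucl n → ℝ} {K : ℝ≥0} (hu : LipschitzWith K u)
    (x e : Eucl n) (he : ‖e‖ ≤ 1) {k k' h : ℝ} (hk' : 0 ≤ k') (hh : 0 < h)
    (hk : k < (u (x + h • e) - u x) / h) :
    ENNReal.ofReal ((k - k') * h) ≤ ENNReal.ofReal K *
      volume {t | t ∈ Ioc 0 h ∧ k' < (u (x + t • e) - u x) / t ∧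
        k' < lineDeriv ℝ u (x + t • e) e} := by
  set Φ : ℝ → ℝ := fun t => u (x + t • e) - u x - k' * t with hΦ
  set Ψ : ℝ → ℝ := fun t => max (Φ t) 0 with hΨ
  have hline := lipschitzWith_comp_line hu x e
  have hΦL : LipschitzWith (K * ‖e‖₊ + ‖k'‖₊) Φ := by
    have h1 : LipschitzWith ‖k'‖₊ fun t : ℝ => k' * t := by
      refine LipschitzWith.of_dist_le_mul fun s t => ?_
      rw [Real.dist_eq, Real.dist_eq, ← mul_sub, abs_mul]; simp
    have h2 : LipschitzWith (K * ‖e‖₊) fun t : ℝ => u (x + t • e) - u x := by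
      refine LipschitzWith.of_dist_le_mul fun s t => ?_
      rw [dist_sub_right]; exact hline.dist_le_mul s t
    exact h2.sub h1
  have hΨL : LipschitzWith (K * ‖e‖₊ + ‖k'‖₊) Ψ := hΦL.max_const 0
  have hAC : AbsolutelyContinuousOnInterval Ψ 0 h :=
    (hΨL.lipschitzOnWith).absolutelyContinuousOnInterval
  have hFTC := hAC.integral_deriv_eq_sub
  have hΨ0 : Ψ 0 = 0 := by simp [hΨ, hΦ]
  have hΨh : (k - k') * h ≤ Ψ h := by
    refine le_trans ?_ (le_max_left _ _)
    rw [lt_div_iff₀ hh] at hk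
    simp only [hΦ]; linarith
  rw [hΨ0, sub_zero, intervalIntegral.integral_of_le hh.le] at hFTC
  have hd : ∀ t ∈ Ioc 0 h, 0 < deriv Ψ t →
      k' < (u (x + t • e) - u x) / t ∧ k' < lineDeriv ℝ u (x + t • e) e ∧
        deriv Ψ t ≤ K := by
    intro t ht hpos
    have hΦpos : 0 < Φ t := by
      by_contra hneg
      push Not at hneg
      have : IsLocalMin Ψ t := Filter.Eventually.of_forall fun s => by
        simp only [hΨ]; rw [max_eq_right hneg]; exact le_max_right _ _
      rw [this.deriv_eq_zero] at hpos
      exact lt_irrefl _ hpos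
    have heq : Ψ =ᶠ[nhds t] Φ := by
      filter_upwards [hΦL.continuous.continuousAt.eventually (lt_mem_nhds hΦpos)] with s hs
      exact max_eq_left hs.le
    rw [heq.deriv_eq] at hpos ⊢
    have hdiff : DifferentiableAt ℝ Φ t := by
      by_contra hnd
      rw [deriv_zero_of_not_differentiableAt hnd] at hpos
      exact lt_irrefl _ hpos
    have hdu : DifferentiableAt ℝ (fun t : ℝ => u (x + t • e)) t := by
      have : (fun t : ℝ => u (x + t • e)) = fun t => Φ t + (u x + k' * t) := by
        ext s; simp only [hΦ]; ring
      rw [this]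
      fun_prop
    have hdv : deriv Φ t = lineDeriv ℝ u (x + t • e) e - k' := by
      rw [← deriv_comp_line]
      have h1 : HasDerivAt Φ (deriv (fun s : ℝ => u (x + s • e)) t - k' * 1) t :=
        ((hdu.hasDerivAt.sub_const (u x)).sub ((hasDerivAt_id t).const_mul k'))
      rw [h1.deriv, mul_one]
    rw [hdv] at hpos ⊢
    have hK : lineDeriv ℝ u (x + t • e) e ≤ K := by
      rw [← deriv_comp_line]
      refine (le_abs_self _).trans ?_
      have := norm_deriv_le_of_lipschitz (x₀ := t) hline
      rw [Real.norm_eq_abs] at this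
      refine this.trans ?_
      push_cast
      exact mul_le_of_le_one_right K.2 he
    refine ⟨?_, by linarith, by linarith⟩
    rw [lt_div_iff₀ ht.1]
    simp only [hΦ] at hΦpos; linarith
  set A := {t | t ∈ Ioc 0 h ∧ k' < (u (x + t • e) - u x) / t ∧
        k' < lineDeriv ℝ u (x + t • e) e} with hA
  have hAmeas : MeasurableSet A := by
    have h1 : Measurable fun y => lineDeriv ℝ u y e := measurable_lineDeriv hu.continuous
    have h2 := hu.continuous.measurable
    have h3 : Measurable fun t : ℝ => (u (x + t • e) - u x) / t := by fun_prop
    have h4 : Measurable fun t : ℝ => lineDeriv ℝ u (x + t • e) e := by fun_prop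
    exact measurableSet_Ioc.inter
      ((measurableSet_lt measurable_const h3).inter (measurableSet_lt measurable_const h4))
  calc ENNReal.ofReal ((k - k') * h) ≤ ENNReal.ofReal (∫ t in Ioc 0 h, deriv Ψ t) := by
        rw [hFTC]; exact ENNReal.ofReal_le_ofReal hΨh
    _ ≤ ∫⁻ t in Ioc 0 h, ENNReal.ofReal (deriv Ψ t) := by
        have hint : IntegrableOn (deriv Ψ) (Ioc 0 h) := by
          have := hAC.intervalIntegrable_deriv
          rwa [intervalIntegrable_iff_integrableOn_Ioc_of_le hh.le] at this
        calc ENNReal.ofReal (∫ t in Ioc 0 h, deriv Ψ t)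
            ≤ ENNReal.ofReal (∫ t in Ioc 0 h, max (deriv Ψ t) 0) := by
              refine ENNReal.ofReal_le_ofReal (integral_mono hint hint.pos_part ?_)
              intro t; exact le_max_left _ _
          _ = ∫⁻ t in Ioc 0 h, ENNReal.ofReal (max (deriv Ψ t) 0) :=
              ofReal_integral_eq_lintegral_ofReal hint.pos_part
                (Filter.Eventually.of_forall fun t => le_max_right _ _)
          _ = _ := by simp
    _ ≤ ∫⁻ t in Ioc 0 h, A.indicator (fun _ => ENNReal.ofReal K) t := by
        refine setLIntegral_mono' measurableSet_Ioc fun t ht => ?_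
        by_cases hpos : 0 < deriv Ψ t
        · obtain ⟨h1, h2, h3⟩ := hd t ht hpos
          rw [indicator_of_mem (show t ∈ A from ⟨ht, h1, h2⟩)]
          exact ENNReal.ofReal_le_ofReal h3
        · rw [ENNReal.ofReal_of_nonpos (not_lt.1 hpos)]; exact zero_le
    _ ≤ ∫⁻ t, A.indicator (fun _ => ENNReal.ofReal K) t := setLIntegral_le_lintegral _ _
    _ = _ := lintegral_indicator_const hAmeas _

end OneDim

/-- A monotone vector field which is uniformly elliptic, at scale `δ`, away from `ball 0 κ`. -/
structure EllipticField {n : ℕ} (S : Eucl n → Eucl n →L[ℝ] ℝ) (M δ κ lam Lam : ℝ) : Prop where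
  lam_pos : 0 < lam
  lam_le : lam ≤ Lam
  measurable : Measurable S
  mono : ∀ a b, 0 ≤ (S b - S a) (b - a)
  bdd : ∃ C, ∀ a, ‖a‖ ≤ M → ‖S a‖ ≤ C
  coer : ∀ a b, ‖a‖ ≤ M → ‖b‖ ≤ M → κ ≤ max ‖a‖ ‖b‖ → ‖b - a‖ ≤ δ →
    lam * ‖b - a‖ ^ 2 ≤ (S b - S a) (b - a)
  cocoer : ∀ a b, ‖a‖ ≤ M → ‖b‖ ≤ M → κ ≤ max ‖a‖ ‖b‖ → ‖b - a‖ ≤ δ →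
    ‖S b - S a‖ ^ 2 ≤ Lam * (S b - S a) (b - a)
  jump : ∀ θ > 0, ∃ c > 0, ∀ a b, ‖a‖ ≤ M → ‖b‖ ≤ M → κ ≤ max ‖a‖ ‖b‖ → θ ≤ ‖b - a‖ →
    c ≤ (S b - S a) (b - a)

/-- A Lipschitz weak solution of `-div S(∇u) = f` in `ball x R`. -/
structure LipSolution {n : ℕ} (S : Eucl n → Eucl n →L[ℝ] ℝ) (u f : Eucl n → ℝ) (x : Eucl n)
    (R M : ℝ) (K N : ℝ≥0) : Prop where
  lip : LipschitzWith K u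
  grad_le : ∀ᵐ y, y ∈ ball x R → ‖gradient u y‖ ≤ M
  meas_f : Measurable f
  lintegral_le : ∀ A, MeasurableSet A → ∫⁻ y in A, ‖f y‖ₑ ≤ N * volume A ^ (2 / 3 : ℝ)
  euler : ∀ (φ : Eucl n → ℝ) (L : ℝ≥0), LipschitzWith L φ → ∀ ρ < R,
    (∀ y, y ∉ closedBall x ρ → φ y = 0) →
    ∫ y, S (gradient u y) (gradient φ y) = ∫ y, f y * φ y

section Pointwise

variable {n : ℕ}

theorem measurable_gradient (u : Eucl n → ℝ) : Measurable (gradient u) :=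
  ((InnerProductSpace.toDual ℝ (Eucl n)).symm.continuous.measurable).comp (measurable_fderiv ℝ u)

theorem gradient_eq_zero_of_isLocalMin {φ : Eucl n → ℝ} {y : Eucl n} (h : IsLocalMin φ y) :
    gradient φ y = 0 := by
  rw [gradient, h.fderiv_eq_zero, map_zero]

theorem norm_gradient (φ : Eucl n → ℝ) (y : Eucl n) : ‖gradient φ y‖ = ‖fderiv ℝ φ y‖ := by
  rw [gradient, LinearIsometryEquiv.norm_map]

theorem norm_gradient_le_of_lipschitz {φ : Eucl n → ℝ} {K : ℝ≥0} (h : LipschitzWith K φ)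
    (y : Eucl n) : ‖gradient φ y‖ ≤ K := by
  rw [norm_gradient]
  exact norm_fderiv_le_of_lipschitz ℝ h

theorem enorm_lineDeriv_le {φ : Eucl n → ℝ} {y e : Eucl n} (hd : DifferentiableAt ℝ φ y)
    (he : ‖e‖ ≤ 1) : ‖lineDeriv ℝ φ y e‖ₑ ≤ ENNReal.ofReal ‖gradient φ y‖ := by
  rw [hd.lineDeriv_eq_fderiv, ← ofReal_norm, norm_gradient]
  refine ENNReal.ofReal_le_ofReal ((ContinuousLinearMap.le_opNorm _ _).trans ?_)
  exact mul_le_of_le_one_right (norm_nonneg _) he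

/-- Difference quotient of `u` in direction `e` with step `h`. -/
def dq (u : Eucl n → ℝ) (e : Eucl n) (h : ℝ) (y : Eucl n) : ℝ := (u (y + h • e) - u y) / h

theorem abs_dq_le {u : Eucl n → ℝ} {K : ℝ≥0} (hu : LipschitzWith K u) {e : Eucl n}
    (he : ‖e‖ ≤ 1) {h : ℝ} (hh : 0 < h) (y : Eucl n) : |dq u e h y| ≤ K := by
  rw [dq, abs_div, abs_of_pos hh, div_le_iff₀ hh]
  have := hu.dist_le_mul (y + h • e) y
  rw [Real.dist_eq, dist_eq_norm, add_sub_cancel_left, norm_smul, Real.norm_of_nonneg hh.le]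
    at this
  refine this.trans ?_
  gcongr
  exact mul_le_of_le_one_right hh.le he

theorem lipschitzWith_dq {u : Eucl n → ℝ} {K : ℝ≥0} (hu : LipschitzWith K u) (e : Eucl n)
    (h : ℝ) : ∃ L, LipschitzWith L (dq u e h) := by
  have h1 : LipschitzWith K fun y => u (y + h • e) := by
    refine LipschitzWith.of_dist_le_mul fun a b => (hu.dist_le_mul _ _).trans ?_
    rw [dist_add_right]
  refine ⟨‖h⁻¹‖₊ * (K + K), ?_⟩
  have h2 := h1.sub hu
  refine LipschitzWith.of_dist_le_mul fun a b => ?_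
  have := h2.dist_le_mul a b
  simp only [Real.dist_eq, dq] at this ⊢
  rw [← sub_div, div_eq_inv_mul, abs_mul]
  push_cast at this ⊢
  rw [mul_assoc]
  exact mul_le_mul_of_nonneg_left this (abs_nonneg _)

theorem lipschitzWith_sq_mul {η ψ : Eucl n → ℝ} {ℓ L B : ℝ≥0} (hη : LipschitzWith ℓ η)
    (hη1 : ∀ y, |η y| ≤ 1) (hψ : LipschitzWith L ψ) (hψB : ∀ y, |ψ y| ≤ B) :
    ∃ L', LipschitzWith L' fun y => η y ^ 2 * ψ y := by
  refine ⟨2 * ℓ * B + L, LipschitzWith.of_dist_le_mul fun a b => ?_⟩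
  have h1 := hη.dist_le_mul a b
  have h2 := hψ.dist_le_mul a b
  rw [Real.dist_eq] at h1 h2 ⊢
  have e1 : η a ^ 2 * ψ a - η b ^ 2 * ψ b =
      (η a + η b) * (η a - η b) * ψ a + η b ^ 2 * (ψ a - ψ b) := by ring
  rw [e1]
  have ha := hη1 a
  have hb := hη1 b
  have h3 : |η a + η b| ≤ 2 := (abs_add_le _ _).trans (by linarith)
  have h4 : |η b ^ 2| ≤ 1 := by
    rw [abs_pow]; exact pow_le_one₀ (abs_nonneg _) hb
  calc _ ≤ |η a + η b| * |η a - η b| * |ψ a| + |η b ^ 2| * |ψ a - ψ b| := by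
        refine (abs_add_le _ _).trans ?_
        rw [abs_mul, abs_mul, abs_mul]
    _ ≤ 2 * (ℓ * dist a b) * B + 1 * (L * dist a b) := by
        gcongr
        exact hψB a
    _ = _ := by push_cast; ring

/-- The exceptional set, where ellipticity cannot be used. -/
def badSet (u : Eucl n → ℝ) (e : Eucl n) (κ δ h k : ℝ) : Set (Eucl n) :=
  {y | k < dq u e h y ∧ ¬ (κ ≤ max ‖gradient u y‖ ‖gradient u (y + h • e)‖ ∧
    ‖gradient u (y + h • e) - gradient u y‖ ≤ δ)}

theorem measurableSet_badSet {u : Eucl n → ℝ} (hu : Continuous u) (e : Eucl n) (κ δ h k : ℝ) :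
    MeasurableSet (badSet u e κ δ h k) := by
  have hg := measurable_gradient u
  have h1 : Measurable (dq u e h) := by
    have := hu.measurable
    unfold dq; fun_prop
  have h2 : Measurable fun y => max ‖gradient u y‖ ‖gradient u (y + h • e)‖ := by fun_prop
  have h3 : Measurable fun y => ‖gradient u (y + h • e) - gradient u y‖ := by fun_prop
  exact (measurableSet_lt measurable_const h1).inter
    ((measurableSet_le measurable_const h2).inter
      (measurableSet_le h3 measurable_const)).compl

theorem ae_translate {P : Eucl n → Prop} (h : ∀ᵐ y, P y) (v : Eucl n) : ∀ᵐ y, P (y + v) :=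
  (measurePreserving_add_right volume v).quasiMeasurePreserving.ae h

/-- Gradient of the test function `η² (D_h u - k)_+`. -/
theorem ae_gradient_test {u : Eucl n → ℝ} {K ℓ : ℝ≥0} (hu : LipschitzWith K u)
    {η : Eucl n → ℝ} (hη : LipschitzWith ℓ η) (e : Eucl n) (h k : ℝ) :
    ∀ᵐ y, gradient (fun y => η y ^ 2 * max (dq u e h y - k) 0) y =
      if k < dq u e h y then
        (η y ^ 2 / h) • (gradient u (y + h • e) - gradient u y) +
          (2 * η y * (dq u e h y - k)) • gradient η y
      else 0 := by
  have hd := hu.ae_differentiableAt (μ := volume)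
  filter_upwards [hd, ae_translate hd (h • e), hη.ae_differentiableAt (μ := volume)]
    with y h1 h2 h3
  split_ifs with hk
  · have hcont : Continuous (dq u e h) := (lipschitzWith_dq hu e h).choose_spec.continuous
    have heq : (fun y => η y ^ 2 * max (dq u e h y - k) 0) =ᶠ[nhds y]
        fun y => η y ^ 2 * (dq u e h y - k) := by
      filter_upwards [hcont.continuousAt.eventually (lt_mem_nhds hk)] with z hz
      rw [max_eq_left (by linarith)]
    have hu1 : HasFDerivAt u (fderiv ℝ u y) y := h1.hasFDerivAt
    have hu2 : HasFDerivAt (fun y => u (y + h • e)) (fderiv ℝ u (y + h • e)) y :=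
      (hasFDerivAt_comp_add_right (h • e)).2 h2.hasFDerivAt
    have hv : HasFDerivAt (fun y => dq u e h y - k)
        (h⁻¹ • (fderiv ℝ u (y + h • e) - fderiv ℝ u y)) y := by
      have := ((hu2.sub hu1).const_mul h⁻¹).sub_const k
      refine this.congr_of_eventuallyEq (Filter.Eventually.of_forall fun z => ?_)
      simp only [dq, Pi.sub_apply]; ring
    have hη' := h3.hasFDerivAt.pow 2
    have hprod := (hη'.mul hv).congr_of_eventuallyEq heq
    rw [gradient, hprod.fderiv]
    simp only [map_add, map_sub, map_smul, gradient, smul_smul, Nat.add_one_sub_one,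
      pow_one]
    congr 1
    simp only [nsmul_eq_mul]
    push_cast
    congr 1
    ring
  · refine gradient_eq_zero_of_isLocalMin (Filter.Eventually.of_forall fun z => ?_)
    simp only
    rw [max_eq_right (by linarith), mul_zero]
    exact mul_nonneg (sq_nonneg _) (le_max_right _ _)

theorem good_point_lower {S : Eucl n →L[ℝ] ℝ} {d g : Eucl n} {Lam ℓ h η ψ : ℝ}
    (hh : 0 < h) (hLam : 0 ≤ Lam) (hψ : 0 ≤ ψ) (hη : 0 ≤ η) (hg : ‖g‖ ≤ ℓ)
    (hS : ‖S‖ ^ 2 ≤ Lam * S d) :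
    3 / 4 * (η ^ 2 * (S d / h ^ 2)) ≤
      S ((η ^ 2 / h) • d + (2 * η * ψ) • g) / h + 4 * Lam * ℓ ^ 2 * ψ ^ 2 := by
  have hℓ : 0 ≤ ℓ := (norm_nonneg g).trans hg
  have h1 : -(‖S‖ * ℓ) ≤ S g := by
    have := (abs_le.1 ((ContinuousLinearMap.le_opNorm S g))).1
    have h2 : ‖S‖ * ‖g‖ ≤ ‖S‖ * ℓ := by gcongr
    linarith
  simp only [map_add, map_smul, smul_eq_mul]
  have h2 : -(2 * η * ψ * (‖S‖ * ℓ)) ≤ 2 * η * ψ * S g := by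
    have := mul_le_mul_of_nonneg_left h1 (by positivity : 0 ≤ 2 * η * ψ)
    linarith
  have key : 2 * η * ψ * (‖S‖ * ℓ) / h ≤
      1 / 4 * (η ^ 2 * (S d / h ^ 2)) + 4 * Lam * ℓ ^ 2 * ψ ^ 2 := by
    rcases hLam.eq_or_lt with h0 | h0
    · rw [← h0] at hS ⊢
      have : ‖S‖ = 0 := by
        have := norm_nonneg S
        nlinarith
      have hS0 : S = 0 := norm_eq_zero.1 this
      simp [hS0]
    · have h3 : S d ≥ ‖S‖ ^ 2 / Lam := by
        rw [ge_iff_le, div_le_iff₀ h0]; linarith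
      have h4 : 1 / 4 * (η ^ 2 * (‖S‖ ^ 2 / Lam / h ^ 2)) ≤ 1 / 4 * (η ^ 2 * (S d / h ^ 2)) := by
        gcongr
      refine le_trans ?_ (add_le_add_left h4 _)
      have : 1 / 4 * (η ^ 2 * (‖S‖ ^ 2 / Lam / h ^ 2)) + 4 * Lam * ℓ ^ 2 * ψ ^ 2
          - 2 * η * ψ * (‖S‖ * ℓ) / h = Lam * (η * ‖S‖ / (2 * Lam * h) - 2 * ℓ * ψ) ^ 2 := by
        field_simp
        ring
      nlinarith [mul_nonneg h0.le (sq_nonneg (η * ‖S‖ / (2 * Lam * h) - 2 * ℓ * ψ))]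
  have e1 : (η ^ 2 / h * S d + 2 * η * ψ * S g) / h =
      η ^ 2 * (S d / h ^ 2) + 2 * η * ψ * S g / h := by field_simp
  rw [e1]
  have : -(2 * η * ψ * (‖S‖ * ℓ) / h) ≤ 2 * η * ψ * S g / h := by
    rw [← neg_div]; gcongr
  linarith

theorem bad_point_lower {S : Eucl n →L[ℝ] ℝ} {d g : Eucl n} {C ℓ h η ψ B : ℝ}
    (hh : 0 < h) (hψ : 0 ≤ ψ) (hψB : ψ ≤ B) (hη : 0 ≤ η) (hη1 : η ≤ 1) (hg : ‖g‖ ≤ ℓ)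
    (hS : ‖S‖ ≤ C) (hd : 0 ≤ S d) :
    3 / 4 * (η ^ 2 * (S d / h ^ 2)) ≤
      S ((η ^ 2 / h) • d + (2 * η * ψ) • g) / h + 2 * C * ℓ * B / h := by
  have hℓ : 0 ≤ ℓ := (norm_nonneg g).trans hg
  have hC : 0 ≤ C := (norm_nonneg S).trans hS
  have h1 : -(C * ℓ) ≤ S g := by
    have := (abs_le.1 ((ContinuousLinearMap.le_opNorm S g))).1
    have h2 : ‖S‖ * ‖g‖ ≤ C * ℓ := by gcongr
    linarith
  have h2 : -(2 * 1 * B * (C * ℓ)) ≤ 2 * η * ψ * S g := by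
    have h3 := mul_le_mul_of_nonneg_left h1 (by positivity : 0 ≤ 2 * η * ψ)
    have h4 : 2 * η * ψ * (C * ℓ) ≤ 2 * 1 * B * (C * ℓ) := by gcongr
    linarith
  simp only [map_add, map_smul, smul_eq_mul]
  have e1 : (η ^ 2 / h * S d + 2 * η * ψ * S g) / h =
      η ^ 2 * (S d / h ^ 2) + 2 * η * ψ * S g / h := by field_simp
  have h5 : -(2 * C * ℓ * B / h) ≤ 2 * η * ψ * S g / h := by
    rw [← neg_div]; gcongr; linarith
  have h6 : 0 ≤ η ^ 2 * (S d / h ^ 2) := by positivity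
  rw [e1]
  linarith

theorem mul_ofReal_le_young (F : ℝ≥0∞) {t c : ℝ} (hc : 0 < c) :
    F * ENNReal.ofReal t ≤ ENNReal.ofReal (1 / c) * F ^ 2 + ENNReal.ofReal (c * t ^ 2 / 4) := by
  rcases eq_or_ne F ⊤ with rfl | hF
  · have : ENNReal.ofReal (1 / c) ≠ 0 := by
      simp [hc]
    rw [show (⊤ : ℝ≥0∞) ^ 2 = ⊤ by simp, ENNReal.mul_top this]
    simp
  · lift F to ℝ≥0 using hF
    rw [← ENNReal.ofReal_coe_nnreal, ← ENNReal.ofReal_pow F.coe_nonneg,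
      ← ENNReal.ofReal_mul F.coe_nonneg,
      ← ENNReal.ofReal_mul (by positivity), ← ENNReal.ofReal_add (by positivity) (by positivity)]
    refine ENNReal.ofReal_le_ofReal ?_
    have : 1 / c * (F : ℝ) ^ 2 + c * t ^ 2 / 4 - F * t = c * (F / c - t / 2) ^ 2 := by
      field_simp; ring
    nlinarith [mul_nonneg hc.le (sq_nonneg ((F : ℝ) / c - t / 2))]

end Pointwise

section Caccioppoli

variable {n : ℕ}

theorem measurable_clm_apply {S : Eucl n → Eucl n →L[ℝ] ℝ} (hS : Measurable S)
    {a g : Eucl n → Eucl n} (ha : Measurable a) (hg : Measurable g) :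
    Measurable fun y => S (a y) (g y) := by
  have : Continuous fun p : (Eucl n →L[ℝ] ℝ) × Eucl n => p.1 p.2 :=
    isBoundedBilinearMap_apply.continuous
  exact this.measurable.comp ((hS.comp ha).prodMk hg)

/-- Average of `|f|` over the segment `[y, y + h e]`. -/
def lineAvg (f : Eucl n → ℝ) (e : Eucl n) (h : ℝ) (y : Eucl n) : ℝ≥0∞ :=
  ∫⁻ s in Ioc 0 h, ENNReal.ofReal h⁻¹ * ‖f (y + s • e)‖ₑ

theorem lintegral_Ioc_ofReal_inv {h : ℝ} (hh : 0 < h) :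
    ∫⁻ _ in Ioc 0 h, ENNReal.ofReal h⁻¹ = 1 := by
  rw [setLIntegral_const, Real.volume_Ioc, sub_zero, ← ENNReal.ofReal_mul (by positivity),
    inv_mul_cancel₀ hh.ne', ENNReal.ofReal_one]

theorem measurable_lineAvg {f : Eucl n → ℝ} (hf : Measurable f) (e : Eucl n) (h : ℝ) :
    Measurable (lineAvg f e h) := by
  have : Measurable fun q : Eucl n × ℝ => ENNReal.ofReal h⁻¹ * ‖f (q.1 + q.2 • e)‖ₑ := by
    fun_prop
  exact this.lintegral_prod_right'

theorem lineAvg_eq {f : Eucl n → ℝ} (e : Eucl n) (h : ℝ) (y : Eucl n) :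
    lineAvg f e h y = ENNReal.ofReal h⁻¹ * ∫⁻ s in Ioc 0 h, ‖f (y + s • e)‖ₑ := by
  rw [lineAvg, lintegral_const_mul' _ _ ENNReal.ofReal_ne_top]

theorem setLIntegral_lineAvg_le {f : Eucl n → ℝ} (hf : Measurable f) {N : ℝ≥0}
    (hN : ∀ A, MeasurableSet A → ∫⁻ y in A, ‖f y‖ₑ ≤ N * volume A ^ (2 / 3 : ℝ))
    (e : Eucl n) {h : ℝ} (hh : 0 < h) {A : Set (Eucl n)} (hA : MeasurableSet A) :
    ∫⁻ y in A, lineAvg f e h y ≤ N * volume A ^ (2 / 3 : ℝ) := by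
  have hm : Measurable fun q : Eucl n × ℝ => ENNReal.ofReal h⁻¹ * ‖f (q.1 + q.2 • e)‖ₑ := by
    fun_prop
  unfold lineAvg
  rw [lintegral_lintegral_swap hm.aemeasurable]
  calc ∫⁻ s in Ioc 0 h, ∫⁻ y in A, ENNReal.ofReal h⁻¹ * ‖f (y + s • e)‖ₑ
      ≤ ∫⁻ s in Ioc 0 h, ENNReal.ofReal h⁻¹ * (N * volume A ^ (2 / 3 : ℝ)) := by
        refine lintegral_mono fun s => ?_
        rw [lintegral_const_mul' _ _ ENNReal.ofReal_ne_top]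
        gcongr
        have h1 : MeasurableSet ((fun y => y - s • e) ⁻¹' A) := by
          exact hA.preimage (by fun_prop)
        have h2 := hN _ h1
        rw [(measurePreserving_sub_right volume (s • e)).measure_preimage hA.nullMeasurableSet]
          at h2
        refine le_trans (le_of_eq ?_) h2
        rw [← lintegral_indicator hA, ← lintegral_indicator h1,
          ← lintegral_add_right_eq_self
            (((fun y => y - s • e) ⁻¹' A).indicator fun y => ‖f y‖ₑ) (s • e)]
        refine lintegral_congr fun y => ?_
        have h3 : y + s • e ∈ (fun y => y - s • e) ⁻¹' A ↔ y ∈ A := by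
          rw [mem_preimage, add_sub_cancel_right]
        by_cases hy : y ∈ A
        · rw [indicator_of_mem hy, indicator_of_mem (h3.2 hy)]
        · rw [indicator_of_notMem hy, indicator_of_notMem (fun h => hy (h3.1 h))]
    _ = N * volume A ^ (2 / 3 : ℝ) := by
        have hm1 : Measurable fun _ : ℝ => ENNReal.ofReal h⁻¹ := measurable_const
        rw [lintegral_mul_const _ hm1, lintegral_Ioc_ofReal_inv hh, one_mul]

theorem setLIntegral_sq_lineAvg_le {f : Eucl n → ℝ} (hf : Measurable f) {e : Eucl n}
    (he : ‖e‖ ≤ 1) {h : ℝ} (hh : 0 < h) {x : Eucl n} {ρ R : ℝ} (hR : ρ + h < R) :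
    ∫⁻ y in closedBall x ρ, lineAvg f e h y ^ 2 ≤ ∫⁻ y in ball x R, ‖f y‖ₑ ^ 2 := by
  have hm : Measurable fun q : Eucl n × ℝ =>
      ENNReal.ofReal h⁻¹ * ‖f (q.1 + q.2 • e)‖ₑ ^ 2 := by
    fun_prop
  have hm1 : Measurable fun _ : ℝ => ENNReal.ofReal h⁻¹ := measurable_const
  calc ∫⁻ y in closedBall x ρ, lineAvg f e h y ^ 2
      ≤ ∫⁻ y in closedBall x ρ, ∫⁻ s in Ioc 0 h,
          ENNReal.ofReal h⁻¹ * ‖f (y + s • e)‖ₑ ^ 2 := by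
        refine lintegral_mono fun y => ?_
        exact sq_lintegral_mul_le_of_lintegral_eq_one hm1 (by fun_prop)
          (lintegral_Ioc_ofReal_inv hh)
    _ = ∫⁻ s in Ioc 0 h, ∫⁻ y in closedBall x ρ,
          ENNReal.ofReal h⁻¹ * ‖f (y + s • e)‖ₑ ^ 2 := by
        rw [lintegral_lintegral_swap hm.aemeasurable]
    _ ≤ ∫⁻ s in Ioc 0 h, ENNReal.ofReal h⁻¹ * ∫⁻ y in ball x R, ‖f y‖ₑ ^ 2 := by
        refine setLIntegral_mono' measurableSet_Ioc fun s hs => ?_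
        rw [lintegral_const_mul' _ _ ENNReal.ofReal_ne_top]
        refine mul_le_mul_right ?_ _
        rw [← lintegral_indicator measurableSet_closedBall, ← lintegral_indicator
          measurableSet_ball, ← lintegral_add_right_eq_self (fun y => (ball x R).indicator _ y)
          (s • e)]
        refine lintegral_mono fun y => ?_
        by_cases hy : y ∈ closedBall x ρ
        · rw [indicator_of_mem hy, indicator_of_mem]
          rw [mem_ball]
          have h1 : dist (y + s • e) y ≤ h := by
            rw [dist_eq_norm, add_sub_cancel_left, norm_smul, Real.norm_of_nonneg hs.1.le]
            nlinarith [norm_nonneg e, hs.1, hs.2]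
          linarith [dist_triangle (y + s • e) y x, mem_closedBall.1 hy]
        · rw [indicator_of_notMem hy]; exact zero_le
    _ = _ := by
        rw [lintegral_mul_const _ hm1, lintegral_Ioc_ofReal_inv hh, one_mul]

theorem good_point_upper {S : Eucl n →L[ℝ] ℝ} {d g : Eucl n} {lam ℓ h η ψ : ℝ} (F : ℝ≥0∞)
    (hh : 0 < h) (hlam : 0 < lam) (hψ : 0 ≤ ψ) (hη : 0 ≤ η) (hη1 : η ≤ 1) (hg : ‖g‖ ≤ ℓ)
    (hS : lam * ‖d‖ ^ 2 ≤ S d) :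
    F * ENNReal.ofReal ‖(η ^ 2 / h) • d + (2 * η * ψ) • g‖ ≤
      ENNReal.ofReal (1 / 4 * (η ^ 2 * (S d / h ^ 2))) +
        (ENNReal.ofReal (2 / lam) * F ^ 2 + ENNReal.ofReal (lam * ℓ ^ 2 * ψ ^ 2)) := by
  have hℓ : 0 ≤ ℓ := (norm_nonneg g).trans hg
  have h1 : ‖(η ^ 2 / h) • d + (2 * η * ψ) • g‖ ≤ η ^ 2 / h * ‖d‖ + 2 * η * ψ * ℓ := by
    refine (norm_add_le _ _).trans ?_
    rw [norm_smul, norm_smul, Real.norm_of_nonneg (by positivity),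
      Real.norm_of_nonneg (by positivity)]
    gcongr
  have hη2 : η ^ 2 ≤ 1 := pow_le_one₀ hη hη1
  calc F * ENNReal.ofReal ‖(η ^ 2 / h) • d + (2 * η * ψ) • g‖
      ≤ F * ENNReal.ofReal (η ^ 2 / h * ‖d‖) + F * ENNReal.ofReal (2 * η * ψ * ℓ) := by
        rw [← mul_add, ← ENNReal.ofReal_add (by positivity) (by positivity)]
        gcongr
    _ ≤ (ENNReal.ofReal (1 / lam) * F ^ 2 + ENNReal.ofReal (lam * (η ^ 2 / h * ‖d‖) ^ 2 / 4)) +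
        (ENNReal.ofReal (1 / lam) * F ^ 2 + ENNReal.ofReal (lam * (2 * η * ψ * ℓ) ^ 2 / 4)) :=
        add_le_add (mul_ofReal_le_young F hlam) (mul_ofReal_le_young F hlam)
    _ ≤ (ENNReal.ofReal (1 / lam) * F ^ 2 + ENNReal.ofReal (1 / 4 * (η ^ 2 * (S d / h ^ 2)))) +
        (ENNReal.ofReal (1 / lam) * F ^ 2 + ENNReal.ofReal (lam * ℓ ^ 2 * ψ ^ 2)) := by
        refine add_le_add (add_le_add le_rfl (ENNReal.ofReal_le_ofReal ?_))
          (add_le_add le_rfl (ENNReal.ofReal_le_ofReal ?_))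
        · calc lam * (η ^ 2 / h * ‖d‖) ^ 2 / 4 = 1 / 4 * (η ^ 2 * (η ^ 2 * (lam * ‖d‖ ^ 2) / h ^ 2)) := by
                field_simp
            _ ≤ 1 / 4 * (η ^ 2 * (1 * S d / h ^ 2)) := by gcongr
            _ = _ := by rw [one_mul]
        · calc lam * (2 * η * ψ * ℓ) ^ 2 / 4 = η ^ 2 * (lam * ℓ ^ 2 * ψ ^ 2) := by ring
            _ ≤ 1 * (lam * ℓ ^ 2 * ψ ^ 2) := by gcongr
            _ = _ := one_mul _
    _ = _ := by
        rw [show (2 / lam) = 1 / lam + 1 / lam by ring, ENNReal.ofReal_add (by positivity)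
          (by positivity)]
        ring

/-- Difference quotient energy of the field. -/
def energy (S : Eucl n → Eucl n →L[ℝ] ℝ) (u : Eucl n → ℝ) (e : Eucl n) (h : ℝ) (y : Eucl n) : ℝ :=
  (S (gradient u (y + h • e)) - S (gradient u y)) (gradient u (y + h • e) - gradient u y) / h ^ 2

theorem measurable_energy {S : Eucl n → Eucl n →L[ℝ] ℝ} (hS : Measurable S) (u : Eucl n → ℝ)
    (e : Eucl n) (h : ℝ) : Measurable (energy S u e h) := by
  have hg := measurable_gradient u
  have h1 : Measurable fun y => gradient u (y + h • e) := by fun_prop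
  have h2 := measurable_clm_apply hS h1 (h1.sub hg)
  have h3 := measurable_clm_apply hS hg (h1.sub hg)
  exact (h2.sub h3).div_const _

end Caccioppoli

section CaccioppoliMain

variable {n : ℕ} {S : Eucl n → Eucl n →L[ℝ] ℝ} {u f : Eucl n → ℝ} {x : Eucl n}
  {R M δ κ lam Lam : ℝ} {K N : ℝ≥0}

theorem LipSolution.integrable_f_mul (sol : LipSolution S u f x R M K N) {φ : Eucl n → ℝ}
    {B : ℝ} (hφ : Continuous φ) (hB : ∀ y, |φ y| ≤ B) {ρ : ℝ}
    (hs : ∀ y, y ∉ closedBall x ρ → φ y = 0) : Integrable fun y => f y * φ y := by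
  rw [← integrableOn_iff_integrable_of_support_subset (s := closedBall x ρ)
    (fun y hy => by
      by_contra h; exact hy (by simp [hs y h]))]
  have h1 : IntegrableOn f (closedBall x ρ) := by
    refine ⟨sol.meas_f.aestronglyMeasurable, ?_⟩
    refine (sol.lintegral_le _ measurableSet_closedBall).trans_lt ?_
    exact ENNReal.mul_lt_top ENNReal.coe_lt_top
      (ENNReal.rpow_lt_top_of_nonneg (by norm_num) measure_closedBall_lt_top.ne)
  exact h1.mul_bdd (c := B) hφ.aestronglyMeasurable
    (Filter.Eventually.of_forall fun y => by rw [Real.norm_eq_abs]; exact hB y)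

theorem integrable_clm_apply {a g : Eucl n → Eucl n} (hS : Measurable S) (ha : Measurable a)
    (hg : Measurable g) {C L : ℝ} {ρ : ℝ} (hC : ∀ᵐ y, y ∈ closedBall x ρ → ‖S (a y)‖ ≤ C)
    (hL : ∀ y, ‖g y‖ ≤ L) (hs : ∀ y, y ∉ closedBall x ρ → g y = 0) (hC0 : 0 ≤ C) :
    Integrable fun y => S (a y) (g y) := by
  refine integrable_of_abs_le_of_support (A := C * L) (R := ρ) (z := x)
    (measurable_clm_apply hS ha hg).aestronglyMeasurable ?_
    (fun y hy => by simp [hs y hy])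
  have hL0 : 0 ≤ L := (norm_nonneg _).trans (hL x)
  filter_upwards [hC] with y hy
  by_cases hyD : y ∈ closedBall x ρ
  · refine (ContinuousLinearMap.le_opNorm (S (a y)) (g y)).trans ?_
    exact mul_le_mul (hy hyD) (hL y) (norm_nonneg _) hC0
  · rw [hs y hyD]; simp; positivity

/-- Testing the equation with a function and with its translate. -/
theorem LipSolution.euler_sub (sol : LipSolution S u f x R M K N)
    (ell : EllipticField S M δ κ lam Lam) {φ : Eucl n → ℝ} {L : ℝ≥0} (hφ : LipschitzWith L φ)
    {B : ℝ} (hB : ∀ y, |φ y| ≤ B) {ρ h : ℝ} (hh : 0 < h) (hR : ρ + h < R) {e : Eucl n}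
    (he : ‖e‖ ≤ 1) (hs : ∀ y, y ∉ closedBall x ρ → φ y = 0)
    (hs' : ∀ y, y ∉ closedBall x ρ → gradient φ y = 0) :
    Integrable (fun y => (S (gradient u (y + h • e)) - S (gradient u y)) (gradient φ y)) ∧
    ∫ y, (S (gradient u (y + h • e)) - S (gradient u y)) (gradient φ y) =
      ∫ y, f y * (φ (y - h • e) - φ y) := by
  have hφ' : LipschitzWith L fun y => φ (y - h • e) := by
    refine LipschitzWith.of_dist_le_mul fun a b => (hφ.dist_le_mul _ _).trans ?_
    rw [dist_sub_right]
  have hdist : ∀ y : Eucl n, dist (y + h • e) y ≤ h := fun y => by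
    rw [dist_eq_norm, add_sub_cancel_left, norm_smul, Real.norm_of_nonneg hh.le]
    exact mul_le_of_le_one_right hh.le he
  have hsupp' : ∀ y, y ∉ closedBall x (ρ + h) → φ (y - h • e) = 0 := by
    intro y hy
    refine hs _ fun hy' => hy ?_
    rw [mem_closedBall] at hy' ⊢
    have := hdist (y - h • e)
    rw [sub_add_cancel] at this
    linarith [dist_triangle y (y - h • e) x]
  have e1 := sol.euler φ L hφ ρ (by linarith) hs
  have e2 := sol.euler (fun y => φ (y - h • e)) L hφ' (ρ + h) hR hsupp'
  have e3 : ∫ y, S (gradient u y) (gradient (fun y => φ (y - h • e)) y) =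
      ∫ y, S (gradient u (y + h • e)) (gradient φ y) := by
    rw [← integral_add_right_eq_self _ (h • e)]
    refine integral_congr_ae (Filter.Eventually.of_forall fun y => ?_)
    simp only [gradient]
    rw [fderiv_comp_sub]
    simp
  rw [e3] at e2
  obtain ⟨C, hC⟩ := ell.bdd
  have hgm := measurable_gradient u
  have hball : closedBall x ρ ⊆ ball x R := closedBall_subset_ball (by linarith)
  have hi1 : Integrable fun y => S (gradient u y) (gradient φ y) := by
    refine integrable_clm_apply (C := max C 0) (L := L) (ρ := ρ) (x := x) ell.measurable hgm
      (measurable_gradient φ) ?_ (norm_gradient_le_of_lipschitz hφ) hs' (le_max_right _ _)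
    filter_upwards [sol.grad_le] with y hy hyD
    exact (hC _ (hy (hball hyD))).trans (le_max_left _ _)
  have hi2 : Integrable fun y => S (gradient u (y + h • e)) (gradient φ y) := by
    refine integrable_clm_apply (a := fun y => gradient u (y + h • e)) (C := max C 0) (L := L)
      (ρ := ρ) (x := x) ell.measurable (by fun_prop)
      (measurable_gradient φ) ?_ (norm_gradient_le_of_lipschitz hφ) hs' (le_max_right _ _)
    filter_upwards [ae_translate sol.grad_le (h • e)] with y hy hyD
    refine (hC _ (hy ?_)).trans (le_max_left _ _)
    rw [mem_ball]
    linarith [dist_triangle (y + h • e) y x, hdist y, mem_closedBall.1 hyD]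
  refine ⟨hi2.sub hi1, ?_⟩
  have hf1 := sol.integrable_f_mul hφ.continuous hB hs
  have hf2 := sol.integrable_f_mul hφ'.continuous (fun y => hB _) hsupp'
  simp only [sub_apply, mul_sub]
  rw [integral_sub hi2 hi1, integral_sub hf2 hf1, e1, e2]

set_option maxHeartbeats 1000000 in
/-- Caccioppoli inequality for difference quotients. -/
theorem LipSolution.caccioppoli (sol : LipSolution S u f x R M K N)
    (ell : EllipticField S M δ κ lam Lam) {e : Eucl n} (he : ‖e‖ ≤ 1)
    {η : Eucl n → ℝ} {ℓ : ℝ≥0} (hη : LipschitzWith ℓ η) (hη0 : ∀ y, 0 ≤ η y)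
    (hη1 : ∀ y, η y ≤ 1) {ρ : ℝ} (hρ : ρ < R) (hηs : ∀ y, y ∉ closedBall x ρ → η y = 0) (k : ℝ) :
    ∃ C : ℝ, 0 ≤ C ∧ ∀ h, 0 < h → ρ + h < R →
      ∫⁻ y in {y | k < dq u e h y}, ENNReal.ofReal (η y ^ 2 * energy S u e h y) ≤
        ENNReal.ofReal (10 * Lam * ℓ ^ 2) *
            (∫⁻ y in closedBall x ρ, ENNReal.ofReal (max (dq u e h y - k) 0 ^ 2)) +
          ENNReal.ofReal (4 / lam) * (∫⁻ y in ball x R, ‖f y‖ₑ ^ 2) +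
          ENNReal.ofReal (C / h) * (volume (badSet u e κ δ h k ∩ closedBall x ρ) +
            N * volume (badSet u e κ δ h k ∩ closedBall x ρ) ^ (2 / 3 : ℝ)) := by
  obtain ⟨CS, hCS⟩ := ell.bdd
  set B : ℝ≥0 := K + ‖k‖₊ with hBdef
  set C1 : ℝ := 2 * (2 * max CS 0) * ℓ * B with hC1
  set C3 : ℝ := 2 * max M 0 + 2 * B * ℓ * (R - ρ) with hC3
  have hC1n : 0 ≤ C1 := by positivity
  have hC3n : 0 ≤ C3 := by
    have : 0 ≤ R - ρ := by linarith
    positivity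
  have hlamp := ell.lam_pos
  have hLam : 0 < Lam := hlamp.trans_le ell.lam_le
  refine ⟨2 * (C1 + C3), by positivity, fun h hh hρh => ?_⟩
  set D := closedBall x ρ with hD
  set P := {y | k < dq u e h y} with hP
  set Bd := badSet u e κ δ h k ∩ D with hBd
  set φ : Eucl n → ℝ := fun y => η y ^ 2 * max (dq u e h y - k) 0 with hφdef
  set J : Eucl n → ℝ := energy S u e h with hJ
  set X : Eucl n → ℝ := P.indicator fun y => η y ^ 2 * J y with hX
  set F : Eucl n → ℝ≥0∞ := lineAvg f e h with hF
  set ψ : Eucl n → ℝ := fun y => max (dq u e h y - k) 0 with hψdef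
  obtain ⟨Lq, hLq⟩ := lipschitzWith_dq sol.lip e h
  have hψ0 : ∀ y, 0 ≤ ψ y := fun y => le_max_right _ _
  have hψB : ∀ y, ψ y ≤ B := fun y => by
    have h1 := (abs_le.1 (abs_dq_le sol.lip he hh y)).2
    have h2 := neg_abs_le k
    simp only [hψdef, hBdef]
    push_cast
    rw [Real.norm_eq_abs]
    exact max_le (by linarith) (by positivity)
  have hψabs : ∀ y, |ψ y| ≤ B := fun y => by rw [abs_of_nonneg (hψ0 y)]; exact hψB y
  have hψL : LipschitzWith Lq ψ := by
    have h1 : LipschitzWith Lq fun y => dq u e h y - k := by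
      refine LipschitzWith.of_dist_le_mul fun a b => ?_
      rw [dist_sub_right]; exact hLq.dist_le_mul a b
    exact h1.max_const 0
  have hηabs : ∀ y, |η y| ≤ 1 := fun y => by rw [abs_of_nonneg (hη0 y)]; exact hη1 y
  obtain ⟨L, hφL⟩ := lipschitzWith_sq_mul hη hηabs hψL hψabs
  have hφ0 : ∀ y, 0 ≤ φ y := fun y => mul_nonneg (sq_nonneg _) (hψ0 y)
  have hφB : ∀ y, |φ y| ≤ B := fun y => by
    rw [abs_of_nonneg (hφ0 y)]
    exact (mul_le_of_le_one_left (hψ0 y) (pow_le_one₀ (hη0 y) (hη1 y))).trans (hψB y)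
  have hφs : ∀ y, y ∉ D → φ y = 0 := fun y hy => by simp [hφdef, hηs y hy]
  have hφs' : ∀ y, y ∉ D → gradient φ y = 0 := fun y hy =>
    gradient_eq_zero_of_isLocalMin (Filter.Eventually.of_forall fun z => by
      rw [hφs y hy]; exact hφ0 z)
  obtain ⟨hGi, hGe⟩ := sol.euler_sub ell hφL hφB hh hρh he hφs hφs'
  set G : Eucl n → ℝ := fun y =>
    (S (gradient u (y + h • e)) - S (gradient u y)) (gradient φ y) with hG
  -- measurability
  have hPm : MeasurableSet P := measurableSet_lt measurable_const hLq.continuous.measurable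
  have hDm : MeasurableSet D := measurableSet_closedBall
  have hBdm : MeasurableSet Bd := (measurableSet_badSet sol.lip.continuous e κ δ h k).inter hDm
  have hJm : Measurable J := measurable_energy ell.measurable u e h
  have hηm : Measurable η := hη.continuous.measurable
  have hψm : Measurable ψ := hψL.continuous.measurable
  have hXm : Measurable X := ((hηm.pow_const 2).mul hJm).indicator hPm
  have hFm : Measurable F := measurable_lineAvg sol.meas_f e h
  have hJ0 : ∀ y, 0 ≤ J y := fun y => div_nonneg (ell.mono _ _) (sq_nonneg h)
  have hX0 : ∀ y, 0 ≤ X y := fun y => indicator_nonneg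
    (fun z _ => mul_nonneg (sq_nonneg _) (hJ0 z)) y
  have hXs : ∀ y, y ∉ D → X y = 0 := fun y hy => by simp [hX, indicator, hηs y hy]
  -- pointwise facts
  have hdist : ∀ y : Eucl n, dist (y + h • e) y ≤ h := fun y => by
    rw [dist_eq_norm, add_sub_cancel_left, norm_smul, Real.norm_of_nonneg hh.le]
    exact mul_le_of_le_one_right hh.le he
  have hab : ∀ᵐ y, y ∈ D → ‖gradient u y‖ ≤ M ∧ ‖gradient u (y + h • e)‖ ≤ M := by
    filter_upwards [sol.grad_le, ae_translate sol.grad_le (h • e)] with y h1 h2 hy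
    refine ⟨h1 (closedBall_subset_ball hρ hy), h2 ?_⟩
    rw [mem_ball]
    linarith [dist_triangle (y + h • e) y x, hdist y, mem_closedBall.1 hy]
  have hgη : ∀ y, ‖gradient η y‖ ≤ ℓ := norm_gradient_le_of_lipschitz hη
  set Y : Eucl n → ℝ := fun y => D.indicator (fun y => 4 * Lam * ℓ ^ 2 * ψ y ^ 2) y +
    Bd.indicator (fun _ => C1 / h) y with hY
  have hY0 : ∀ y, 0 ≤ Y y := fun y => add_nonneg
    (indicator_nonneg (fun z _ => by positivity) y) (indicator_nonneg (fun z _ => by positivity) y)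
  have hlow : ∀ᵐ y, 3 / 4 * X y ≤ G y / h + Y y := by
    filter_upwards [hab, ae_gradient_test sol.lip hη e h k] with y hy hgr
    by_cases hyD : y ∈ D
    swap
    · rw [hXs y hyD, hG]
      simp only [hφs' y hyD, map_zero, zero_div, mul_zero, zero_add]
      exact hY0 y
    obtain ⟨ha, hb⟩ := hy hyD
    by_cases hk : k < dq u e h y
    swap
    · rw [if_neg hk] at hgr
      have : X y = 0 := indicator_of_notMem (show y ∉ P from hk) _
      rw [this, hG]
      simp only [hφdef, hgr, map_zero, zero_div, mul_zero, zero_add]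
      exact hY0 y
    rw [if_pos hk] at hgr
    have hXy : X y = η y ^ 2 * J y := indicator_of_mem (show y ∈ P from hk) _
    have hψy : dq u e h y - k = ψ y := (max_eq_left (by linarith)).symm
    rw [hψy] at hgr
    rw [hXy, hJ, energy, hG]
    simp only [hφdef, hgr]
    by_cases hbad : y ∈ badSet u e κ δ h k
    · refine (bad_point_lower (C := 2 * max CS 0) (ℓ := ℓ) (B := B) hh (hψ0 y) (hψB y) (hη0 y)
        (hη1 y) (hgη y) ?_ (ell.mono _ _)).trans ?_
      · refine (norm_sub_le _ _).trans ?_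
        have h1 := (hCS _ ha).trans (le_max_left CS 0)
        have h2 := (hCS _ hb).trans (le_max_left CS 0)
        linarith
      · have h1 : C1 / h ≤ Y y := by
          rw [hY]
          simp only
          rw [indicator_of_mem (show y ∈ Bd from ⟨hbad, hyD⟩)]
          exact le_add_of_nonneg_left (indicator_nonneg (fun z _ => by positivity) y)
        exact add_le_add le_rfl h1
    · have hgood := not_not.1 fun h' => hbad ⟨hk, h'⟩
      refine (good_point_lower (Lam := Lam) (ℓ := ℓ) hh hLam.le (hψ0 y) (hη0 y) (hgη y)
        (ell.cocoer _ _ ha hb hgood.1 hgood.2)).trans ?_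
      have h1 : 4 * Lam * ℓ ^ 2 * ψ y ^ 2 ≤ Y y := by
        rw [hY]
        simp only
        rw [indicator_of_mem hyD]
        exact le_add_of_nonneg_right (indicator_nonneg (fun z _ => by positivity) y)
      exact add_le_add le_rfl h1
  have hup : ∀ᵐ y, F y * ‖lineDeriv ℝ φ y e‖ₑ ≤ ENNReal.ofReal (1 / 4 * X y) +
      (D.indicator (fun y => ENNReal.ofReal (2 / lam) * F y ^ 2 +
        ENNReal.ofReal (lam * ℓ ^ 2 * ψ y ^ 2)) y +
        Bd.indicator (fun y => ENNReal.ofReal (C3 / h) * F y) y) := by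
    filter_upwards [hab, ae_gradient_test sol.lip hη e h k, hφL.ae_differentiableAt]
      with y hy hgr hd
    have h1 := enorm_lineDeriv_le hd he
    refine (mul_le_mul_right h1 (F y)).trans ?_
    by_cases hyD : y ∈ D
    swap
    · rw [show gradient (fun y => η y ^ 2 * ψ y) y = 0 from hφs' y hyD]; simp
    obtain ⟨ha, hb⟩ := hy hyD
    by_cases hk : k < dq u e h y
    swap
    · rw [if_neg hk] at hgr
      rw [hgr]; simp
    rw [if_pos hk] at hgr
    have hXy : X y = η y ^ 2 * J y := indicator_of_mem (show y ∈ P from hk) _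
    have hψy : dq u e h y - k = ψ y := (max_eq_left (by linarith)).symm
    rw [hψy] at hgr
    rw [hXy, hJ, energy, hgr]
    by_cases hbad : y ∈ badSet u e κ δ h k
    · rw [indicator_of_mem (show y ∈ Bd from ⟨hbad, hyD⟩), mul_comm (F y)]
      refine le_trans ?_ le_add_self
      refine le_trans ?_ le_add_self
      refine mul_le_mul_left (ENNReal.ofReal_le_ofReal ?_) _
      have hM : ‖gradient u (y + h • e) - gradient u y‖ ≤ 2 * max M 0 := by
        refine (norm_sub_le _ _).trans ?_
        have := le_max_left M 0
        linarith
      have hη2 : η y ^ 2 ≤ 1 := pow_le_one₀ (hη0 y) (hη1 y)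
      have hn1 := hη0 y
      have hn2 := hψ0 y
      calc _ ≤ η y ^ 2 / h * ‖gradient u (y + h • e) - gradient u y‖ +
            2 * η y * ψ y * ‖gradient η y‖ := by
            refine (norm_add_le _ _).trans ?_
            rw [norm_smul, norm_smul, Real.norm_of_nonneg (by positivity),
              Real.norm_of_nonneg (by positivity)]
        _ ≤ 1 / h * (2 * max M 0) + 2 * 1 * B * ℓ := by
            gcongr
            · exact hη1 y
            · exact hψB y
            · exact hgη y
        _ ≤ C3 / h := by
            rw [hC3, add_div]
            have : 2 * 1 * (B : ℝ) * ℓ ≤ 2 * B * ℓ * (R - ρ) / h := by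
              rw [le_div_iff₀ hh]
              have : h ≤ R - ρ := by linarith
              have h5 : (0 : ℝ) ≤ 2 * B * ℓ := by positivity
              nlinarith
            have h6 : 1 / h * (2 * max M 0) = 2 * max M 0 / h := by ring
            linarith
    · have hgood := not_not.1 fun h' => hbad ⟨hk, h'⟩
      refine (good_point_upper (lam := lam) (ℓ := ℓ) (F y) hh hlamp (hψ0 y) (hη0 y) (hη1 y)
        (hgη y) (ell.coer _ _ ha hb hgood.1 hgood.2)).trans ?_
      rw [indicator_of_mem hyD]
      exact add_le_add le_rfl le_self_add
  -- integration
  have hXb : ∀ᵐ y, |X y| ≤ 2 * max CS 0 * (2 * max M 0) / h ^ 2 := by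
    filter_upwards [hab] with y hy
    rw [abs_of_nonneg (hX0 y)]
    by_cases hyD : y ∈ D
    swap
    · rw [hXs y hyD]; positivity
    obtain ⟨ha, hb⟩ := hy hyD
    have hJle : J y ≤ 2 * max CS 0 * (2 * max M 0) / h ^ 2 := by
      rw [hJ, energy]
      gcongr
      refine (le_abs_self _).trans ?_
      rw [← Real.norm_eq_abs]
      refine ((S (gradient u (y + h • e)) - S (gradient u y)).le_opNorm _).trans ?_
      gcongr
      · refine (norm_sub_le _ _).trans ?_
        have h1 := (hCS _ ha).trans (le_max_left CS 0)
        have h2 := (hCS _ hb).trans (le_max_left CS 0)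
        linarith
      · refine (norm_sub_le _ _).trans ?_
        have := le_max_left M 0
        linarith
    refine le_trans ?_ hJle
    refine indicator_le' (fun z _ => ?_) (fun z _ => hJ0 z) y
    exact mul_le_of_le_one_left (hJ0 z) (pow_le_one₀ (hη0 z) (hη1 z))
  have hXi : Integrable X := integrable_of_abs_le_of_support hXm.aestronglyMeasurable hXb hXs
  have hYm : Measurable Y := (((hψm.pow_const 2).const_mul _).indicator hDm).add
    (measurable_const.indicator hBdm)
  have hYi : Integrable Y := by
    refine integrable_of_abs_le_of_support (A := 4 * Lam * ℓ ^ 2 * B ^ 2 + C1 / h) (R := ρ)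
      (z := x) hYm.aestronglyMeasurable (Filter.Eventually.of_forall fun y => ?_) fun y hy => ?_
    · rw [abs_of_nonneg (hY0 y)]
      refine add_le_add ?_ ?_
      · refine indicator_apply_le' (fun _ => ?_) (fun _ => by positivity)
        have := hψ0 y
        gcongr
        exact hψB y
      · exact indicator_apply_le' (fun _ => le_rfl) (fun _ => by positivity)
    · have h1 : y ∉ D := hy
      have h2 : y ∉ Bd := fun h' => h1 h'.2
      simp [hY, h1, h2]
  set IX : ℝ≥0∞ := ∫⁻ y, ENNReal.ofReal (X y) with hIX
  have hIXfin : IX ≠ ⊤ := by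
    rw [hIX, ← ofReal_integral_eq_lintegral_ofReal hXi (Filter.Eventually.of_forall hX0)]
    exact ENNReal.ofReal_ne_top
  have s1 : ENNReal.ofReal (3 / 4) * IX ≤ ENNReal.ofReal (∫ y, G y / h) +
      ∫⁻ y, ENNReal.ofReal (Y y) := by
    rw [hIX, ← ofReal_integral_eq_lintegral_ofReal hXi (Filter.Eventually.of_forall hX0),
      ← ENNReal.ofReal_mul (by norm_num), ← integral_const_mul,
      ← ofReal_integral_eq_lintegral_ofReal hYi (Filter.Eventually.of_forall hY0)]
    refine le_trans (ENNReal.ofReal_le_ofReal ?_) ENNReal.ofReal_add_le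
    rw [← integral_add (hGi.div_const h) hYi]
    exact integral_mono_ae (hXi.const_mul _) ((hGi.div_const h).add hYi) hlow
  have s2 : ENNReal.ofReal (∫ y, G y / h) ≤ ∫⁻ y, F y * ‖lineDeriv ℝ φ y e‖ₑ := by
    rw [integral_div, hGe, div_eq_inv_mul, ENNReal.ofReal_mul (by positivity)]
    calc _ ≤ ENNReal.ofReal h⁻¹ * ∫⁻ y, ‖f y‖ₑ * ‖φ (y - h • e) - φ y‖ₑ := by
          gcongr
          refine (Real.ofReal_le_enorm _).trans ((enorm_integral_le_lintegral_enorm _).trans ?_)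
          simp only [enorm_mul]; exact le_rfl
      _ ≤ ENNReal.ofReal h⁻¹ * ∫⁻ y, (∫⁻ s in Ioc 0 h, ‖f (y + s • e)‖ₑ) *
            ‖lineDeriv ℝ φ y e‖ₑ := by
          exact mul_le_mul_right (lintegral_enorm_mul_enorm_sub_le hφL sol.meas_f e hh.le) _
      _ = _ := by
          rw [← lintegral_const_mul' _ _ ENNReal.ofReal_ne_top]
          refine lintegral_congr fun y => ?_
          rw [hF, lineAvg_eq, mul_assoc]
  have s3 : ∫⁻ y, F y * ‖lineDeriv ℝ φ y e‖ₑ ≤ ENNReal.ofReal (1 / 4) * IX +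
      (ENNReal.ofReal (2 / lam) * (∫⁻ y in D, F y ^ 2) +
        ENNReal.ofReal (lam * ℓ ^ 2) * (∫⁻ y in D, ENNReal.ofReal (ψ y ^ 2)) +
        ENNReal.ofReal (C3 / h) * ∫⁻ y in Bd, F y) := by
    refine (lintegral_mono_ae hup).trans (le_of_eq ?_)
    rw [lintegral_add_left (by fun_prop), lintegral_add_left
      (Measurable.indicator (by fun_prop) hDm), lintegral_indicator hDm, lintegral_indicator hBdm,
      lintegral_add_left (by fun_prop), lintegral_const_mul _ (by fun_prop),
      lintegral_const_mul _ hFm]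
    congr 1
    · rw [hIX, ← lintegral_const_mul _ (by fun_prop)]
      refine lintegral_congr fun y => ?_
      rw [ENNReal.ofReal_mul (by norm_num)]
    · congr 2
      rw [← lintegral_const_mul _ (by fun_prop)]
      refine lintegral_congr fun y => ?_
      rw [ENNReal.ofReal_mul (by positivity)]
  have s4 : ∫⁻ y, ENNReal.ofReal (Y y) = ENNReal.ofReal (4 * Lam * ℓ ^ 2) *
      (∫⁻ y in D, ENNReal.ofReal (ψ y ^ 2)) + ENNReal.ofReal (C1 / h) * volume Bd := by
    have h1 : ∀ y, ENNReal.ofReal (Y y) =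
        D.indicator (fun y => ENNReal.ofReal (4 * Lam * ℓ ^ 2) * ENNReal.ofReal (ψ y ^ 2)) y +
          Bd.indicator (fun _ => ENNReal.ofReal (C1 / h)) y := by
      intro y
      rw [hY]
      simp only
      rw [ENNReal.ofReal_add (indicator_nonneg (fun z _ => by positivity) y)
        (indicator_nonneg (fun z _ => by positivity) y)]
      congr 1
      · by_cases hy : y ∈ D
        · simp only [indicator_of_mem hy]; rw [ENNReal.ofReal_mul (by positivity)]
        · simp [indicator_of_notMem hy]
      · by_cases hy : y ∈ Bd
        · simp only [indicator_of_mem hy]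
        · simp [indicator_of_notMem hy]
    simp only [h1]
    rw [lintegral_add_left (Measurable.indicator (by fun_prop) hDm), lintegral_indicator hDm,
      lintegral_indicator_const hBdm, lintegral_const_mul _ (by fun_prop)]
  have s5 : ∫⁻ y in D, F y ^ 2 ≤ ∫⁻ y in ball x R, ‖f y‖ₑ ^ 2 :=
    setLIntegral_sq_lineAvg_le sol.meas_f he hh hρh
  have s6 : ∫⁻ y in Bd, F y ≤ N * volume Bd ^ (2 / 3 : ℝ) :=
    setLIntegral_lineAvg_le sol.meas_f sol.lintegral_le e hh hBdm
  have s7 : ∫⁻ y in P, ENNReal.ofReal (η y ^ 2 * J y) = IX := by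
    rw [hIX, ← lintegral_indicator hPm]
    refine lintegral_congr fun y => ?_
    by_cases hy : y ∈ P
    · simp only [hX, indicator_of_mem hy]
    · simp [hX, indicator_of_notMem hy]
  rw [s7]
  set I2 := ∫⁻ y in D, ENNReal.ofReal (ψ y ^ 2) with hI2
  set If := ∫⁻ y in ball x R, ‖f y‖ₑ ^ 2 with hIf
  set V1 := volume Bd with hV1
  set V2 := (N : ℝ≥0∞) * volume Bd ^ (2 / 3 : ℝ) with hV2
  have s8 : ENNReal.ofReal (3 / 4) * IX ≤ ENNReal.ofReal (1 / 4) * IX +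
      (ENNReal.ofReal (2 / lam) * If + ENNReal.ofReal (lam * ℓ ^ 2) * I2 +
        ENNReal.ofReal (C3 / h) * V2 +
        (ENNReal.ofReal (4 * Lam * ℓ ^ 2) * I2 + ENNReal.ofReal (C1 / h) * V1)) := by
    refine (s1.trans (add_le_add (s2.trans s3) s4.le)).trans ?_
    rw [add_assoc]
    refine add_le_add le_rfl (add_le_add (add_le_add (add_le_add ?_ le_rfl) ?_) le_rfl)
    · exact mul_le_mul_right s5 _
    · exact mul_le_mul_right s6 _
  have s9 : ENNReal.ofReal (1 / 2) * IX ≤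
      (ENNReal.ofReal (2 / lam) * If + ENNReal.ofReal (lam * ℓ ^ 2) * I2 +
        ENNReal.ofReal (C3 / h) * V2 +
        (ENNReal.ofReal (4 * Lam * ℓ ^ 2) * I2 + ENNReal.ofReal (C1 / h) * V1)) := by
    rw [show (3 / 4 : ℝ) = 1 / 4 + 1 / 2 by norm_num, ENNReal.ofReal_add (by norm_num)
      (by norm_num), add_mul] at s8
    exact (ENNReal.add_le_add_iff_left (ENNReal.mul_ne_top ENNReal.ofReal_ne_top hIXfin)).1 s8
  calc IX = ENNReal.ofReal 2 * (ENNReal.ofReal (1 / 2) * IX) := by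
        rw [← mul_assoc, ← ENNReal.ofReal_mul (by norm_num)]; norm_num
    _ ≤ ENNReal.ofReal 2 * (ENNReal.ofReal (2 / lam) * If + ENNReal.ofReal (lam * ℓ ^ 2) * I2 +
        ENNReal.ofReal (C3 / h) * V2 +
        (ENNReal.ofReal (4 * Lam * ℓ ^ 2) * I2 + ENNReal.ofReal (C1 / h) * V1)) := by gcongr
    _ = ENNReal.ofReal (2 * (lam * ℓ ^ 2) + 2 * (4 * Lam * ℓ ^ 2)) * I2 +
        ENNReal.ofReal (2 * (2 / lam)) * If +
        (ENNReal.ofReal (2 * (C1 / h)) * V1 + ENNReal.ofReal (2 * (C3 / h)) * V2) := by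
        rw [ENNReal.ofReal_add (by positivity) (by positivity)]
        simp only [ENNReal.ofReal_mul (show (0 : ℝ) ≤ 2 by norm_num)]
        ring
    _ ≤ _ := by
        rw [mul_add]
        gcongr ENNReal.ofReal ?_ * I2 + ENNReal.ofReal ?_ * If + (ENNReal.ofReal ?_ * V1 + ENNReal.ofReal ?_ * V2)
        · nlinarith [ell.lam_le, sq_nonneg (ℓ : ℝ)]
        · exact le_of_eq (by ring)
        · have h1 : 0 ≤ C3 / h := by positivity
          have h2 : 2 * (C1 + C3) / h = 2 * (C1 / h) + 2 * (C3 / h) := by ring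
          rw [h2]; linarith
        · have h1 : 0 ≤ C1 / h := by positivity
          have h2 : 2 * (C1 + C3) / h = 2 * (C1 / h) + 2 * (C3 / h) := by ring
          rw [h2]; linarith

end CaccioppoliMain

section BadDecay

variable {n : ℕ} {S : Eucl n → Eucl n →L[ℝ] ℝ} {u f : Eucl n → ℝ} {x : Eucl n}
  {R M δ κ lam Lam : ℝ} {K N : ℝ≥0}

theorem exists_lipschitz_cutoff (x : Eucl n) {ρ ρ' : ℝ} (h : ρ < ρ') :
    ∃ η : Eucl n → ℝ, LipschitzWith (Real.toNNReal (ρ' - ρ)⁻¹) η ∧ (∀ y, 0 ≤ η y) ∧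
      (∀ y, η y ≤ 1) ∧ (∀ y, y ∉ closedBall x ρ' → η y = 0) ∧ ∀ y ∈ closedBall x ρ, η y = 1 := by
  have hpos : 0 < ρ' - ρ := by linarith
  have hinv : 0 < (ρ' - ρ)⁻¹ := inv_pos.2 hpos
  refine ⟨fun y => max (min ((ρ' - ρ)⁻¹ * (ρ' - dist y x)) 1) 0, ?_, fun y => le_max_right _ _,
    fun y => max_le (min_le_right _ _) zero_le_one, fun y hy => ?_, fun y hy => ?_⟩
  · have h1 : LipschitzWith (Real.toNNReal (ρ' - ρ)⁻¹)
        fun y => (ρ' - ρ)⁻¹ * (ρ' - dist y x) := by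
      refine LipschitzWith.of_dist_le_mul fun a b => ?_
      rw [Real.dist_eq, ← mul_sub, abs_mul, abs_of_pos hinv, Real.coe_toNNReal _ hinv.le]
      gcongr
      have e1 : ρ' - dist a x - (ρ' - dist b x) = dist b x - dist a x := by ring
      rw [e1, dist_comm a b]
      exact abs_dist_sub_le _ _ _
    exact (h1.min_const 1).max_const 0
  · rw [mem_closedBall, not_le] at hy
    apply max_eq_right
    refine (min_le_left _ _).trans ?_
    exact mul_nonpos_of_nonneg_of_nonpos hinv.le (by linarith)
  · rw [mem_closedBall] at hy
    have h1 : 1 ≤ (ρ' - ρ)⁻¹ * (ρ' - dist y x) := by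
      rw [inv_mul_eq_div, one_le_div hpos]; linarith
    simp only
    rw [min_eq_right h1, max_eq_left zero_le_one]

/-- The set where the gradient jumps by at least `θ`. -/
def jumpSet (u : Eucl n → ℝ) (e : Eucl n) (κ θ h k : ℝ) : Set (Eucl n) :=
  {y | k < dq u e h y ∧ κ ≤ max ‖gradient u y‖ ‖gradient u (y + h • e)‖ ∧
    θ ≤ ‖gradient u (y + h • e) - gradient u y‖}

theorem measurableSet_jumpSet {u : Eucl n → ℝ} (hu : Continuous u) (e : Eucl n) (κ θ h k : ℝ) :
    MeasurableSet (jumpSet u e κ θ h k) := by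
  have hg := measurable_gradient u
  have h1 : Measurable (dq u e h) := by
    have := hu.measurable
    unfold dq; fun_prop
  have h2 : Measurable fun y => max ‖gradient u y‖ ‖gradient u (y + h • e)‖ := by fun_prop
  have h3 : Measurable fun y => ‖gradient u (y + h • e) - gradient u y‖ := by fun_prop
  exact (measurableSet_lt measurable_const h1).inter
    ((measurableSet_le measurable_const h2).inter
      (measurableSet_le measurable_const h3))

theorem lintegral_sq_dq_le {u : Eucl n → ℝ} {K : ℝ≥0} (hu : LipschitzWith K u) {e : Eucl n}
    (he : ‖e‖ ≤ 1) {h : ℝ} (hh : 0 < h) (k : ℝ) (s : Set (Eucl n)) :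
    ∫⁻ y in s, ENNReal.ofReal (max (dq u e h y - k) 0 ^ 2) ≤
      ENNReal.ofReal ((K + |k|) ^ 2) * volume s := by
  rw [← setLIntegral_const]
  refine lintegral_mono fun y => ENNReal.ofReal_le_ofReal ?_
  refine pow_le_pow_left₀ (le_max_right _ _) (max_le ?_ (by positivity)) 2
  have h1 := (abs_le.1 (abs_dq_le hu he hh y)).2
  have h2 := neg_abs_le k
  linarith

theorem LipSolution.volume_jumpSet_le (sol : LipSolution S u f x R M K N)
    (ell : EllipticField S M δ κ lam Lam) (hf : ∫⁻ y in ball x R, ‖f y‖ₑ ^ 2 ≠ ⊤)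
    {e : Eucl n} (he : ‖e‖ ≤ 1)
    {θ : ℝ} (hθ : 0 < θ) {ρ ρ' : ℝ} (hρ : ρ < ρ') (hρ' : ρ' < R) (k : ℝ) :
    ∃ C : ℝ≥0, ∀ h, 0 < h → ρ' + h < R →
      volume (jumpSet u e κ θ h k ∩ closedBall x ρ) ≤
        C * (ENNReal.ofReal h ^ 2 + ENNReal.ofReal h *
          volume (badSet u e κ δ h k ∩ closedBall x ρ') ^ (2 / 3 : ℝ)) := by
  obtain ⟨η, hηL, hη0, hη1, hηs, hηe⟩ := exists_lipschitz_cutoff x hρ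
  obtain ⟨C, hC0, hC⟩ := sol.caccioppoli ell he hηL hη0 hη1 hρ' hηs k
  obtain ⟨c, hc, hjump⟩ := ell.jump θ hθ
  set ℓ := Real.toNNReal (ρ' - ρ)⁻¹
  set A : ℝ≥0∞ := ENNReal.ofReal (10 * Lam * ℓ ^ 2) *
    (ENNReal.ofReal ((K + |k|) ^ 2) * volume (closedBall x ρ')) +
    ENNReal.ofReal (4 / lam) * (∫⁻ y in ball x R, ‖f y‖ₑ ^ 2) with hA
  set W : ℝ≥0∞ := volume (closedBall x ρ') ^ (1 / 3 : ℝ) + N with hW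
  have hv : volume (closedBall x ρ') ≠ ⊤ := measure_closedBall_lt_top.ne
  have hAt : A ≠ ⊤ := ENNReal.add_ne_top.2 ⟨ENNReal.mul_ne_top ENNReal.ofReal_ne_top
    (ENNReal.mul_ne_top ENNReal.ofReal_ne_top hv), ENNReal.mul_ne_top ENNReal.ofReal_ne_top hf⟩
  have hWt : W ≠ ⊤ := ENNReal.add_ne_top.2 ⟨ENNReal.rpow_ne_top_of_nonneg (by norm_num) hv,
    ENNReal.coe_ne_top⟩
  set B : ℝ≥0∞ := ENNReal.ofReal c⁻¹ * (A + ENNReal.ofReal C * W) with hB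
  have hBt : B ≠ ⊤ := ENNReal.mul_ne_top ENNReal.ofReal_ne_top (ENNReal.add_ne_top.2
    ⟨hAt, ENNReal.mul_ne_top ENNReal.ofReal_ne_top hWt⟩)
  refine ⟨B.toNNReal, fun h hh hρh => ?_⟩
  rw [ENNReal.coe_toNNReal hBt]
  set J := jumpSet u e κ θ h k ∩ closedBall x ρ with hJ
  set V := volume (badSet u e κ δ h k ∩ closedBall x ρ') with hV
  have hJm : MeasurableSet J :=
    (measurableSet_jumpSet sol.lip.continuous e κ θ h k).inter measurableSet_closedBall
  have hdist : ∀ y : Eucl n, dist (y + h • e) y ≤ h := fun y => by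
    rw [dist_eq_norm, add_sub_cancel_left, norm_smul, Real.norm_of_nonneg hh.le]
    exact mul_le_of_le_one_right hh.le he
  have s1 : ENNReal.ofReal (c / h ^ 2) * volume J ≤
      ∫⁻ y in {y | k < dq u e h y}, ENNReal.ofReal (η y ^ 2 * energy S u e h y) := by
    rw [← setLIntegral_const]
    refine le_trans ?_ (lintegral_mono_set (show J ⊆ {y | k < dq u e h y} from
      fun y hy => hy.1.1))
    refine setLIntegral_mono_ae' hJm ?_
    filter_upwards [sol.grad_le, ae_translate sol.grad_le (h • e)] with y h1 h2 hy
    refine ENNReal.ofReal_le_ofReal ?_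
    rw [hηe y hy.2, one_pow, one_mul, energy]
    have hyr := mem_closedBall.1 hy.2
    gcongr
    refine hjump _ _ (h1 ?_) (h2 ?_) hy.1.2.1 hy.1.2.2
    · rw [mem_ball]; linarith
    · rw [mem_ball]; linarith [dist_triangle (y + h • e) y x, hdist y]
  have hV3 : V ≤ volume (closedBall x ρ') ^ (1 / 3 : ℝ) * V ^ (2 / 3 : ℝ) := by
    calc V = V ^ (1 / 3 + 2 / 3 : ℝ) := by norm_num
      _ = V ^ (1 / 3 : ℝ) * V ^ (2 / 3 : ℝ) :=
        ENNReal.rpow_add_of_nonneg _ _ (by norm_num) (by norm_num)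
      _ ≤ _ := by
        gcongr
        exact measure_mono inter_subset_right
  have s2 : ENNReal.ofReal (c / h ^ 2) * volume J ≤
      A + ENNReal.ofReal (C / h) * (W * V ^ (2 / 3 : ℝ)) := by
    refine s1.trans ((hC h hh hρh).trans ?_)
    rw [hA, hW, add_mul]
    refine add_le_add (add_le_add (mul_le_mul_right (lintegral_sq_dq_le sol.lip he hh k _) _)
      le_rfl) (mul_le_mul_right (add_le_add hV3 le_rfl) _)
  have e1 : ENNReal.ofReal h ^ 2 * ENNReal.ofReal (C / h) =
      ENNReal.ofReal C * ENNReal.ofReal h := by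
    rw [← ENNReal.ofReal_pow hh.le, ← ENNReal.ofReal_mul (by positivity),
      ← ENNReal.ofReal_mul hC0]
    congr 1; field_simp
  have e2 : ENNReal.ofReal c⁻¹ * ENNReal.ofReal h ^ 2 * ENNReal.ofReal (c / h ^ 2) = 1 := by
    rw [← ENNReal.ofReal_pow hh.le, ← ENNReal.ofReal_mul (by positivity),
      ← ENNReal.ofReal_mul (by positivity), ← ENNReal.ofReal_one]
    congr 1; field_simp
  calc volume J = ENNReal.ofReal c⁻¹ * ENNReal.ofReal h ^ 2 *
        (ENNReal.ofReal (c / h ^ 2) * volume J) := by rw [← mul_assoc, e2, one_mul]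
    _ ≤ ENNReal.ofReal c⁻¹ * ENNReal.ofReal h ^ 2 *
        (A + ENNReal.ofReal (C / h) * (W * V ^ (2 / 3 : ℝ))) := mul_le_mul_right s2 _
    _ = ENNReal.ofReal c⁻¹ * (A * ENNReal.ofReal h ^ 2 + (ENNReal.ofReal h ^ 2 *
        ENNReal.ofReal (C / h)) * (W * V ^ (2 / 3 : ℝ))) := by ring
    _ = ENNReal.ofReal c⁻¹ * (A * ENNReal.ofReal h ^ 2 + ENNReal.ofReal C * W *
        (ENNReal.ofReal h * V ^ (2 / 3 : ℝ))) := by rw [e1]; ring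
    _ ≤ ENNReal.ofReal c⁻¹ * ((A + ENNReal.ofReal C * W) * ENNReal.ofReal h ^ 2 +
        (A + ENNReal.ofReal C * W) * (ENNReal.ofReal h * V ^ (2 / 3 : ℝ))) := by
        gcongr
        · exact le_self_add
        · exact le_add_self
    _ = _ := by rw [hB]; ring

theorem ofReal_mul_volume_small_gradient_le {u : Eucl n → ℝ} {K : ℝ≥0} (hu : LipschitzWith K u)
    {e : Eucl n} (he : ‖e‖ ≤ 1) {κ k k' h : ℝ} (hκ : 0 ≤ κ) (hk' : κ < k') (hh : 0 < h)
    {D : Set (Eucl n)} (hD : MeasurableSet D) :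
    ENNReal.ofReal ((k - k') * h) * volume ({y | k < dq u e h y ∧ ‖gradient u y‖ < κ} ∩ D) ≤
      K * ∫⁻ t in Ioc 0 h, volume (jumpSet u e κ (k' - κ) t k' ∩ D) := by
  set E := {y | k < dq u e h y ∧ ‖gradient u y‖ < κ} ∩ D with hE
  have hc := hu.continuous
  have hcm := hc.measurable
  have hg := measurable_gradient u
  have hEm : MeasurableSet E := by
    refine MeasurableSet.inter ?_ hD
    have h1 : Measurable (dq u e h) := by unfold dq; fun_prop
    exact (measurableSet_lt measurable_const h1).inter (measurableSet_lt hg.norm measurable_const)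
  set Z : Set (Eucl n × ℝ) := {z | k' < dq u e z.2 z.1 ∧
    k' < lineDeriv ℝ u (z.1 + z.2 • e) e} with hZ
  have hZm : MeasurableSet Z := by
    have h1 : Measurable fun z : Eucl n × ℝ => dq u e z.2 z.1 := by unfold dq; fun_prop
    have h2 : Measurable fun z : Eucl n × ℝ => lineDeriv ℝ u (z.1 + z.2 • e) e :=
      (measurable_lineDeriv hc).comp (by fun_prop)
    exact (measurableSet_lt measurable_const h1).inter (measurableSet_lt measurable_const h2)
  have s1 : ENNReal.ofReal ((k - k') * h) * volume E ≤
      ∫⁻ y in E, K * ∫⁻ t in Ioc 0 h, Z.indicator 1 (y, t) := by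
    rw [← setLIntegral_const]
    refine setLIntegral_mono' hEm fun y hy => ?_
    have h1 := ofReal_le_volume_lineDeriv_gt hu y e he (hκ.trans hk'.le) hh hy.1.1
    rw [ENNReal.ofReal_coe_nnreal] at h1
    refine h1.trans (le_of_eq ?_)
    congr 1
    have hm : MeasurableSet {t | (y, t) ∈ Z} := measurable_prodMk_left hZm
    have e1 : ∀ t, Z.indicator (1 : Eucl n × ℝ → ℝ≥0∞) (y, t) =
      {t | (y, t) ∈ Z}.indicator 1 t := fun t => by simp [indicator]
    simp only [e1]
    rw [lintegral_indicator_one hm, Measure.restrict_apply hm]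
    congr 1
    ext t
    simp only [hZ, dq, mem_ofPred_eq, mem_inter_iff]
    tauto
  refine s1.trans ?_
  have hZi : Measurable (Z.indicator (1 : Eucl n × ℝ → ℝ≥0∞)) := measurable_one.indicator hZm
  rw [lintegral_const_mul' _ _ ENNReal.coe_ne_top]
  rw [lintegral_lintegral_swap (f := fun y t => Z.indicator (1 : Eucl n × ℝ → ℝ≥0∞) (y, t))
    hZi.aemeasurable]
  refine mul_le_mul_right (lintegral_mono fun t => ?_) _
  have hm : MeasurableSet {y | (y, t) ∈ Z} := measurable_prodMk_right hZm
  have e1 : ∀ y, Z.indicator (1 : Eucl n × ℝ → ℝ≥0∞) (y, t) =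
    {y | (y, t) ∈ Z}.indicator 1 y := fun t => by simp [indicator]
  simp only [e1]
  rw [lintegral_indicator_one hm, Measure.restrict_apply hm]
  refine measure_mono_ae ?_
  filter_upwards [ae_translate hu.ae_differentiableAt (t • e)] with y hd hy
  obtain ⟨⟨hz1, hz2⟩, ⟨hy1, hy2⟩, hyD⟩ := hy
  have h1 : k' < ‖gradient u (y + t • e)‖ := by
    refine hz2.trans_le ?_
    rw [hd.lineDeriv_eq_fderiv, norm_gradient]
    refine (le_abs_self _).trans ?_
    rw [← Real.norm_eq_abs]
    exact ((fderiv ℝ u (y + t • e)).le_opNorm _).trans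
      (mul_le_of_le_one_right (norm_nonneg _) he)
  refine ⟨⟨hz1, le_max_of_le_right (hk'.trans h1).le, ?_⟩, hyD⟩
  have := norm_sub_norm_le (gradient u (y + t • e)) (gradient u y)
  linarith

/-- Polynomial decay of the exceptional sets. -/
def BadDecay (u : Eucl n → ℝ) (e x : Eucl n) (κ δ R b : ℝ) : Prop :=
  ∀ k > κ, ∀ ρ < R, ∃ C : ℝ≥0, ∃ h₀ > 0, ∀ h, 0 < h → h < h₀ →
    volume (badSet u e κ δ h k ∩ closedBall x ρ) ≤ C * ENNReal.ofReal h ^ b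

theorem badDecay_zero (u : Eucl n → ℝ) (e x : Eucl n) (κ δ R : ℝ) : BadDecay u e x κ δ R 0 := by
  intro k _ ρ _
  refine ⟨(volume (closedBall x ρ)).toNNReal, 1, one_pos, fun h _ _ => ?_⟩
  rw [ENNReal.rpow_zero, mul_one, ENNReal.coe_toNNReal measure_closedBall_lt_top.ne]
  exact measure_mono inter_subset_right

theorem LipSolution.volume_jumpSet_le_rpow (sol : LipSolution S u f x R M K N)
    (ell : EllipticField S M δ κ lam Lam) (hf : ∫⁻ y in ball x R, ‖f y‖ₑ ^ 2 ≠ ⊤)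
    {e : Eucl n} (he : ‖e‖ ≤ 1) {b : ℝ} (hb : b ≤ 3 / 2)
    (H : BadDecay u e x κ δ R b)
    {θ : ℝ} (hθ : 0 < θ) {ρ : ℝ} (hρ : ρ < R) {k : ℝ} (hk : κ < k) :
    ∃ C : ℝ≥0, ∃ h₀ > 0, ∀ h, 0 < h → h < h₀ →
      volume (jumpSet u e κ θ h k ∩ closedBall x ρ) ≤
        C * ENNReal.ofReal h ^ (1 + 2 * b / 3) := by
  obtain ⟨ρ', hρ1, hρ2⟩ := exists_between hρ
  obtain ⟨C1, h1, hh1, hC1⟩ := H k hk ρ' hρ2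
  obtain ⟨C2, hC2⟩ := sol.volume_jumpSet_le ell hf he hθ hρ1 hρ2 k
  refine ⟨C2 * (1 + C1 ^ (2 / 3 : ℝ)), min (min h1 1) (R - ρ'), by
    refine lt_min (lt_min hh1 one_pos) (by linarith), fun h hh hlt => ?_⟩
  have ha1 : h < h1 := hlt.trans_le ((min_le_left _ _).trans (min_le_left _ _))
  have ha2 : h < 1 := hlt.trans_le ((min_le_left _ _).trans (min_le_right _ _))
  have ha3 : h < R - ρ' := hlt.trans_le (min_le_right _ _)
  refine (hC2 h hh (by linarith)).trans ?_
  push_cast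
  rw [mul_assoc, add_mul, one_mul]
  have hp : 0 < ENNReal.ofReal h := ENNReal.ofReal_pos.2 hh
  refine mul_le_mul_right (add_le_add ?_ ?_) _
  · rw [← ENNReal.rpow_natCast]
    refine ENNReal.rpow_le_rpow_of_exponent_ge ?_ (by push_cast; linarith)
    rw [← ENNReal.ofReal_one]; exact ENNReal.ofReal_le_ofReal ha2.le
  · calc _ ≤ ENNReal.ofReal h * (C1 * ENNReal.ofReal h ^ b) ^ (2 / 3 : ℝ) := by
          gcongr
          exact hC1 h hh ha1
      _ = ENNReal.ofReal h * (C1 ^ (2 / 3 : ℝ) * ENNReal.ofReal h ^ (b * (2 / 3) : ℝ)) := by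
          rw [ENNReal.mul_rpow_of_nonneg _ _ (by norm_num), ENNReal.rpow_mul]
      _ = C1 ^ (2 / 3 : ℝ) * (ENNReal.ofReal h ^ (1 : ℝ) *
            ENNReal.ofReal h ^ (b * (2 / 3) : ℝ)) := by
          rw [ENNReal.rpow_one]; ring
      _ = _ := by
          rw [← ENNReal.rpow_add _ _ hp.ne' ENNReal.ofReal_ne_top,
            ENNReal.coe_rpow_of_nonneg _ (by norm_num)]
          congr 2; ring

theorem LipSolution.badDecay_step (sol : LipSolution S u f x R M K N)
    (ell : EllipticField S M δ κ lam Lam) (hf : ∫⁻ y in ball x R, ‖f y‖ₑ ^ 2 ≠ ⊤)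
    (hδ : 0 < δ) (hκ : 0 ≤ κ)
    {e : Eucl n} (he : ‖e‖ ≤ 1) {b : ℝ} (hb0 : 0 ≤ b) (hb : b ≤ 3 / 2)
    (H : BadDecay u e x κ δ R b) : BadDecay u e x κ δ R (1 + 2 * b / 3) := by
  intro k hk ρ hρ
  obtain ⟨k', hk1, hk2⟩ := exists_between hk
  obtain ⟨C1, h1, hh1, hC1⟩ := sol.volume_jumpSet_le_rpow ell hf he hb H hδ hρ hk
  obtain ⟨C2, h2, hh2, hC2⟩ :=
    sol.volume_jumpSet_le_rpow ell hf he hb H (sub_pos.2 hk1) hρ hk1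
  refine ⟨C1 + Real.toNNReal (k - k')⁻¹ * K * C2, min h1 h2, lt_min hh1 hh2, fun h hh hlt => ?_⟩
  have ha1 : h < h1 := hlt.trans_le (min_le_left _ _)
  have ha2 : h < h2 := hlt.trans_le (min_le_right _ _)
  set D := closedBall x ρ with hD
  set E := {y | k < dq u e h y ∧ ‖gradient u y‖ < κ} ∩ D with hE
  set b' : ℝ := 1 + 2 * b / 3 with hb'
  have s1 : badSet u e κ δ h k ∩ D ⊆ (jumpSet u e κ δ h k ∩ D) ∪ E := by
    rintro y ⟨⟨hy1, hy2⟩, hyD⟩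
    by_cases hm : κ ≤ max ‖gradient u y‖ ‖gradient u (y + h • e)‖
    · left
      refine ⟨⟨hy1, hm, ?_⟩, hyD⟩
      by_contra hcon
      exact hy2 ⟨hm, (not_le.1 hcon).le⟩
    · right
      exact ⟨⟨hy1, (max_lt_iff.1 (not_le.1 hm)).1⟩, hyD⟩
  have s2 : ∫⁻ t in Ioc 0 h, volume (jumpSet u e κ (k' - κ) t k' ∩ D) ≤
      C2 * ENNReal.ofReal h ^ b' * ENNReal.ofReal h := by
    calc _ ≤ ∫⁻ _ in Ioc 0 h, C2 * ENNReal.ofReal h ^ b' := by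
          refine setLIntegral_mono' measurableSet_Ioc fun t ht => ?_
          refine (hC2 t ht.1 (ht.2.trans_lt ha2)).trans ?_
          have hb2 : 0 ≤ b' := by positivity
          gcongr
          exact ht.2
      _ = _ := by rw [setLIntegral_const, Real.volume_Ioc, sub_zero]
  have s3 := ofReal_mul_volume_small_gradient_le (k := k) sol.lip he hκ hk1 hh
    (measurableSet_closedBall (x := x) (ε := ρ))
  have hkk : 0 < k - k' := by linarith
  have s4 : volume E ≤ ENNReal.ofReal (k - k')⁻¹ * K * C2 * ENNReal.ofReal h ^ b' := by
    have e1 : ENNReal.ofReal ((k - k') * h)⁻¹ * ENNReal.ofReal ((k - k') * h) = 1 := by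
      rw [← ENNReal.ofReal_mul (by positivity), inv_mul_cancel₀ (by positivity),
        ENNReal.ofReal_one]
    have e2 : ENNReal.ofReal ((k - k') * h)⁻¹ * ENNReal.ofReal h = ENNReal.ofReal (k - k')⁻¹ := by
      rw [← ENNReal.ofReal_mul (by positivity)]
      congr 1; field_simp
    calc volume E = ENNReal.ofReal ((k - k') * h)⁻¹ *
          (ENNReal.ofReal ((k - k') * h) * volume E) := by rw [← mul_assoc, e1, one_mul]
      _ ≤ ENNReal.ofReal ((k - k') * h)⁻¹ *
          (K * (C2 * ENNReal.ofReal h ^ b' * ENNReal.ofReal h)) :=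
          mul_le_mul_right (s3.trans (mul_le_mul_right s2 _)) _
      _ = (ENNReal.ofReal ((k - k') * h)⁻¹ * ENNReal.ofReal h) *
          (K * (C2 * ENNReal.ofReal h ^ b')) := by ring
      _ = _ := by rw [e2]; ring
  refine (measure_mono s1).trans ((measure_union_le _ _).trans
    ((add_le_add (hC1 h hh ha1) s4).trans (le_of_eq ?_)))
  push_cast
  rw [add_mul]
  rfl

theorem LipSolution.badDecay (sol : LipSolution S u f x R M K N)
    (ell : EllipticField S M δ κ lam Lam) (hf : ∫⁻ y in ball x R, ‖f y‖ₑ ^ 2 ≠ ⊤)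
    (hδ : 0 < δ) (hκ : 0 ≤ κ) {e : Eucl n} (he : ‖e‖ ≤ 1) :
    BadDecay u e x κ δ R (5 / 3) := by
  have h1 := sol.badDecay_step ell hf hδ hκ he le_rfl (by norm_num) (badDecay_zero u e x κ δ R)
  have h2 := sol.badDecay_step ell hf hδ hκ he (b := 1) zero_le_one (by norm_num)
    (by convert h1 using 1; norm_num)
  convert h2 using 1; norm_num

end BadDecay

section ReverseHolder

variable {n : ℕ} {S : Eucl n → Eucl n →L[ℝ] ℝ} {u f : Eucl n → ℝ} {x : Eucl n}
  {R M δ κ lam Lam : ℝ} {K N : ℝ≥0}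

theorem ae_norm_fderiv_cutoff_mul_le {u : Eucl n → ℝ} {K ℓ : ℝ≥0} (hu : LipschitzWith K u)
    {η : Eucl n → ℝ} (hη : LipschitzWith ℓ η) (hη0 : ∀ y, 0 ≤ η y) (e : Eucl n) {h : ℝ}
    (hh : 0 < h) (k : ℝ) :
    ∀ᵐ y, ‖fderiv ℝ (fun y => η y * max (dq u e h y - k) 0) y‖ ≤
      if k < dq u e h y then
        η y / h * ‖gradient u (y + h • e) - gradient u y‖ + ℓ * max (dq u e h y - k) 0
      else 0 := by
  have hd := hu.ae_differentiableAt (μ := volume)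
  filter_upwards [hd, ae_translate hd (h • e), hη.ae_differentiableAt (μ := volume)]
    with y h1 h2 h3
  split_ifs with hk
  · have hcont : Continuous (dq u e h) := (lipschitzWith_dq hu e h).choose_spec.continuous
    have heq : (fun y => η y * max (dq u e h y - k) 0) =ᶠ[nhds y]
        fun y => η y * (dq u e h y - k) := by
      filter_upwards [hcont.continuousAt.eventually (lt_mem_nhds hk)] with z hz
      rw [max_eq_left (by linarith)]
    have hu1 : HasFDerivAt u (fderiv ℝ u y) y := h1.hasFDerivAt
    have hu2 : HasFDerivAt (fun y => u (y + h • e)) (fderiv ℝ u (y + h • e)) y :=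
      (hasFDerivAt_comp_add_right (h • e)).2 h2.hasFDerivAt
    have hv : HasFDerivAt (fun y => dq u e h y - k)
        (h⁻¹ • (fderiv ℝ u (y + h • e) - fderiv ℝ u y)) y := by
      have := ((hu2.sub hu1).const_mul h⁻¹).sub_const k
      refine this.congr_of_eventuallyEq (Filter.Eventually.of_forall fun z => ?_)
      simp only [dq, Pi.sub_apply]; ring
    have hprod := (h3.hasFDerivAt.mul hv).congr_of_eventuallyEq heq
    rw [hprod.fderiv]
    have hn : ‖gradient u (y + h • e) - gradient u y‖ =
        ‖fderiv ℝ u (y + h • e) - fderiv ℝ u y‖ := by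
      rw [gradient, gradient, ← map_sub, LinearIsometryEquiv.norm_map]
    rw [hn, max_eq_left (by linarith)]
    refine (norm_add_le _ _).trans ?_
    rw [norm_smul, norm_smul, norm_smul, Real.norm_of_nonneg (hη0 y), norm_inv,
      Real.norm_of_nonneg hh.le, Real.norm_of_nonneg (show 0 ≤ dq u e h y - k by linarith)]
    have h4 := norm_fderiv_le_of_lipschitz ℝ hη (x₀ := y)
    have h5 : 0 ≤ dq u e h y - k := by linarith
    rw [← mul_assoc, ← div_eq_mul_inv, mul_comm (dq u e h y - k)]
    gcongr
  · have hmin : IsLocalMin (fun y => η y * max (dq u e h y - k) 0) y := by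
      refine Filter.Eventually.of_forall fun z => ?_
      simp only
      rw [max_eq_right (show dq u e h y - k ≤ 0 by linarith), mul_zero]
      exact mul_nonneg (hη0 _) (le_max_right _ _)
    rw [hmin.fderiv_eq_zero, norm_zero]

theorem tendsto_dq_lineDeriv {u : Eucl n → ℝ} {y e : Eucl n} (hd : DifferentiableAt ℝ u y)
    {h : ℕ → ℝ} (hh : ∀ j, 0 < h j) (hh0 : Filter.Tendsto h Filter.atTop (nhds 0)) :
    Filter.Tendsto (fun j => dq u e (h j) y) Filter.atTop (nhds (lineDeriv ℝ u y e)) := by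
  have h1 := (hd.lineDifferentiableAt (v := e)).hasLineDerivAt.tendsto_slope_zero_right
  have h2 : Filter.Tendsto h Filter.atTop (nhdsWithin 0 (Ioi 0)) :=
    tendsto_nhdsWithin_iff.2 ⟨hh0, Filter.Eventually.of_forall hh⟩
  refine (h1.comp h2).congr fun j => ?_
  simp only [Function.comp, dq, smul_eq_mul]
  ring

theorem ENNReal_add_sq_le (a b : ℝ≥0∞) : (a + b) ^ 2 ≤ 2 * a ^ 2 + 2 * b ^ 2 := by
  have := ENNReal.rpow_add_le_mul_rpow_add_rpow a b (p := 2) (by norm_num)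
  norm_num at this
  rwa [mul_add] at this

theorem tendsto_badSet_error {e : Eucl n} {k ρ : ℝ} (H : BadDecay u e x κ δ R (5 / 3))
    (hk : κ < k) (hρ : ρ < R) {h : ℕ → ℝ} (hh : ∀ j, 0 < h j)
    (hh0 : Filter.Tendsto h Filter.atTop (nhds 0)) (N : ℝ≥0) {C : ℝ} (hC : 0 ≤ C) :
    Filter.Tendsto (fun j => ENNReal.ofReal (C / h j) *
      (volume (badSet u e κ δ (h j) k ∩ closedBall x ρ) +
        N * volume (badSet u e κ δ (h j) k ∩ closedBall x ρ) ^ (2 / 3 : ℝ)))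
      Filter.atTop (nhds 0) := by
  obtain ⟨C1, h₀, hh₀, hC1⟩ := H k hk ρ hρ
  have hlim : ∀ b > (0 : ℝ), Filter.Tendsto (fun j => ENNReal.ofReal (h j) ^ b)
      Filter.atTop (nhds 0) := by
    intro b hb
    have h1 := (ENNReal.continuous_rpow_const (y := b)).tendsto 0
    rw [ENNReal.zero_rpow_of_pos hb] at h1
    refine h1.comp ?_
    rw [← ENNReal.ofReal_zero]
    exact (ENNReal.continuous_ofReal.tendsto 0).comp hh0
  have hbound : Filter.Tendsto (fun j => ENNReal.ofReal C *
      (C1 * ENNReal.ofReal (h j) ^ (2 / 3 : ℝ) +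
        N * ((C1 : ℝ≥0∞) ^ (2 / 3 : ℝ) * ENNReal.ofReal (h j) ^ (1 / 9 : ℝ))))
      Filter.atTop (nhds 0) := by
    have h1 := ENNReal.Tendsto.const_mul (hlim (2 / 3) (by norm_num))
      (Or.inr (ENNReal.coe_ne_top (r := C1)))
    have hne : (C1 : ℝ≥0∞) ^ (2 / 3 : ℝ) ≠ ⊤ :=
      ENNReal.rpow_ne_top_of_nonneg (by norm_num) ENNReal.coe_ne_top
    have h2 := ENNReal.Tendsto.const_mul (ENNReal.Tendsto.const_mul
      (hlim (1 / 9) (by norm_num)) (Or.inr hne)) (Or.inr (ENNReal.coe_ne_top (r := N)))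
    have h3 := ENNReal.Tendsto.const_mul (h1.add h2) (Or.inr (ENNReal.ofReal_ne_top (r := C)))
    simpa using h3
  refine tendsto_of_tendsto_of_tendsto_of_le_of_le' tendsto_const_nhds hbound
    (Filter.Eventually.of_forall fun _ => zero_le) ?_
  filter_upwards [hh0.eventually (gt_mem_nhds hh₀)] with j hj
  have hp : ENNReal.ofReal (h j) ≠ 0 := (ENNReal.ofReal_pos.2 (hh j)).ne'
  have hV := hC1 (h j) (hh j) hj
  rw [div_eq_mul_inv, ENNReal.ofReal_mul hC, mul_assoc]
  refine mul_le_mul_right ?_ _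
  have e0 : ENNReal.ofReal (h j)⁻¹ = ENNReal.ofReal (h j) ^ (-1 : ℝ) := by
    rw [ENNReal.rpow_neg_one, ENNReal.ofReal_inv_of_pos (hh j)]
  rw [mul_add]
  refine add_le_add ?_ ?_
  · calc _ ≤ ENNReal.ofReal (h j)⁻¹ * (C1 * ENNReal.ofReal (h j) ^ (5 / 3 : ℝ)) :=
          mul_le_mul_right hV _
      _ = C1 * (ENNReal.ofReal (h j) ^ (-1 : ℝ) * ENNReal.ofReal (h j) ^ (5 / 3 : ℝ)) := by
          rw [e0]; ring
      _ = _ := by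
          rw [← ENNReal.rpow_add _ _ hp ENNReal.ofReal_ne_top]; norm_num
  · calc _ ≤ ENNReal.ofReal (h j)⁻¹ *
          (N * (C1 * ENNReal.ofReal (h j) ^ (5 / 3 : ℝ)) ^ (2 / 3 : ℝ)) := by gcongr
      _ = N * ((C1 : ℝ≥0∞) ^ (2 / 3 : ℝ) *
          (ENNReal.ofReal (h j) ^ (-1 : ℝ) * ENNReal.ofReal (h j) ^ (10 / 9 : ℝ))) := by
          rw [e0, ENNReal.mul_rpow_of_nonneg _ _ (by norm_num), ← ENNReal.rpow_mul]
          norm_num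
          ring
      _ = _ := by
          rw [← ENNReal.rpow_add _ _ hp ENNReal.ofReal_ne_top]; norm_num

set_option maxHeartbeats 1000000 in
/-- Reverse Hölder inequality for truncated directional derivatives. -/
theorem LipSolution.reverse_holder (hn : 2 < n) {p' : ℝ≥0}
    (hp' : (p' : ℝ)⁻¹ = (2 : ℝ)⁻¹ - (n : ℝ)⁻¹) (sol : LipSolution S u f x R M K N)
    (ell : EllipticField S M δ κ lam Lam) (hf : ∫⁻ y in ball x R, ‖f y‖ₑ ^ 2 ≠ ⊤)
    (hδ : 0 < δ) (hκ : 0 ≤ κ) (hR : 0 < R) {e : Eucl n} (he : ‖e‖ ≤ 1) {k : ℝ} (hk : κ < k) :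
    eLpNorm ((closedBall x (R / 2)).indicator fun y => max (lineDeriv ℝ u y e - k) 0) p' volume ≤
      SNormLESNormFDerivOfEqConst ℝ (volume : Measure (Eucl n)) 2 *
        (ENNReal.ofReal (352 * (Lam / lam) / R ^ 2) *
            (∫⁻ y in ball x R, ENNReal.ofReal (max (lineDeriv ℝ u y e - k) 0 ^ 2)) +
          ENNReal.ofReal (8 / lam ^ 2) * ∫⁻ y in ball x R, ‖f y‖ₑ ^ 2) ^ (1 / 2 : ℝ) := by
  have hlam := ell.lam_pos
  have hLam : 0 < Lam := hlam.trans_le ell.lam_le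
  set ρ : ℝ := 3 * R / 4 with hρdef
  have hρR : ρ < R := by rw [hρdef]; linarith
  obtain ⟨η, hηL, hη0, hη1, hηs, hηe⟩ := exists_lipschitz_cutoff x
    (show R / 2 < ρ by rw [hρdef]; linarith)
  set ℓ := Real.toNNReal (ρ - R / 2)⁻¹ with hℓ
  have hℓv : (ℓ : ℝ) = 4 / R := by
    have h1 : ρ - R / 2 = R / 4 := by rw [hρdef]; ring
    rw [hℓ, h1, Real.coe_toNNReal _ (by positivity)]; field_simp
  have H := sol.badDecay ell hf hδ hκ he
  obtain ⟨C, hC0, hC⟩ := sol.caccioppoli ell he hηL hη0 hη1 hρR hηs k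
  set h : ℕ → ℝ := fun j => R / 8 * (1 / ((j : ℝ) + 1)) with hh
  have hpos : ∀ j, 0 < h j := fun j => by positivity
  have hlim : Filter.Tendsto h Filter.atTop (nhds 0) := by
    have := (tendsto_one_div_add_atTop_nhds_zero_nat (𝕜 := ℝ)).const_mul (R / 8)
    rwa [mul_zero] at this
  have hle : ∀ j, ρ + h j < R := fun j => by
    have h1 : 1 / ((j : ℝ) + 1) ≤ 1 := by
      rw [div_le_one (by positivity)]; linarith [Nat.cast_nonneg (α := ℝ) j]
    have h2 : h j ≤ R / 8 * 1 := by rw [hh]; simp only; gcongr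
    rw [hρdef]; linarith
  set v : Eucl n → ℝ := fun y => lineDeriv ℝ u y e with hv
  have hvm : Measurable v := measurable_lineDeriv sol.lip.continuous
  have hηm : Measurable η := hηL.continuous.measurable
  set D := closedBall x ρ with hD
  have hDm : MeasurableSet D := measurableSet_closedBall
  set ψ : ℕ → Eucl n → ℝ := fun j y => max (dq u e (h j) y - k) 0 with hψ
  have hψ0 : ∀ j y, 0 ≤ ψ j y := fun j y => le_max_right _ _
  have hψB : ∀ j y, ψ j y ≤ K + |k| := fun j y => by
    have h1 := (abs_le.1 (abs_dq_le sol.lip he (hpos j) y)).2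
    have h2 := neg_abs_le k
    exact max_le (by linarith) (by positivity)
  have hdqm : ∀ j, Measurable (dq u e (h j)) := fun j => by
    have := sol.lip.continuous.measurable
    unfold dq; fun_prop
  have hψm : ∀ j, Measurable (ψ j) := fun j => by
    have := hdqm j
    rw [hψ]; fun_prop
  have hψL : ∀ j, ∃ L, LipschitzWith L fun y => η y * ψ j y := fun j => by
    obtain ⟨Lq, hLq⟩ := lipschitzWith_dq sol.lip e (h j)
    have h1 : LipschitzWith Lq (ψ j) := by
      have h2 : LipschitzWith Lq fun y => dq u e (h j) y - k := by
        refine LipschitzWith.of_dist_le_mul fun a b => ?_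
        rw [dist_sub_right]; exact hLq.dist_le_mul a b
      exact h2.max_const 0
    refine ⟨ℓ * (K + ‖k‖₊) + Lq, LipschitzWith.of_dist_le_mul fun a b => ?_⟩
    have h2 := hηL.dist_le_mul a b
    have h3 := h1.dist_le_mul a b
    rw [Real.dist_eq] at h2 h3 ⊢
    have e1 : η a * ψ j a - η b * ψ j b = (η a - η b) * ψ j a + η b * (ψ j a - ψ j b) := by ring
    rw [e1]
    refine (abs_add_le _ _).trans ?_
    rw [abs_mul, abs_mul, abs_of_nonneg (hψ0 j a), abs_of_nonneg (hη0 b)]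
    calc _ ≤ (ℓ * dist a b) * (K + |k|) + 1 * (Lq * dist a b) := by
          gcongr
          · exact hψB j a
          · exact hη1 b
      _ = _ := by push_cast; rw [Real.norm_eq_abs]; ring
  choose L hL using hψL
  have hdiff := sol.lip.ae_differentiableAt (μ := volume)
  have hψlim : ∀ᵐ y, Filter.Tendsto (fun j => ψ j y) Filter.atTop (nhds (max (v y - k) 0)) := by
    filter_upwards [hdiff] with y hy
    exact ((tendsto_dq_lineDeriv hy hpos hlim).sub_const k).max tendsto_const_nhds
  -- decomposition of the gradient
  set P : ℕ → Set (Eucl n) := fun j => {y | k < dq u e (h j) y} with hP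
  have hPm : ∀ j, MeasurableSet (P j) := fun j => measurableSet_lt measurable_const (hdqm j)
  set X : ℕ → Eucl n → ℝ≥0∞ := fun j => (P j).indicator fun y =>
    ENNReal.ofReal (lam⁻¹) * ENNReal.ofReal (η y ^ 2 * energy S u e (h j) y) with hX
  have hEm : ∀ j, Measurable (energy S u e (h j)) := fun j =>
    measurable_energy ell.measurable u e (h j)
  have hXm : ∀ j, Measurable (X j) := fun j => by
    have := hEm j
    exact Measurable.indicator (by fun_prop) (hPm j)
  set Y : ℕ → Eucl n → ℝ≥0∞ := fun j => D.indicator fun y => ENNReal.ofReal (ℓ * ψ j y) with hY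
  have hYm : ∀ j, Measurable (Y j) := fun j => by
    have := hψm j
    exact Measurable.indicator (by fun_prop) hDm
  set Bd : ℕ → Set (Eucl n) := fun j => badSet u e κ δ (h j) k ∩ D with hBd
  have hBdm : ∀ j, MeasurableSet (Bd j) := fun j =>
    (measurableSet_badSet sol.lip.continuous e κ δ (h j) k).inter hDm
  set G : ℕ → Eucl n → ℝ≥0∞ := fun j y => X j y ^ (1 / 2 : ℝ) + Y j y with hG
  set B : ℕ → Eucl n → ℝ≥0∞ := fun j => (Bd j).indicator fun _ =>
    ENNReal.ofReal (2 * max M 0 / h j) with hB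
  have hGm : ∀ j, Measurable (G j) := fun j => ((hXm j).pow_const _).add (hYm j)
  have hGB : ∀ j, ∀ᵐ y, ‖fderiv ℝ (fun y => η y * ψ j y) y‖ₑ ≤ G j y + B j y := by
    intro j
    filter_upwards [ae_norm_fderiv_cutoff_mul_le sol.lip hηL hη0 e (hpos j) k, sol.grad_le,
      ae_translate sol.grad_le (h j • e)] with y hy ha hb
    by_cases hyD : y ∈ D
    swap
    · have hmin : IsLocalMin (fun y => η y * ψ j y) y := by
        refine Filter.Eventually.of_forall fun z => ?_
        simp only
        rw [hηs y hyD, zero_mul]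
        exact mul_nonneg (hη0 _) (hψ0 j z)
      rw [hmin.fderiv_eq_zero]
      exact (enorm_zero (E := Eucl n →L[ℝ] ℝ)).le.trans zero_le
    have hyr := mem_closedBall.1 hyD
    have hdist : dist (y + h j • e) y ≤ h j := by
      rw [dist_eq_norm, add_sub_cancel_left, norm_smul, Real.norm_of_nonneg (hpos j).le]
      exact mul_le_of_le_one_right (hpos j).le he
    replace ha := ha (by rw [mem_ball]; linarith)
    replace hb := hb (by
      rw [mem_ball]; linarith [dist_triangle (y + h j • e) y x, hle j])
    rw [← ofReal_norm]
    refine (ENNReal.ofReal_le_ofReal hy).trans ?_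
    split_ifs with hkk
    swap
    · simp
    have hhj := hpos j
    have hηy := hη0 y
    have hψe : max (dq u e (h j) y - k) 0 = ψ j y := rfl
    rw [hψe, ENNReal.ofReal_add (by positivity) (mul_nonneg ℓ.coe_nonneg (hψ0 j y))]
    have hYy : Y j y = ENNReal.ofReal (ℓ * ψ j y) := indicator_of_mem hyD _
    by_cases hbad : y ∈ badSet u e κ δ (h j) k
    · have hBy : B j y = ENNReal.ofReal (2 * max M 0 / h j) :=
        indicator_of_mem (show y ∈ Bd j from ⟨hbad, hyD⟩) _
      rw [hG]
      simp only
      rw [hYy, hBy, add_comm]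
      refine add_le_add le_add_self (ENNReal.ofReal_le_ofReal ?_)
      have hM : ‖gradient u (y + h j • e) - gradient u y‖ ≤ 2 * max M 0 := by
        refine (norm_sub_le _ _).trans ?_
        have := le_max_left M 0
        linarith
      calc _ ≤ 1 / h j * (2 * max M 0) := by
            gcongr
            exact hη1 y
        _ = _ := by ring
    · have hgood := not_not.1 fun h' => hbad ⟨hkk, h'⟩
      refine le_trans ?_ le_self_add
      rw [hG]
      simp only
      rw [hYy]
      refine add_le_add ?_ le_rfl
      have hXy : X j y = ENNReal.ofReal (lam⁻¹) *
        ENNReal.ofReal (η y ^ 2 * energy S u e (h j) y) := indicator_of_mem (show y ∈ P j from hkk) _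
      rw [hXy, ← ENNReal.ofReal_mul (by positivity)]
      have hco := ell.coer _ _ ha hb hgood.1 hgood.2
      have h1 : (η y / h j * ‖gradient u (y + h j • e) - gradient u y‖) ^ 2 ≤
          lam⁻¹ * (η y ^ 2 * energy S u e (h j) y) := by
        rw [energy, inv_mul_eq_div, le_div_iff₀ hlam]
        have e1 : (η y / h j * ‖gradient u (y + h j • e) - gradient u y‖) ^ 2 * lam =
          η y ^ 2 * ((lam * ‖gradient u (y + h j • e) - gradient u y‖ ^ 2) / h j ^ 2) := by
          field_simp
        rw [e1]
        gcongr
      calc ENNReal.ofReal (η y / h j * ‖gradient u (y + h j • e) - gradient u y‖)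
          = (ENNReal.ofReal
              ((η y / h j * ‖gradient u (y + h j • e) - gradient u y‖) ^ 2)) ^ (1 / 2 : ℝ) := by
            rw [ENNReal.ofReal_pow (by positivity), ← ENNReal.rpow_natCast, ← ENNReal.rpow_mul]
            norm_num
        _ ≤ _ := by gcongr
  have hBlim : Filter.Tendsto (fun j => ∫⁻ y, B j y) Filter.atTop (nhds 0) := by
    have h1 := tendsto_badSet_error (N := 0) H hk hρR hpos hlim
      (show 0 ≤ 2 * max M 0 by positivity)
    refine h1.congr fun j => ?_
    rw [hB]
    simp only
    rw [lintegral_indicator_const (hBdm j)]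
    simp [hBd, hD]
  set I : ℕ → ℝ≥0∞ := fun j => ∫⁻ y in D, ENNReal.ofReal (ψ j y ^ 2) with hI
  set I' : ℝ≥0∞ := ∫⁻ y in D, ENNReal.ofReal (max (v y - k) 0 ^ 2) with hI'
  have hIlim : Filter.Tendsto I Filter.atTop (nhds I') := by
    refine tendsto_lintegral_of_dominated_convergence (fun _ => ENNReal.ofReal ((K + |k|) ^ 2))
      (fun j => ?_) (fun j => Filter.Eventually.of_forall fun y => ?_) ?_ ?_
    · have := hψm j
      fun_prop
    · exact ENNReal.ofReal_le_ofReal (pow_le_pow_left₀ (hψ0 j y) (hψB j y) 2)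
    · rw [setLIntegral_const]
      exact ENNReal.mul_ne_top ENNReal.ofReal_ne_top measure_closedBall_lt_top.ne
    · refine ae_restrict_of_ae ?_
      filter_upwards [hψlim] with y hy
      exact (ENNReal.continuous_ofReal.tendsto _).comp (hy.pow 2)
  set If : ℝ≥0∞ := ∫⁻ y in ball x R, ‖f y‖ₑ ^ 2 with hIf
  set Err : ℕ → ℝ≥0∞ := fun j => ENNReal.ofReal (C / h j) *
      (volume (badSet u e κ δ (h j) k ∩ closedBall x ρ) +
        N * volume (badSet u e κ δ (h j) k ∩ closedBall x ρ) ^ (2 / 3 : ℝ)) with hErr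
  have hErrlim : Filter.Tendsto Err Filter.atTop (nhds 0) :=
    tendsto_badSet_error H hk hρR hpos hlim N hC0
  have hDj : ∀ j, ∫⁻ y, G j y ^ 2 ≤ 2 * (ENNReal.ofReal lam⁻¹ *
      (ENNReal.ofReal (10 * Lam * ℓ ^ 2) * I j + ENNReal.ofReal (4 / lam) * If + Err j)) +
      2 * (ENNReal.ofReal (ℓ ^ 2) * I j) := by
    intro j
    calc ∫⁻ y, G j y ^ 2 ≤ ∫⁻ y, (2 * X j y + 2 * Y j y ^ 2) := by
          refine lintegral_mono fun y => (ENNReal_add_sq_le _ _).trans (le_of_eq ?_)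
          congr 2
          rw [← ENNReal.rpow_natCast, ← ENNReal.rpow_mul]
          norm_num
      _ = 2 * (∫⁻ y, X j y) + 2 * (∫⁻ y, Y j y ^ 2) := by
          rw [lintegral_add_left ((hXm j).const_mul _), lintegral_const_mul _ (hXm j),
            lintegral_const_mul _ ((hYm j).pow_const 2)]
      _ ≤ _ := by
          refine add_le_add (mul_le_mul_right ?_ _) (mul_le_mul_right ?_ _)
          · rw [hX]
            simp only
            rw [lintegral_indicator (hPm j), lintegral_const_mul' _ _ ENNReal.ofReal_ne_top]
            exact mul_le_mul_right (hC (h j) (hpos j) (hle j)) _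
          · have e1 : ∀ y, Y j y ^ 2 = D.indicator (fun y => ENNReal.ofReal (ℓ ^ 2) *
                ENNReal.ofReal (ψ j y ^ 2)) y := by
              intro y
              by_cases hy : y ∈ D
              · simp only [hY, indicator_of_mem hy]
                rw [← ENNReal.ofReal_pow (mul_nonneg ℓ.coe_nonneg (hψ0 j y)),
                  ← ENNReal.ofReal_mul (by positivity), mul_pow]
              · simp [hY, indicator_of_notMem hy]
            simp only [e1]
            rw [lintegral_indicator hDm, lintegral_const_mul' _ _ ENNReal.ofReal_ne_top]
  have two_ne : (2 : ℝ≥0∞) ≠ ⊤ := ENNReal.ofNat_ne_top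
  have hD' : Filter.Tendsto (fun j => 2 * (ENNReal.ofReal lam⁻¹ *
      (ENNReal.ofReal (10 * Lam * ℓ ^ 2) * I j + ENNReal.ofReal (4 / lam) * If + Err j)) +
      2 * (ENNReal.ofReal (ℓ ^ 2) * I j)) Filter.atTop (nhds (2 * (ENNReal.ofReal lam⁻¹ *
      (ENNReal.ofReal (10 * Lam * ℓ ^ 2) * I' + ENNReal.ofReal (4 / lam) * If + 0)) +
      2 * (ENNReal.ofReal (ℓ ^ 2) * I'))) := by
    refine (ENNReal.Tendsto.const_mul (ENNReal.Tendsto.const_mul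
      (((ENNReal.Tendsto.const_mul hIlim (Or.inr ENNReal.ofReal_ne_top)).add
        tendsto_const_nhds).add hErrlim) (Or.inr ENNReal.ofReal_ne_top)) (Or.inr two_ne)).add
      (ENNReal.Tendsto.const_mul (ENNReal.Tendsto.const_mul hIlim
        (Or.inr ENNReal.ofReal_ne_top)) (Or.inr two_ne))
  have key := eLpNorm_le_of_tendsto_of_fderiv_le hn hp' (g := fun y => η y * max (v y - k) 0)
    (gj := fun j y => η y * ψ j y) (A := K + |k|) (R := ρ) (z := x) (K := L)
    (by fun_prop) hL (fun j y => by
      rw [abs_of_nonneg (mul_nonneg (hη0 y) (hψ0 j y))]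
      exact (mul_le_of_le_one_left (hψ0 j y) (hη1 y)).trans (hψB j y))
    (fun j y hy => by rw [hηs y hy, zero_mul]) (fun y hy => by rw [hηs y hy, zero_mul])
    (by
      filter_upwards [hψlim] with y hy
      exact hy.const_mul _) hGm hGB hBlim hDj hD'
  refine le_trans (eLpNorm_mono_real (g := fun y => η y * max (v y - k) 0) fun y => ?_)
    (key.trans (mul_le_mul_right ?_ _))
  · by_cases hy : y ∈ closedBall x (R / 2)
    · rw [indicator_of_mem hy, hηe y hy, one_mul, Real.norm_of_nonneg (le_max_right _ _)]
    · rw [indicator_of_notMem hy, norm_zero]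
      exact mul_nonneg (hη0 y) (le_max_right _ _)
  · refine ENNReal.rpow_le_rpow ?_ (by norm_num)
    have hI'le : I' ≤ ∫⁻ y in ball x R, ENNReal.ofReal (max (lineDeriv ℝ u y e - k) 0 ^ 2) :=
      lintegral_mono_set (closedBall_subset_ball hρR)
    have two : (2 : ℝ≥0∞) = ENNReal.ofReal 2 := by norm_num
    calc _ = ENNReal.ofReal (2 * lam⁻¹ * (10 * Lam * ℓ ^ 2) + 2 * ℓ ^ 2) * I' +
          ENNReal.ofReal (2 * lam⁻¹ * (4 / lam)) * If := by
          rw [ENNReal.ofReal_add (by positivity) (by positivity), two,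
            ENNReal.ofReal_mul (p := 2 * lam⁻¹) (q := 10 * Lam * ℓ ^ 2) (by positivity),
            ENNReal.ofReal_mul (p := 2 * lam⁻¹) (q := 4 / lam) (by positivity),
            ENNReal.ofReal_mul (p := 2) (q := lam⁻¹) (by norm_num),
            ENNReal.ofReal_mul (p := 2) (q := (ℓ : ℝ) ^ 2) (by norm_num)]
          ring
      _ ≤ _ := by
          refine add_le_add (mul_le_mul' (ENNReal.ofReal_le_ofReal ?_) hI'le)
            (mul_le_mul_left (ENNReal.ofReal_le_ofReal (le_of_eq ?_)) _)
          · rw [hℓv]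
            have h1 : 1 ≤ Lam / lam := (one_le_div hlam).2 ell.lam_le
            have e1 : 2 * lam⁻¹ * (10 * Lam * (4 / R) ^ 2) + 2 * (4 / R) ^ 2 =
              (320 * (Lam / lam) + 32 * 1) / R ^ 2 := by field_simp; ring
            rw [e1]
            gcongr
            linarith
          · field_simp; ring

end ReverseHolder

section DeGiorgi

variable {n : ℕ}

/-- The squared `L²`-norm of `(v - k)₊` over `ball x r`. -/
def levelEnergy (v : Eucl n → ℝ) (x : Eucl n) (r k : ℝ) : ℝ≥0∞ :=
  ∫⁻ y in ball x r, ENNReal.ofReal (max (v y - k) 0 ^ 2)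

theorem levelEnergy_anti {v : Eucl n → ℝ} {x : Eucl n} {r k k' : ℝ} (h : k ≤ k') :
    levelEnergy v x r k' ≤ levelEnergy v x r k := by
  refine lintegral_mono fun y => ENNReal.ofReal_le_ofReal ?_
  refine pow_le_pow_left₀ (le_max_right _ _) (max_le_max (by linarith) le_rfl) 2

theorem volume_superlevel_le {v : Eucl n → ℝ} (hv : Measurable v) {x : Eucl n} {r k k' : ℝ}
    (h : k < k') :
    volume {y | y ∈ ball x r ∧ k' < v y} ≤
      ENNReal.ofReal (1 / (k' - k) ^ 2) * levelEnergy v x r k := by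
  have hd : 0 < k' - k := sub_pos.2 h
  have hm : MeasurableSet {y | y ∈ ball x r ∧ k' < v y} :=
    measurableSet_ball.inter (measurableSet_lt measurable_const hv)
  rw [levelEnergy, ← lintegral_const_mul' _ _ ENNReal.ofReal_ne_top, ← setLIntegral_one]
  refine (setLIntegral_mono' hm fun y hy => ?_).trans (lintegral_mono_set fun y hy => hy.1)
  rw [← ENNReal.ofReal_mul (by positivity), ← ENNReal.ofReal_one]
  refine ENNReal.ofReal_le_ofReal ?_
  rw [div_mul_eq_mul_div, one_mul, le_div_iff₀ (by positivity), one_mul]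
  exact pow_le_pow_left₀ hd.le (le_max_of_le_left (by linarith [hy.2])) 2

theorem levelEnergy_step (hn : 2 < n) {p' : ℝ≥0} (hp' : (p' : ℝ)⁻¹ = (2 : ℝ)⁻¹ - (n : ℝ)⁻¹)
    {v : Eucl n → ℝ} (hv : Measurable v) {x : Eucl n} {r k k' : ℝ} (hr : 0 < r) (h : k < k')
    {Cs : ℝ≥0} {Q : ℝ≥0∞}
    (H : eLpNorm ((closedBall x (r / 2)).indicator fun y => max (v y - k') 0) p' volume ≤
      Cs * Q ^ (1 / 2 : ℝ)) :
    levelEnergy v x (r / 2) k' ≤ Cs ^ 2 * Q *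
      (ENNReal.ofReal (1 / (k' - k) ^ 2) * levelEnergy v x r k) ^ (2 / n : ℝ) := by
  have hn0 : (0 : ℝ) < n := by positivity
  have hn2 : (2 : ℝ) < n := by exact_mod_cast hn
  have hp0 : (0 : ℝ) < (p' : ℝ)⁻¹ := by
    rw [hp', sub_pos]; exact inv_strictAnti₀ (by norm_num) hn2
  have hp2 : (2 : ℝ) ≤ p' := by
    rw [← inv_le_inv₀ (inv_pos.1 hp0) two_pos, hp']
    linarith [inv_pos.2 hn0]
  set s := {y | y ∈ ball x r ∧ k' < v y} with hs
  have hsm : MeasurableSet s := measurableSet_ball.inter (measurableSet_lt measurable_const hv)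
  set g := (closedBall x (r / 2)).indicator fun y => max (v y - k') 0 with hg
  have hgm : Measurable g := Measurable.indicator (by fun_prop) measurableSet_closedBall
  have h1 : levelEnergy v x (r / 2) k' ≤ eLpNorm g 2 (volume.restrict s) ^ 2 := by
    have e1 := eLpNorm_nnreal_pow_eq_lintegral (f := g) (μ := volume.restrict s) (p := 2)
      (by norm_num)
    simp only [NNReal.coe_ofNat, ENNReal.coe_ofNat, ENNReal.rpow_ofNat] at e1
    rw [e1, levelEnergy, ← lintegral_indicator measurableSet_ball, ← lintegral_indicator hsm]
    refine lintegral_mono fun y => ?_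
    by_cases hy : y ∈ ball x (r / 2)
    · rw [indicator_of_mem hy]
      by_cases hvy : k' < v y
      · rw [indicator_of_mem (show y ∈ s from ⟨ball_subset_ball (by linarith) hy, hvy⟩), hg,
          indicator_of_mem (ball_subset_closedBall hy), Real.enorm_eq_ofReal (le_max_right _ _),
          ENNReal.ofReal_pow (le_max_right _ _)]
      · rw [max_eq_right (by linarith)]; simp
    · rw [indicator_of_notMem hy]; exact zero_le
  have h2 : eLpNorm g 2 (volume.restrict s) ≤
      (Cs * Q ^ (1 / 2 : ℝ)) * volume s ^ (1 / (n : ℝ)) := by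
    have h3 := eLpNorm_le_eLpNorm_mul_rpow_measure_univ (μ := volume.restrict s) (f := g)
      (p := 2) (q := p') (by exact_mod_cast hp2) hgm.aestronglyMeasurable
    rw [Measure.restrict_apply_univ] at h3
    have e2 : 1 / (2 : ℝ≥0∞).toReal - 1 / (p' : ℝ≥0∞).toReal = 1 / (n : ℝ) := by
      simp only [ENNReal.toReal_ofNat, ENNReal.coe_toReal, one_div, hp']; ring
    rw [e2] at h3
    refine h3.trans (mul_le_mul_left ((eLpNorm_mono_measure g Measure.restrict_le_self).trans H) _)
  calc levelEnergy v x (r / 2) k' ≤ ((Cs * Q ^ (1 / 2 : ℝ)) * volume s ^ (1 / (n : ℝ))) ^ 2 :=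
        h1.trans (pow_le_pow_left₀ zero_le h2 2)
    _ = Cs ^ 2 * Q * volume s ^ (2 / n : ℝ) := by
        rw [mul_pow, mul_pow, ← ENNReal.rpow_natCast (Q ^ (1 / 2 : ℝ)), ← ENNReal.rpow_mul,
          ← ENNReal.rpow_natCast (volume s ^ _), ← ENNReal.rpow_mul]
        have : 1 / (n : ℝ) * (2 : ℕ) = 2 / n := by push_cast; ring
        rw [this]; norm_num
    _ ≤ _ := by
        gcongr
        exact volume_superlevel_le hv h

theorem levelEnergy_step_ofReal (hn : 2 < n) {p' : ℝ≥0}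
    (hp' : (p' : ℝ)⁻¹ = (2 : ℝ)⁻¹ - (n : ℝ)⁻¹) {v : Eucl n → ℝ} (hv : Measurable v) {x : Eucl n}
    {r k A G γ g b Θ : ℝ} (hr : 0 < r) {Cs : ℝ≥0} {Φ : ℝ≥0∞} (hA : 0 ≤ A) (hG : G ≤ A * γ ^ 2)
    (hγ : 0 ≤ γ) (hg : 0 ≤ g) (hb : 0 < b) (hΘ : 0 < Θ)
    (hΘA : Cs ^ 2 * A * 2 ^ (n + 2) ≤ Θ ^ (4 / n : ℝ))
    (hΦ : Φ ≤ ENNReal.ofReal (r ^ n / r ^ 2 * g ^ 2))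
    (hW : levelEnergy v x r k ≤ ENNReal.ofReal (r ^ n * b ^ 2))
    (H : eLpNorm ((closedBall x (r / 2)).indicator fun y => max (v y - (k + Θ * b)) 0) p' volume ≤
      Cs * (ENNReal.ofReal (A / r ^ 2) * levelEnergy v x r (k + Θ * b) +
        ENNReal.ofReal G * Φ) ^ (1 / 2 : ℝ)) :
    levelEnergy v x (r / 2) (k + Θ * b) ≤
      ENNReal.ofReal ((r / 2) ^ n * ((b + γ * g) / 2) ^ 2) := by
  have hn0 : (0 : ℝ) < n := by positivity
  have hΘb : 0 < Θ * b := mul_pos hΘ hb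
  have h1 := levelEnergy_step hn hp' hv hr (show k < k + Θ * b by linarith) H
  have hQ : ENNReal.ofReal (A / r ^ 2) * levelEnergy v x r (k + Θ * b) +
      ENNReal.ofReal G * Φ ≤ ENNReal.ofReal (A * (r ^ n / r ^ 2) * (b + γ * g) ^ 2) := by
    calc _ ≤ ENNReal.ofReal (A / r ^ 2) * ENNReal.ofReal (r ^ n * b ^ 2) +
          ENNReal.ofReal (A * γ ^ 2) * ENNReal.ofReal (r ^ n / r ^ 2 * g ^ 2) := by
          gcongr
          exact (levelEnergy_anti (by linarith)).trans hW
      _ = ENNReal.ofReal (A * (r ^ n / r ^ 2) * (b ^ 2 + (γ * g) ^ 2)) := by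
          rw [← ENNReal.ofReal_mul (by positivity), ← ENNReal.ofReal_mul (by positivity),
            ← ENNReal.ofReal_add (by positivity) (by positivity)]
          congr 1; ring
      _ ≤ _ := by
          refine ENNReal.ofReal_le_ofReal (mul_le_mul_of_nonneg_left ?_ (by positivity))
          have : 0 ≤ b * (γ * g) := by positivity
          nlinarith
  have hV : (ENNReal.ofReal (1 / (k + Θ * b - k) ^ 2) * levelEnergy v x r k) ^ (2 / n : ℝ) ≤
      ENNReal.ofReal (r ^ 2 / Θ ^ (4 / n : ℝ)) := by
    calc _ ≤ (ENNReal.ofReal (1 / (Θ * b) ^ 2) * ENNReal.ofReal (r ^ n * b ^ 2)) ^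
          (2 / n : ℝ) := by
          rw [add_sub_cancel_left]; gcongr
      _ = ENNReal.ofReal ((r ^ n / Θ ^ 2) ^ (2 / n : ℝ)) := by
          rw [← ENNReal.ofReal_mul (by positivity),
            ENNReal.ofReal_rpow_of_nonneg (by positivity) (by positivity)]
          congr 2; field_simp
      _ ≤ _ := by
          refine ENNReal.ofReal_le_ofReal (le_of_eq ?_)
          rw [Real.div_rpow (by positivity) (by positivity), ← Real.rpow_natCast r n,
            ← Real.rpow_natCast Θ 2, ← Real.rpow_mul hr.le, ← Real.rpow_mul hΘ.le]
          have e1 : (n : ℝ) * (2 / n) = (2 : ℕ) := by field_simp; norm_num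
          have e2 : ((2 : ℕ) : ℝ) * (2 / n) = 4 / n := by push_cast; ring
          rw [e1, e2, Real.rpow_natCast]
  refine (h1.trans (mul_le_mul' (mul_le_mul_right hQ _) hV)).trans ?_
  have hCs : (Cs : ℝ≥0∞) ^ 2 = ENNReal.ofReal (Cs ^ 2) := by
    rw [ENNReal.ofReal_pow Cs.coe_nonneg, ENNReal.ofReal_coe_nnreal]
  rw [hCs, ← ENNReal.ofReal_mul (by positivity), ← ENNReal.ofReal_mul (by positivity)]
  refine ENNReal.ofReal_le_ofReal ?_
  have hΘp : 0 < Θ ^ (4 / n : ℝ) := Real.rpow_pos_of_pos hΘ _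
  calc (Cs : ℝ) ^ 2 * (A * (r ^ n / r ^ 2) * (b + γ * g) ^ 2) * (r ^ 2 / Θ ^ (4 / n : ℝ))
      = (Cs ^ 2 * A * 2 ^ (n + 2)) / Θ ^ (4 / n : ℝ) * ((r / 2) ^ n * ((b + γ * g) / 2) ^ 2) := by
        rw [div_pow, pow_add]; field_simp
    _ ≤ 1 * ((r / 2) ^ n * ((b + γ * g) / 2) ^ 2) := by
        gcongr
        exact (div_le_one hΘp).2 hΘA
    _ = _ := one_mul _

/-- The recursively defined bounds `b i` in the level-set iteration. -/
def iterBound (b₀ γ : ℝ) (g : ℕ → ℝ) : ℕ → ℝ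
  | 0 => b₀
  | i + 1 => (iterBound b₀ γ g i + γ * g i) / 2

theorem iterBound_pos {b₀ γ : ℝ} {g : ℕ → ℝ} (hb : 0 < b₀) (hγ : 0 ≤ γ) (hg : ∀ i, 0 ≤ g i)
    (i : ℕ) : 0 < iterBound b₀ γ g i := by
  induction i with
  | zero => exact hb
  | succ i ih =>
    have := mul_nonneg hγ (hg i)
    rw [iterBound]; positivity

theorem sum_iterBound_le {b₀ γ Γ : ℝ} {g : ℕ → ℝ} (hb : 0 < b₀) (hγ : 0 ≤ γ) (hg : ∀ i, 0 ≤ g i)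
    (hΓ : ∀ m, ∑ i ∈ Finset.range m, g i ≤ Γ) (m : ℕ) :
    ∑ i ∈ Finset.range m, iterBound b₀ γ g i ≤ 2 * b₀ + γ * Γ := by
  have key : ∀ m, ∑ i ∈ Finset.range m, iterBound b₀ γ g i + 2 * iterBound b₀ γ g m ≤
      2 * b₀ + γ * ∑ i ∈ Finset.range m, g i := by
    intro m
    induction m with
    | zero => simp [iterBound]
    | succ m ih =>
      rw [Finset.sum_range_succ, Finset.sum_range_succ, iterBound, mul_add]
      linarith
  have h1 := key m
  have h2 := iterBound_pos hb hγ hg m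
  have h3 := mul_le_mul_of_nonneg_left (hΓ m) hγ
  linarith

theorem levelEnergy_iterate (hn : 2 < n) {p' : ℝ≥0}
    (hp' : (p' : ℝ)⁻¹ = (2 : ℝ)⁻¹ - (n : ℝ)⁻¹) {v : Eucl n → ℝ} (hv : Measurable v) {x : Eucl n}
    {R k₀ A G γ b₀ Θ : ℝ} (hR : 0 < R) {Cs : ℝ≥0} {Φ : ℝ → ℝ≥0∞} {g : ℕ → ℝ} (hA : 0 ≤ A)
    (hG : G ≤ A * γ ^ 2)
    (hγ : 0 ≤ γ) (hg : ∀ i, 0 ≤ g i) (hb : 0 < b₀) (hΘ : 0 < Θ)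
    (hΘA : Cs ^ 2 * A * 2 ^ (n + 2) ≤ Θ ^ (4 / n : ℝ))
    (hΦ : ∀ i, Φ (R / 2 ^ i) ≤ ENNReal.ofReal ((R / 2 ^ i) ^ n / (R / 2 ^ i) ^ 2 * g i ^ 2))
    (hW : levelEnergy v x R k₀ ≤ ENNReal.ofReal (R ^ n * b₀ ^ 2))
    (H : ∀ r, 0 < r → r ≤ R → ∀ k, k₀ ≤ k →
      eLpNorm ((closedBall x (r / 2)).indicator fun y => max (v y - k) 0) p' volume ≤
      Cs * (ENNReal.ofReal (A / r ^ 2) * levelEnergy v x r k +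
        ENNReal.ofReal G * Φ r) ^ (1 / 2 : ℝ)) (m : ℕ) :
    levelEnergy v x (R / 2 ^ m) (k₀ + Θ * ∑ i ∈ Finset.range m, iterBound b₀ γ g i) ≤
      ENNReal.ofReal ((R / 2 ^ m) ^ n * iterBound b₀ γ g m ^ 2) := by
  induction m with
  | zero => simpa [iterBound] using hW
  | succ m ih =>
    have hbm := iterBound_pos hb hγ hg
    have hs : 0 ≤ ∑ i ∈ Finset.range m, iterBound b₀ γ g i :=
      Finset.sum_nonneg fun i _ => (hbm i).le
    have hrm : R / 2 ^ m ≤ R := div_le_self hR.le (one_le_pow₀ one_le_two)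
    have e1 : R / 2 ^ (m + 1) = R / 2 ^ m / 2 := by rw [pow_succ]; field_simp
    have e2 : k₀ + Θ * ∑ i ∈ Finset.range (m + 1), iterBound b₀ γ g i =
        k₀ + Θ * ∑ i ∈ Finset.range m, iterBound b₀ γ g i + Θ * iterBound b₀ γ g m := by
      rw [Finset.sum_range_succ]; ring
    rw [e1, e2]
    refine levelEnergy_step_ofReal hn hp' hv (by positivity) hA hG hγ (hg m) (hbm m) hΘ hΘA (hΦ m)
      ih (H _ (by positivity) hrm _ ?_)
    have := mul_nonneg hΘ.le hs
    have := mul_pos hΘ (hbm m)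
    linarith

/-- A pointwise bound at Lebesgue points from decay of the level energies. -/
theorem le_of_levelEnergy_le {v : Eucl n → ℝ} (hv : Measurable v) {x : Eucl n} {R k : ℝ}
    (hR : 0 < R) {b : ℕ → ℝ} (hb : Filter.Tendsto b Filter.atTop (nhds 0))
    (hW : ∀ m : ℕ, levelEnergy v x (R / 2 ^ m) k ≤ ENNReal.ofReal ((R / 2 ^ m) ^ n * b m ^ 2))
    {c : ℝ} (hx : Filter.Tendsto (fun r => (∫⁻ y in closedBall x r, ‖v y - c‖ₑ) /
      volume (closedBall x r)) (nhdsWithin 0 (Ioi 0)) (nhds 0)) : c ≤ k := by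
  by_contra! hlt
  set d := c - k with hd
  have hd0 : 0 < d := sub_pos.2 hlt
  set r : ℕ → ℝ := fun m => R / 2 ^ m with hr
  have hr0 : ∀ m, 0 < r m := fun m => by positivity
  have hrl : Filter.Tendsto r Filter.atTop (nhdsWithin 0 (Ioi 0)) := by
    refine tendsto_nhdsWithin_iff.2 ⟨?_, Filter.Eventually.of_forall hr0⟩
    have := (tendsto_pow_atTop_nhds_zero_of_lt_one (r := (1 / 2 : ℝ)) (by norm_num)
      (by norm_num)).const_mul R
    simpa [hr, div_eq_mul_inv] using this
  set V := volume (ball (0 : Eucl n) 1) with hV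
  have hV0 : V ≠ 0 := (measure_ball_pos _ _ one_pos).ne'
  have hVt : V ≠ ⊤ := measure_ball_lt_top.ne
  have hvol : ∀ m, volume (closedBall x (r m)) = ENNReal.ofReal (r m ^ n) * V := fun m => by
    rw [Measure.addHaar_closedBall _ _ (hr0 m).le, finrank_euclideanSpace, Fintype.card_fin]
  have hpt : ∀ m, 1 ≤ ENNReal.ofReal (4 / d ^ 2 * b m ^ 2) / V + ENNReal.ofReal (2 / d) *
      ((∫⁻ y in closedBall x (r m), ‖v y - c‖ₑ) / volume (closedBall x (r m))) := by
    intro m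
    have h1 : volume (closedBall x (r m)) ≤
        ENNReal.ofReal (4 / d ^ 2 * b m ^ 2) * ENNReal.ofReal (r m ^ n) + ENNReal.ofReal (2 / d) *
          ∫⁻ y in closedBall x (r m), ‖v y - c‖ₑ := by
      calc volume (closedBall x (r m)) = ∫⁻ y in closedBall x (r m), 1 := by
            rw [setLIntegral_one]
        _ ≤ ∫⁻ y in closedBall x (r m), (ENNReal.ofReal (4 / d ^ 2) *
            ENNReal.ofReal (max (v y - k) 0 ^ 2) + ENNReal.ofReal (2 / d) * ‖v y - c‖ₑ) := by
            refine lintegral_mono fun y => ?_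
            rw [Real.enorm_eq_ofReal_abs, ← ENNReal.ofReal_mul (by positivity),
              ← ENNReal.ofReal_mul (by positivity),
              ← ENNReal.ofReal_add (by positivity) (by positivity), ← ENNReal.ofReal_one]
            refine ENNReal.ofReal_le_ofReal ?_
            rcases le_total (d / 2) |v y - c| with h | h
            · have : 1 ≤ 2 / d * |v y - c| := by
                rw [div_mul_eq_mul_div, le_div_iff₀ hd0]; linarith
              have : 0 ≤ 4 / d ^ 2 * max (v y - k) 0 ^ 2 := by positivity
              linarith
            · have h2 : d / 2 ≤ max (v y - k) 0 := by
                refine le_max_of_le_left ?_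
                have := (abs_le.1 h).1
                linarith
              have h3 : 1 ≤ 4 / d ^ 2 * max (v y - k) 0 ^ 2 := by
                rw [div_mul_eq_mul_div, le_div_iff₀ (by positivity)]
                have := pow_le_pow_left₀ (by positivity) h2 2
                linarith
              have : 0 ≤ 2 / d * |v y - c| := by positivity
              linarith
        _ = ENNReal.ofReal (4 / d ^ 2) * levelEnergy v x (r m) k + ENNReal.ofReal (2 / d) *
            ∫⁻ y in closedBall x (r m), ‖v y - c‖ₑ := by
            rw [lintegral_add_left (by fun_prop), lintegral_const_mul' _ _ ENNReal.ofReal_ne_top,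
              lintegral_const_mul' _ _ ENNReal.ofReal_ne_top, levelEnergy]
            congr 2
            refine setLIntegral_congr ?_
            exact (ae_eq_of_subset_of_measure_ge ball_subset_closedBall
              ((Measure.addHaar_closedBall _ _ (hr0 m).le).trans
                (Measure.addHaar_ball_of_pos _ _ (hr0 m)).symm).le
              measurableSet_ball.nullMeasurableSet measure_closedBall_lt_top.ne).symm
        _ ≤ _ := by
            refine add_le_add ((mul_le_mul_right (hW m) _).trans (le_of_eq ?_)) le_rfl
            rw [← ENNReal.ofReal_mul (by positivity), ← ENNReal.ofReal_mul (by positivity)]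
            congr 1; ring
    have hv0 : volume (closedBall x (r m)) ≠ 0 := (measure_closedBall_pos _ _ (hr0 m)).ne'
    have hvt : volume (closedBall x (r m)) ≠ ⊤ := measure_closedBall_lt_top.ne
    have h2 := ENNReal.div_le_div_right h1 (volume (closedBall x (r m)))
    rw [ENNReal.div_self hv0 hvt, ENNReal.add_div] at h2
    refine h2.trans (add_le_add (le_of_eq ?_) (le_of_eq ?_))
    · have := hr0 m
      rw [hvol m, mul_comm _ V, ENNReal.mul_div_mul_right _ _
        (ENNReal.ofReal_pos.2 (by positivity)).ne' ENNReal.ofReal_ne_top]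
    · rw [mul_div_assoc]
  have hlim : Filter.Tendsto (fun m => ENNReal.ofReal (4 / d ^ 2 * b m ^ 2) / V +
      ENNReal.ofReal (2 / d) *
      ((∫⁻ y in closedBall x (r m), ‖v y - c‖ₑ) / volume (closedBall x (r m)))) Filter.atTop
      (nhds (ENNReal.ofReal (4 / d ^ 2 * 0 ^ 2) / V + ENNReal.ofReal (2 / d) * 0)) := by
    refine Filter.Tendsto.add (ENNReal.Tendsto.div_const (ENNReal.tendsto_ofReal
      ((hb.pow 2).const_mul _)) (Or.inr hV0)) (ENNReal.Tendsto.const_mul (hx.comp hrl)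
      (Or.inr ENNReal.ofReal_ne_top))
  have := ge_of_tendsto' hlim hpt
  simp at this

end DeGiorgi

section Potential

variable {n : ℕ}

theorem rpow_mul_min_rpow_le (hn : 2 < n) {r ρ : ℝ} (hr : 0 < r) (hρ : 0 < ρ) :
    r ^ (1 - n / 2 : ℝ) * min r ρ ^ (n / 2 : ℝ) ≤
      15 * ρ * (√(r / ρ) / (1 + √(r / ρ)) - √(r / 2 / ρ) / (1 + √(r / 2 / ρ))) := by
  have hn3 : (3 : ℝ) ≤ n := by exact_mod_cast hn
  set s := √(r / ρ) with hs
  have hs0 : 0 < s := Real.sqrt_pos.2 (by positivity)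
  have hsq : s ^ 2 = r / ρ := Real.sq_sqrt (by positivity)
  have h2 : √(r / 2 / ρ) = s / √2 := by
    rw [hs, ← Real.sqrt_div (by positivity)]; congr 1; ring
  have hq : (7 / 5 : ℝ) ≤ √2 := Real.le_sqrt_of_sq_le (by norm_num)
  have hq2 : √2 ≤ (3 / 2 : ℝ) := Real.sqrt_le_iff.2 ⟨by norm_num, by norm_num⟩
  have e1 : s / (1 + s) - √(r / 2 / ρ) / (1 + √(r / 2 / ρ)) =
      s * (√2 - 1) / ((1 + s) * (√2 + s)) := by
    rw [h2]; field_simp; ring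
  rw [e1]
  have h3 : s * (2 / 5) / ((1 + s) * (3 / 2 + s)) ≤ s * (√2 - 1) / ((1 + s) * (√2 + s)) := by
    refine div_le_div₀ (mul_nonneg hs0.le (by linarith)) ?_ (by positivity) ?_ <;> gcongr
    linarith
  refine le_trans ?_ (mul_le_mul_of_nonneg_left h3 (by positivity))
  have hrs : r = ρ * s ^ 2 := by rw [hsq]; field_simp
  rcases le_total r ρ with h | h
  · have hs1 : s ≤ 1 := Real.sqrt_le_one.2 ((div_le_one hρ).2 h)
    rw [min_eq_left h, ← Real.rpow_add hr]
    have : (1 - n / 2 + n / 2 : ℝ) = 1 := by ring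
    rw [this, Real.rpow_one, hrs, mul_comm (15 : ℝ), mul_assoc ρ]
    refine mul_le_mul_of_nonneg_left ?_ hρ.le
    rw [mul_div_assoc', le_div_iff₀ (by positivity)]
    have h5 : s ^ 2 ≤ s := by nlinarith
    have h6 : s ^ 3 ≤ s := by nlinarith
    have h7 : s ^ 4 ≤ s := by nlinarith
    nlinarith
  · have hs1 : 1 ≤ s := Real.one_le_sqrt.2 ((one_le_div hρ).2 h)
    rw [min_eq_right h]
    have h4 : r ^ (1 - n / 2 : ℝ) * ρ ^ (n / 2 : ℝ) ≤ ρ * s⁻¹ := by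
      have e2 : r ^ (1 - n / 2 : ℝ) * ρ ^ (n / 2 : ℝ) = ρ * s ^ (2 - n : ℝ) := by
        rw [hrs, Real.mul_rpow hρ.le (by positivity), ← Real.rpow_natCast s 2,
          ← Real.rpow_mul hs0.le, mul_right_comm, ← Real.rpow_add hρ]
        have e3 : (1 - n / 2 + n / 2 : ℝ) = 1 := by ring
        have e4 : ((2 : ℕ) : ℝ) * (1 - n / 2) = 2 - n := by push_cast; ring
        rw [e3, e4, Real.rpow_one]
      rw [e2, ← Real.rpow_neg_one s]
      gcongr
      linarith
    refine h4.trans ?_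
    rw [mul_comm (15 : ℝ), mul_assoc ρ]
    refine mul_le_mul_of_nonneg_left ?_ hρ.le
    rw [mul_div_assoc', le_div_iff₀ (by positivity), inv_mul_le_iff₀ hs0]
    nlinarith

theorem sum_rpow_mul_min_rpow_le (hn : 2 < n) {R ρ : ℝ} (hR : 0 < R) (hρ : 0 < ρ) (m : ℕ) :
    ∑ i ∈ Finset.range m, (R / 2 ^ i) ^ (1 - n / 2 : ℝ) * min (R / 2 ^ i) ρ ^ (n / 2 : ℝ) ≤
      15 * ρ := by
  set ψ : ℕ → ℝ := fun i => √(R / 2 ^ i / ρ) / (1 + √(R / 2 ^ i / ρ)) with hψ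
  have hψ0 : 0 ≤ ψ m := by positivity
  have hψ1 : ψ 0 ≤ 1 := (div_le_one (by positivity)).2 (by linarith)
  calc _ ≤ ∑ i ∈ Finset.range m, 15 * ρ * (ψ i - ψ (i + 1)) := by
        refine Finset.sum_le_sum fun i _ => ?_
        have h1 := rpow_mul_min_rpow_le hn (r := R / 2 ^ i) (by positivity) hρ
        have e1 : R / 2 ^ i / 2 = R / 2 ^ (i + 1) := by rw [pow_succ]; field_simp
        rwa [e1] at h1
    _ = 15 * ρ * (ψ 0 - ψ m) := by rw [← Finset.mul_sum, Finset.sum_range_sub']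
    _ ≤ 15 * ρ * 1 := by gcongr; linarith
    _ = _ := mul_one _

theorem exists_sum_volume_rpow_le (hn : 2 < n) : ∃ C : ℝ, 0 < C ∧
    ∀ (A : Set (Eucl n)) (x : Eucl n) (R : ℝ), 0 < R → ∀ m,
      ∑ i ∈ Finset.range m, ENNReal.ofReal ((R / 2 ^ i) ^ (1 - n / 2 : ℝ)) *
        volume (ball x (R / 2 ^ i) ∩ A) ^ (1 / 2 : ℝ) ≤
      ENNReal.ofReal C * volume A ^ (1 / n : ℝ) := by
  have hn0 : (0 : ℝ) < n := by positivity
  set ω := (volume (ball (0 : Eucl n) 1)).toReal with hω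
  have hω0 : 0 < ω :=
    ENNReal.toReal_pos (measure_ball_pos _ _ one_pos).ne' measure_ball_lt_top.ne
  have hvol : ∀ (x : Eucl n) (r : ℝ), 0 < r → volume (ball x r) = ENNReal.ofReal (ω * r ^ n) := by
    intro x r hr
    rw [Measure.addHaar_ball_of_pos _ _ hr, finrank_euclideanSpace, Fintype.card_fin,
      ENNReal.ofReal_mul hω0.le, hω, ENNReal.ofReal_toReal measure_ball_lt_top.ne, mul_comm]
  refine ⟨15 * ω ^ (1 / 2 : ℝ) * (ω ^ (1 / n : ℝ))⁻¹, by positivity, fun A x R hR m => ?_⟩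
  rcases eq_or_ne (volume A) 0 with h0 | h0
  · refine (Finset.sum_eq_zero fun i _ => ?_).le.trans zero_le
    rw [measure_mono_null inter_subset_right h0, ENNReal.zero_rpow_of_pos (by norm_num), mul_zero]
  rcases eq_or_ne (volume A) ⊤ with ht | ht
  · rw [ht, ENNReal.top_rpow_of_pos (by positivity), ENNReal.mul_top]
    · exact le_top
    · exact (ENNReal.ofReal_pos.2 (by positivity)).ne'
  set a := (volume A).toReal with ha
  have ha0 : 0 < a := ENNReal.toReal_pos h0 ht
  set ρ := (a / ω) ^ (1 / n : ℝ) with hρ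
  have hρ0 : 0 < ρ := by positivity
  have hρn : ω * ρ ^ n = a := by
    rw [hρ, ← Real.rpow_natCast, ← Real.rpow_mul (by positivity), one_div_mul_cancel hn0.ne',
      Real.rpow_one]
    field_simp
  have hA : volume A = ENNReal.ofReal a := (ENNReal.ofReal_toReal ht).symm
  calc _ ≤ ∑ i ∈ Finset.range m, ENNReal.ofReal (ω ^ (1 / 2 : ℝ) *
        ((R / 2 ^ i) ^ (1 - n / 2 : ℝ) * min (R / 2 ^ i) ρ ^ (n / 2 : ℝ))) := by
        refine Finset.sum_le_sum fun i _ => ?_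
        have hr : 0 < R / 2 ^ i := by positivity
        set r := R / 2 ^ i
        have hmin : 0 < min r ρ := lt_min hr hρ0
        have h1 : volume (ball x r ∩ A) ≤ ENNReal.ofReal (ω * min r ρ ^ n) := by
          rcases min_choice r ρ with h | h
          · rw [h, ← hvol x r hr]; exact measure_mono inter_subset_left
          · rw [h, hρn, ← hA]; exact measure_mono inter_subset_right
        calc _ ≤ ENNReal.ofReal (r ^ (1 - n / 2 : ℝ)) *
              ENNReal.ofReal (ω * min r ρ ^ n) ^ (1 / 2 : ℝ) := by gcongr
          _ = _ := by
              rw [ENNReal.ofReal_rpow_of_nonneg (by positivity) (by norm_num),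
                ← ENNReal.ofReal_mul (by positivity), Real.mul_rpow hω0.le (by positivity),
                ← Real.rpow_natCast, ← Real.rpow_mul hmin.le]
              have : (n : ℝ) * (1 / 2) = n / 2 := by ring
              rw [this]
              congr 1; ring
    _ = ENNReal.ofReal (ω ^ (1 / 2 : ℝ) * ∑ i ∈ Finset.range m,
        ((R / 2 ^ i) ^ (1 - n / 2 : ℝ) * min (R / 2 ^ i) ρ ^ (n / 2 : ℝ))) := by
        rw [Finset.mul_sum, ENNReal.ofReal_sum_of_nonneg]
        intro i _
        have : 0 < min (R / 2 ^ i) ρ := lt_min (by positivity) hρ0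
        positivity
    _ ≤ ENNReal.ofReal (ω ^ (1 / 2 : ℝ) * (15 * ρ)) := by
        gcongr
        exact sum_rpow_mul_min_rpow_le hn hR hρ0 m
    _ = _ := by
        rw [hA, ENNReal.ofReal_rpow_of_pos ha0, ← ENNReal.ofReal_mul (by positivity), hρ,
          Real.div_rpow ha0.le hω0.le]
        congr 1; field_simp

theorem setLIntegral_enorm_eq {f : Eucl n → ℝ} (hf : Measurable f) {A : Set (Eucl n)} :
    ∫⁻ y in A, ‖f y‖ₑ = ∫⁻ t in Ioi (0 : ℝ), volume (A ∩ {y | t < ‖f y‖}) := by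
  have h := lintegral_eq_lintegral_meas_lt (volume.restrict A) (f := fun y => ‖f y‖)
    (Filter.Eventually.of_forall fun y => norm_nonneg _) hf.norm.aemeasurable
  simp only [ofReal_norm] at h
  rw [h]
  refine lintegral_congr fun t => ?_
  rw [Measure.restrict_apply (measurableSet_lt measurable_const hf.norm), inter_comm]

/-- The `L(2,1)`-functional over `A`. -/
def halfLorentz (A : Set (Eucl n)) (f : Eucl n → ℝ) : ℝ≥0∞ :=
  ∫⁻ t in Ioi (0 : ℝ), volume (A ∩ {y | t < ‖f y‖}) ^ (1 / 2 : ℝ)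

theorem measurable_volume_superlevel (A : Set (Eucl n)) (f : Eucl n → ℝ) :
    Measurable fun t : ℝ => volume (A ∩ {y | t < ‖f y‖}) :=
  Antitone.measurable fun _ _ h => measure_mono (inter_subset_inter_right _ fun _ hy =>
    lt_of_le_of_lt h hy)

theorem setLIntegral_sq_enorm_le {f : Eucl n → ℝ} (hf : Measurable f) {A : Set (Eucl n)} :
    ∫⁻ y in A, ‖f y‖ₑ ^ 2 ≤ 2 * halfLorentz A f ^ 2 := by
  set m : ℝ → ℝ≥0∞ := fun t => volume (A ∩ {y | t < ‖f y‖}) with hm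
  have hanti : Antitone m := fun _ _ h => measure_mono (inter_subset_inter_right _ fun _ hy =>
    lt_of_le_of_lt h hy)
  have hmm : Measurable m := hanti.measurable
  have h := lintegral_rpow_eq_lintegral_meas_lt_mul (volume.restrict A) (f := fun y => ‖f y‖)
    (Filter.Eventually.of_forall fun y => norm_nonneg _) hf.norm.aemeasurable two_pos
  have e1 : ∀ y, ENNReal.ofReal (‖f y‖ ^ (2 : ℝ)) = ‖f y‖ₑ ^ 2 := fun y => by
    rw [Real.rpow_two, ENNReal.ofReal_pow (norm_nonneg _), ofReal_norm]
  simp only [e1] at h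
  rw [h, ENNReal.ofReal_ofNat]
  refine mul_le_mul_right ?_ _
  rw [sq, halfLorentz, ← lintegral_mul_const _ (hmm.pow_const _)]
  refine setLIntegral_mono' measurableSet_Ioi fun t (ht : 0 < t) => ?_
  rw [Measure.restrict_apply (measurableSet_lt measurable_const hf.norm), inter_comm]
  have h1 : ENNReal.ofReal t * m t ^ (1 / 2 : ℝ) ≤ ∫⁻ s in Ioi (0 : ℝ), m s ^ (1 / 2 : ℝ) := by
    calc ENNReal.ofReal t * m t ^ (1 / 2 : ℝ) = ∫⁻ _ in Ioc 0 t, m t ^ (1 / 2 : ℝ) := by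
          rw [setLIntegral_const, Real.volume_Ioc, sub_zero, mul_comm]
      _ ≤ ∫⁻ s in Ioc 0 t, m s ^ (1 / 2 : ℝ) := by
          refine setLIntegral_mono' measurableSet_Ioc fun s hs => ?_
          exact ENNReal.rpow_le_rpow (hanti hs.2) (by norm_num)
      _ ≤ _ := lintegral_mono_set fun s hs => hs.1
  refine le_trans (le_of_eq ?_) (mul_le_mul_right h1 _)
  change m t * _ = m t ^ (1 / 2 : ℝ) * _
  have e2 : m t = m t ^ (1 / 2 : ℝ) * m t ^ (1 / 2 : ℝ) := by
    rw [← ENNReal.rpow_add_of_nonneg _ _ (by norm_num) (by norm_num)]; norm_num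
  have e3 : t ^ ((2 : ℝ) - 1) = t := by norm_num
  rw [e3]
  nth_rewrite 1 [e2]
  ring

theorem lorentzNorm_eq (A : Set (Eucl n)) (f : Eucl n → ℝ) :
    lorentzNorm A f = ∫⁻ t in Ioi (0 : ℝ), volume (A ∩ {y | t < ‖f y‖}) ^ (1 / n : ℝ) := rfl

theorem rpow_le_rpow_mul_rpow_sub {a V : ℝ≥0∞} {s t : ℝ} (h : a ≤ V) (hs : 0 ≤ s) (hst : s ≤ t) :
    a ^ t ≤ a ^ s * V ^ (t - s) := by
  have e : t = s + (t - s) := by ring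
  nth_rewrite 1 [e]
  rw [ENNReal.rpow_add_of_nonneg _ _ hs (by linarith)]
  gcongr

theorem setLIntegral_enorm_le_lorentzNorm (hn : 2 < n) {f : Eucl n → ℝ} (hf : Measurable f)
    {A B : Set (Eucl n)} (hAB : A ⊆ B) :
    ∫⁻ y in A, ‖f y‖ₑ ≤
      volume B ^ (1 / 3 - 1 / n : ℝ) * lorentzNorm B f * volume A ^ (2 / 3 : ℝ) := by
  have hn3 : (3 : ℝ) ≤ n := by exact_mod_cast hn
  have hni : 1 / (n : ℝ) ≤ 1 / 3 := one_div_le_one_div_of_le (by norm_num) hn3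
  have hni0 : 0 ≤ 1 / (n : ℝ) := by positivity
  rw [setLIntegral_enorm_eq hf, lorentzNorm_eq, ← lintegral_const_mul _
    ((measurable_volume_superlevel B f).pow_const _), ← lintegral_mul_const _
    (((measurable_volume_superlevel B f).pow_const _).const_mul _)]
  refine lintegral_mono fun t => ?_
  set a := volume (A ∩ {y | t < ‖f y‖}) with ha
  have h1 : a ≤ volume (B ∩ {y | t < ‖f y‖}) := measure_mono (inter_subset_inter_left _ hAB)
  have h2 : a ≤ volume A := measure_mono inter_subset_left
  have h3 : a ≤ volume B := h2.trans (measure_mono hAB)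
  calc a = a ^ (1 : ℝ) := (ENNReal.rpow_one a).symm
    _ ≤ a ^ (1 / 3 + 1 / n : ℝ) * a ^ (1 - (1 / 3 + 1 / n) : ℝ) := by
        rw [← ENNReal.rpow_add_of_nonneg _ _ (by linarith) (by linarith), add_sub_cancel]
    _ = a ^ (1 / 3 - 1 / n : ℝ) * a ^ (1 / n : ℝ) * a ^ (2 / 3 : ℝ) := by
        rw [← ENNReal.rpow_add_of_nonneg _ _ (by linarith) (by linarith),
          ← ENNReal.rpow_add_of_nonneg _ _ (by linarith) (by linarith),
          ← ENNReal.rpow_add_of_nonneg _ _ (by linarith) (by linarith)]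
        congr 1; ring
    _ ≤ _ := by
        gcongr

theorem halfLorentz_le (hn : 2 < n) {f : Eucl n → ℝ} {A B : Set (Eucl n)} (hAB : A ⊆ B) :
    halfLorentz A f ≤ volume B ^ (1 / 2 - 1 / n : ℝ) * lorentzNorm B f := by
  have hn2 : (2 : ℝ) ≤ n := by exact_mod_cast hn.le
  have hni : 1 / (n : ℝ) ≤ 1 / 2 := one_div_le_one_div_of_le (by norm_num) hn2
  rw [halfLorentz, lorentzNorm_eq, ← lintegral_const_mul _
    ((measurable_volume_superlevel B f).pow_const _)]
  refine lintegral_mono fun t => ?_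
  have h1 : volume (A ∩ {y | t < ‖f y‖}) ≤ volume (B ∩ {y | t < ‖f y‖}) :=
    measure_mono (inter_subset_inter_left _ hAB)
  refine (ENNReal.rpow_le_rpow h1 (by norm_num)).trans ?_
  rw [mul_comm]
  exact rpow_le_rpow_mul_rpow_sub (measure_mono inter_subset_left) (by positivity) hni

/-- The Riesz-type potential of an `L(n,1)` function is bounded by its Lorentz norm. -/
theorem exists_potential_bound (hn : 2 < n) : ∃ C : ℝ, 0 < C ∧
    ∀ (f : Eucl n → ℝ), Measurable f → ∀ B : Set (Eucl n), volume B ≠ ⊤ → lorentzNorm B f ≠ ⊤ →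
    ∀ (x : Eucl n) (R : ℝ), 0 < R → ball x R ⊆ B → ∃ g : ℕ → ℝ, (∀ i, 0 ≤ g i) ∧
      (∀ i, ∫⁻ y in ball x (R / 2 ^ i), ‖f y‖ₑ ^ 2 ≤
        ENNReal.ofReal ((R / 2 ^ i) ^ n / (R / 2 ^ i) ^ 2 * g i ^ 2)) ∧
      ∀ m, ∑ i ∈ Finset.range m, g i ≤ C * (lorentzNorm B f).toReal := by
  obtain ⟨C, hC, H⟩ := exists_sum_volume_rpow_le hn
  have hn2 : (2 : ℝ) ≤ n := by exact_mod_cast hn.le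
  have hni : 1 / (n : ℝ) ≤ 1 / 2 := one_div_le_one_div_of_le (by norm_num) hn2
  refine ⟨√2 * C, by positivity, fun f hf B hB hΛ x R hR hsub => ?_⟩
  set r : ℕ → ℝ := fun i => R / 2 ^ i with hr
  have hr0 : ∀ i, 0 < r i := fun i => by positivity
  have hrR : ∀ i, ball x (r i) ⊆ B := fun i =>
    (ball_subset_ball (div_le_self hR.le (one_le_pow₀ one_le_two))).trans hsub
  set J : ℕ → ℝ≥0∞ := fun i => halfLorentz (ball x (r i)) f with hJ
  have hJt : ∀ i, J i ≠ ⊤ := fun i => ne_top_of_le_ne_top (ENNReal.mul_ne_top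
    (ENNReal.rpow_ne_top_of_nonneg (by linarith) hB) hΛ) (halfLorentz_le hn (hrR i))
  have hsum : ∀ m, ∑ i ∈ Finset.range m, ENNReal.ofReal (r i ^ (1 - n / 2 : ℝ)) * J i ≤
      ENNReal.ofReal C * lorentzNorm B f := by
    intro m
    simp only [hJ, halfLorentz]
    simp_rw [← lintegral_const_mul' _ _ ENNReal.ofReal_ne_top]
    rw [← lintegral_finsetSum _ fun i _ =>
      ((measurable_volume_superlevel _ f).pow_const _).const_mul _, lorentzNorm_eq,
      ← lintegral_const_mul' _ _ ENNReal.ofReal_ne_top]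
    refine lintegral_mono fun t => ?_
    refine le_trans (Finset.sum_le_sum fun i _ => ?_) (H (B ∩ {y | t < ‖f y‖}) x R hR m)
    refine mul_le_mul_right (ENNReal.rpow_le_rpow (measure_mono ?_) (by norm_num)) _
    exact fun y hy => ⟨hy.1, hrR i hy.1, hy.2⟩
  refine ⟨fun i => √2 * (r i ^ (1 - n / 2 : ℝ) * (J i).toReal), fun i => ?_, fun i => ?_,
    fun m => ?_⟩
  · have := hr0 i
    positivity
  · have hri := hr0 i
    refine (setLIntegral_sq_enorm_le hf).trans (le_of_eq ?_)
    change 2 * J i ^ 2 = _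
    have e1 : (r i ^ (1 - n / 2 : ℝ)) ^ 2 = r i ^ 2 / r i ^ n := by
      rw [← Real.rpow_natCast, ← Real.rpow_mul hri.le, ← Real.rpow_natCast (r i) 2,
        ← Real.rpow_natCast (r i) n, ← Real.rpow_sub hri]
      congr 1; push_cast; ring
    rw [mul_pow, mul_pow, Real.sq_sqrt zero_le_two]
    change _ = ENNReal.ofReal (r i ^ n / r i ^ 2 * (2 * ((r i ^ (1 - n / 2 : ℝ)) ^ 2 * _)))
    rw [e1]
    have e2 : r i ^ n / r i ^ 2 * (2 * (r i ^ 2 / r i ^ n * (J i).toReal ^ 2)) =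
      2 * (J i).toReal ^ 2 := by field_simp
    rw [e2, ENNReal.ofReal_mul zero_le_two, ENNReal.ofReal_pow ENNReal.toReal_nonneg,
      ENNReal.ofReal_toReal (hJt i), ENNReal.ofReal_ofNat]
  · rw [← Finset.mul_sum, mul_assoc]
    refine mul_le_mul_of_nonneg_left ?_ (by positivity)
    have h1 := ENNReal.toReal_mono (ENNReal.mul_ne_top ENNReal.ofReal_ne_top hΛ) (hsum m)
    rw [ENNReal.toReal_sum fun i _ => ENNReal.mul_ne_top ENNReal.ofReal_ne_top (hJt i),
      ENNReal.toReal_mul, ENNReal.toReal_ofReal hC.le] at h1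
    refine le_trans (Finset.sum_le_sum fun i _ => ?_) h1
    have := hr0 i
    rw [ENNReal.toReal_mul, ENNReal.toReal_ofReal (by positivity)]

end Potential

theorem _root_.ConvexOn.add_fderiv_le {n : ℕ} {F : Eucl n → ℝ} (hc : ConvexOn ℝ univ F)
    {z : Eucl n} (hd : DifferentiableAt ℝ F z) (y : Eucl n) :
    F z + fderiv ℝ F z (y - z) ≤ F y := by
  have hg : ConvexOn ℝ univ (F ∘ AffineMap.lineMap (k := ℝ) z y) := by
    simpa using hc.comp_affineMap (AffineMap.lineMap (k := ℝ) z y)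
  have hl : HasDerivAt (AffineMap.lineMap (k := ℝ) z y) (y - z) 0 :=
    AffineMap.hasDerivAt_lineMap
  have hd' : HasFDerivAt F (fderiv ℝ F z) (AffineMap.lineMap (k := ℝ) z y 0) := by
    rw [AffineMap.lineMap_apply_zero]; exact hd.hasFDerivAt
  have := hg.le_slope_of_hasDerivAt (mem_univ 0) (mem_univ 1) one_pos (hd'.comp_hasDerivAt 0 hl)
  simp only [slope_def_field, Function.comp_apply, AffineMap.lineMap_apply_one,
    AffineMap.lineMap_apply_zero, sub_zero, div_one] at this
  linarith

theorem exists_inner_eq_zero_norm_eq {n : ℕ} (hn : 1 < n) (z : Eucl n) :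
    ∃ w : Eucl n, inner ℝ z w = 0 ∧ ‖w‖ = ‖z‖ := by
  have hne : (Submodule.span ℝ {z})ᗮ ≠ ⊥ := by
    intro h
    rw [Submodule.orthogonal_eq_bot_iff] at h
    have h1 := finrank_span_le_card (R := ℝ) ({z} : Set (Eucl n))
    rw [h, finrank_top, finrank_euclideanSpace_fin] at h1
    simp at h1
    omega
  obtain ⟨w, hw, hw0⟩ := Submodule.exists_mem_ne_zero_of_ne_bot hne
  refine ⟨(‖z‖ / ‖w‖) • w, ?_, ?_⟩
  · rw [inner_smul_right, Submodule.mem_orthogonal_singleton_iff_inner_right.1 hw, mul_zero]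
  · rw [norm_smul, norm_div, norm_norm, norm_norm, div_mul_cancel₀ _ (norm_ne_zero_iff.2 hw0)]

theorem norm_fderiv_sub_le_of_inner_eq_zero {n : ℕ} {F : Eucl n → ℝ}
    (hF : ContDiffOn ℝ 2 F {0}ᶜ) {z w : Eucl n} {ε : ℝ} (hz : z ≠ 0) (hzw : inner ℝ z w = 0)
    (hw : ‖w‖ = ‖z‖)
    (h : ∀ y : Eucl n, y ≠ 0 → ‖y‖ ≤ ‖z‖ → ‖y‖ * ‖fderiv ℝ (fderiv ℝ F) y‖ ≤ ε) :
    ‖fderiv ℝ F w - fderiv ℝ F z‖ ≤ 4 * ε := by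
  have hz0 : 0 < ‖z‖ := norm_pos_iff.2 hz
  have hseg : ∀ y ∈ segment ℝ z w, ‖z‖ / 2 ≤ ‖y‖ ∧ ‖y‖ ≤ ‖z‖ := by
    rintro y ⟨a, b, ha, hb, hab, rfl⟩
    have e : ‖a • z + b • w‖ ^ 2 = (a ^ 2 + b ^ 2) * ‖z‖ ^ 2 := by
      rw [norm_add_sq_real, inner_smul_left, inner_smul_right, hzw, norm_smul, norm_smul, hw]
      simp [mul_pow]; ring
    constructor
    · refine le_of_sq_le_sq ?_ (norm_nonneg _)
      rw [e]
      have : (1:ℝ) / 4 ≤ a ^ 2 + b ^ 2 := by nlinarith [sq_nonneg (a - b)]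
      nlinarith [sq_nonneg ‖z‖]
    · refine le_of_sq_le_sq ?_ (norm_nonneg _)
      rw [e]
      have : a ^ 2 + b ^ 2 ≤ 1 := by nlinarith
      nlinarith [sq_nonneg ‖z‖]
  have h0 : ∀ y ∈ segment ℝ z w, y ≠ 0 := fun y hy => by
    have := (hseg y hy).1
    exact norm_pos_iff.1 (by linarith)
  have hd : ∀ y ∈ segment ℝ z w, DifferentiableAt ℝ (fderiv ℝ F) y := fun y hy =>
    ((hF.contDiffAt (isOpen_compl_singleton.mem_nhds (h0 y hy))).fderiv_right (m := 1)
      (by norm_num)).differentiableAt (by norm_num)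
  have := (convex_segment z w).norm_image_sub_le_of_norm_fderiv_le (𝕜 := ℝ) (C := 2 * ε / ‖z‖) hd
    (fun y hy => by
      rw [le_div_iff₀ hz0]
      have h1 := h y (h0 y hy) (hseg y hy).2
      have := mul_le_mul_of_nonneg_right (hseg y hy).1 (norm_nonneg (fderiv ℝ (fderiv ℝ F) y))
      linarith) (left_mem_segment ℝ z w) (right_mem_segment ℝ z w)
  have h2 : ‖w - z‖ ≤ 2 * ‖z‖ := by
    have := norm_sub_le w z
    linarith
  have hε : 0 ≤ ε := (by positivity : (0:ℝ) ≤ _).trans (h z hz le_rfl)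
  calc _ ≤ _ := this
    _ ≤ 2 * ε / ‖z‖ * (2 * ‖z‖) := by gcongr
    _ = 4 * ε := by field_simp; ring

/-- A convex function which is `C²` away from the origin and satisfies `|y| |D²F(y)| → 0` as
`y → 0` is differentiable at the origin. -/
theorem _root_.ConvexOn.differentiableAt_zero {n : ℕ} (hn : 1 < n) {F : Eucl n → ℝ}
    (hc : ConvexOn ℝ univ F) (hF : ContDiffOn ℝ 2 F {0}ᶜ)
    (h : ∀ ε > 0, ∃ ρ > 0, ∀ y : Eucl n, y ≠ 0 → ‖y‖ ≤ ρ →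
      ‖y‖ * ‖fderiv ℝ (fderiv ℝ F) y‖ ≤ ε) :
    DifferentiableAt ℝ F 0 := by
  have hd : ∀ z : Eucl n, z ≠ 0 → DifferentiableAt ℝ F z := fun z hz =>
    (hF.contDiffAt (isOpen_compl_singleton.mem_nhds hz)).differentiableAt (by norm_num)
  have hcont : Continuous F := hc.locallyLipschitz.continuous
  obtain ⟨l, hl⟩ : ∃ l : Eucl n →L[ℝ] ℝ, ∀ y, F 0 + l y ≤ F y := by
    have : Nontrivial (Eucl n) := by
      have : Nonempty (Fin n) := ⟨⟨0, by omega⟩⟩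
      infer_instance
    obtain ⟨C, t, ht, hC⟩ := hc.locallyLipschitz 0
    have hb : ∀ᶠ z in nhdsWithin (0 : Eucl n) {0}ᶜ, fderiv ℝ F z ∈ closedBall 0 (C : ℝ) := by
      refine nhdsWithin_le_nhds ?_
      filter_upwards [eventually_mem_nhds_iff.2 ht] with z hz
      rw [mem_closedBall_zero_iff]
      exact norm_fderiv_le_of_lipschitzOn ℝ hz hC
    set U := Ultrafilter.of (nhdsWithin (0 : Eucl n) {0}ᶜ)
    have hU : (U : Filter (Eucl n)) ≤ nhdsWithin (0 : Eucl n) {0}ᶜ := Ultrafilter.of_le _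
    obtain ⟨l, -, hl⟩ := (isCompact_closedBall (0 : Eucl n →L[ℝ] ℝ) (C : ℝ)).ultrafilter_le_nhds
      (U.map (fderiv ℝ F)) (by
        rw [Filter.le_principal_iff]
        exact hU hb)
    have hl' : Filter.Tendsto (fderiv ℝ F) U (nhds l) := hl
    have hid : Filter.Tendsto id (U : Filter (Eucl n)) (nhds 0) := hU.trans nhdsWithin_le_nhds
    refine ⟨l, fun y => ?_⟩
    have h1 : Filter.Tendsto (fun z => F z + fderiv ℝ F z (y - z)) U (nhds (F 0 + l (y - 0))) :=
      ((hcont.tendsto 0).comp hid).add ((isBoundedBilinearMap_apply.continuous.tendsto (l, y - 0)).comp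
        (hl'.prodMk_nhds (tendsto_const_nhds.sub hid)))
    rw [sub_zero] at h1
    refine le_of_tendsto h1 ?_
    filter_upwards [hU self_mem_nhdsWithin] with z hz
    exact hc.add_fderiv_le (hd z hz) y
  have hkey : ∀ ε > 0, ∃ ρ > 0, ∀ z : Eucl n, z ≠ 0 → ‖z‖ ≤ ρ → F z - F 0 - l z ≤ ε * ‖z‖ := by
    intro ε hε
    obtain ⟨ρ, hρ, hy⟩ := h (ε / 8) (by positivity)
    refine ⟨ρ, hρ, fun z hz hzρ => ?_⟩
    obtain ⟨w, hzw, hw⟩ := exists_inner_eq_zero_norm_eq hn z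
    have h1 := norm_fderiv_sub_le_of_inner_eq_zero hF hz hzw hw
      fun y hy0 hyz => hy y hy0 (hyz.trans hzρ)
    have h2 := norm_fderiv_sub_le_of_inner_eq_zero hF (neg_ne_zero.2 hz)
      (by rw [inner_neg_left, hzw, neg_zero]) (by rw [norm_neg, hw])
      fun y hy0 hyz => hy y hy0 ((norm_neg z ▸ hyz).trans hzρ)
    have h3 : ‖fderiv ℝ F z - fderiv ℝ F (-z)‖ ≤ ε := by
      have := norm_sub_le (fderiv ℝ F w - fderiv ℝ F (-z)) (fderiv ℝ F w - fderiv ℝ F z)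
      rw [sub_sub_sub_cancel_left] at this
      linarith
    have h4 := (le_abs_self _).trans ((fderiv ℝ F z - fderiv ℝ F (-z)).le_opNorm z)
    have h5 := hc.add_fderiv_le (hd z hz) 0
    have h6 := hc.add_fderiv_le (hd (-z) (neg_ne_zero.2 hz)) 0
    have h7 := hl (-z)
    have h8 := mul_le_mul_of_nonneg_right h3 (norm_nonneg z)
    rw [sub_apply] at h4
    simp only [zero_sub, neg_neg, map_neg] at h5 h6 h7
    linarith
  refine HasFDerivAt.differentiableAt (f' := l) ?_
  rw [hasFDerivAt_iff_isLittleO_nhds_zero, Asymptotics.isLittleO_iff]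
  intro ε hε
  obtain ⟨ρ, hρ, hz⟩ := hkey ε hε
  filter_upwards [closedBall_mem_nhds (0 : Eucl n) hρ] with z hzρ
  rw [mem_closedBall_zero_iff] at hzρ
  rw [zero_add, Real.norm_of_nonneg (by linarith [hl z])]
  rcases eq_or_ne z 0 with rfl | h0
  · simp
  · exact hz z h0 hzρ

theorem exists_fderiv_sub_apply_eq {n : ℕ} {F : Eucl n → ℝ} (hF : ContDiffOn ℝ 2 F {0}ᶜ)
    {a b : Eucl n} (h0 : ∀ t ∈ Icc (0 : ℝ) 1, a + t • (b - a) ≠ 0) (v : Eucl n) :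
    ∃ t ∈ Ioo (0 : ℝ) 1, (fderiv ℝ F b - fderiv ℝ F a) v =
      fderiv ℝ (fderiv ℝ F) (a + t • (b - a)) (b - a) v := by
  have hd : ∀ t ∈ Icc (0 : ℝ) 1, HasDerivAt (fun t : ℝ => fderiv ℝ F (a + t • (b - a)) v)
      (fderiv ℝ (fderiv ℝ F) (a + t • (b - a)) (b - a) v) t := by
    intro t ht
    have h1 : DifferentiableAt ℝ (fderiv ℝ F) (a + t • (b - a)) :=
      ((hF.contDiffAt (isOpen_compl_singleton.mem_nhds (h0 t ht))).fderiv_right (m := 1)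
        (by norm_num)).differentiableAt (by norm_num)
    have h2 : HasDerivAt (fun t : ℝ => a + t • (b - a)) (b - a) t := by
      simpa using ((hasDerivAt_id t).smul_const (b - a)).const_add a
    exact ((ContinuousLinearMap.apply ℝ ℝ v).hasFDerivAt.comp_hasDerivAt t
      (h1.hasFDerivAt.comp_hasDerivAt t h2))
  obtain ⟨t, ht, h⟩ := exists_hasDerivAt_eq_slope _ _ one_pos
    (fun t ht => (hd t ht).continuousAt.continuousWithinAt)
    (fun t ht => hd t (Ioo_subset_Icc_self ht))
  refine ⟨t, ht, ?_⟩
  rw [h]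
  simp

theorem norm_line_le {n : ℕ} {a b : Eucl n} {M : ℝ} (ha : ‖a‖ ≤ M) (hb : ‖b‖ ≤ M) {t : ℝ}
    (ht : t ∈ Icc (0 : ℝ) 1) : ‖a + t • (b - a)‖ ≤ M := by
  have e : a + t • (b - a) = (1 - t) • a + t • b := by module
  rw [e]
  refine (norm_add_le _ _).trans ?_
  rw [norm_smul, norm_smul, Real.norm_of_nonneg (sub_nonneg.2 ht.2), Real.norm_of_nonneg ht.1]
  nlinarith [ht.1, ht.2]

theorem half_le_norm_line {n : ℕ} {a b : Eucl n} {κ : ℝ} (hκ : κ ≤ max ‖a‖ ‖b‖)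
    (hab : ‖b - a‖ ≤ κ / 2) {t : ℝ} (ht : t ∈ Icc (0 : ℝ) 1) : κ / 2 ≤ ‖a + t • (b - a)‖ := by
  rcases le_max_iff.1 hκ with h | h
  · have h1 := norm_sub_le (a + t • (b - a)) (t • (b - a))
    rw [add_sub_cancel_right, norm_smul, Real.norm_of_nonneg ht.1] at h1
    nlinarith [ht.2, norm_nonneg (b - a)]
  · have h1 := norm_add_le (a + t • (b - a)) ((1 - t) • (b - a))
    rw [norm_smul, Real.norm_of_nonneg (sub_nonneg.2 ht.2),
      show a + t • (b - a) + (1 - t) • (b - a) = b by module] at h1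
    nlinarith [ht.1, norm_nonneg (b - a)]

theorem _root_.ConvexOn.fderiv_sub_nonneg {n : ℕ} {F : Eucl n → ℝ} (hc : ConvexOn ℝ univ F)
    (hd : Differentiable ℝ F) (a b : Eucl n) : 0 ≤ (fderiv ℝ F b - fderiv ℝ F a) (b - a) := by
  have h1 := hc.add_fderiv_le (hd a) b
  have h2 := hc.add_fderiv_le (hd b) a
  rw [← neg_sub b a, map_neg] at h2
  rw [sub_apply]
  linarith

theorem ellipticField_fderiv {n : ℕ} {F : Eucl n → ℝ} (hc : ConvexOn ℝ univ F)
    (hd : Differentiable ℝ F) (hF : ContDiffOn ℝ 2 F {0}ᶜ) {M κ lam Lam : ℝ} (hκ : 0 < κ)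
    (hlam : 0 < lam) (hle : lam ≤ Lam)
    (h1 : ∀ z : Eucl n, κ / 2 ≤ ‖z‖ → ‖z‖ ≤ M → ∀ ξ,
      lam * ‖ξ‖ ^ 2 ≤ fderiv ℝ (fderiv ℝ F) z ξ ξ)
    (h2 : ∀ z : Eucl n, κ / 2 ≤ ‖z‖ → ‖z‖ ≤ M → ‖fderiv ℝ (fderiv ℝ F) z‖ ≤ Lam) :
    EllipticField (fderiv ℝ F) M (κ / 2) κ lam Lam := by
  have hmono := hc.fderiv_sub_nonneg hd
  have hne : ∀ {a b : Eucl n}, κ ≤ max ‖a‖ ‖b‖ → ‖b - a‖ ≤ κ / 2 → ∀ t ∈ Icc (0 : ℝ) 1,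
      a + t • (b - a) ≠ 0 := fun hκ' hab t ht =>
    norm_pos_iff.1 ((half_pos hκ).trans_le (half_le_norm_line hκ' hab ht))
  have hcoer : ∀ a b : Eucl n, ‖a‖ ≤ M → ‖b‖ ≤ M → κ ≤ max ‖a‖ ‖b‖ → ‖b - a‖ ≤ κ / 2 →
      lam * ‖b - a‖ ^ 2 ≤ (fderiv ℝ F b - fderiv ℝ F a) (b - a) := by
    intro a b ha hb hκ' hab
    obtain ⟨t, ht, e⟩ := exists_fderiv_sub_apply_eq hF (hne hκ' hab) (b - a)
    have ht := Ioo_subset_Icc_self ht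
    rw [e]
    exact h1 _ (half_le_norm_line hκ' hab ht) (norm_line_le ha hb ht) _
  refine ⟨hlam, hle, measurable_fderiv ℝ F, hmono, ?_, hcoer, ?_, ?_⟩
  · obtain ⟨K, hK⟩ := (hc.locallyLipschitz.locallyLipschitzOn (s := closedBall (0 : Eucl n)
      (M + 1))).exists_lipschitzOnWith_of_compact (isCompact_closedBall _ _)
    refine ⟨K, fun a ha => norm_fderiv_le_of_lipschitzOn ℝ ?_ hK⟩
    refine closedBall_mem_nhds_of_mem ?_
    rw [mem_ball_zero_iff]
    linarith
  · intro a b ha hb hκ' hab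
    obtain ⟨e, he, hle'⟩ := exists_norm_le_one_enorm_apply_eq
      (fderiv ℝ F b - fderiv ℝ F a)
    set l := fderiv ℝ F b - fderiv ℝ F a
    have h3 : ‖l e‖ = ‖l‖ := by
      rw [← toReal_enorm, ← toReal_enorm, hle']
    have h4 : ∀ τ : ℝ, 0 ≤ Lam * (τ * τ) + (-2 * l e) * τ + l (b - a) := by
      intro τ
      obtain ⟨t, ht, h⟩ := exists_fderiv_sub_apply_eq hF (hne hκ' hab) (b - a - (2 * τ) • e)
      have ht := Ioo_subset_Icc_self ht
      set z := a + t • (b - a)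
      have hz1 := half_le_norm_line hκ' hab ht
      have hz2 := norm_line_le ha hb ht
      have hsymm : IsSymmSndFDerivAt ℝ F z :=
        (hF.contDiffAt (isOpen_compl_singleton.mem_nhds (hne hκ' hab t ht))).isSymmSndFDerivAt
          (by simp)
      have h5 := h1 z hz1 hz2 (b - a - τ • e)
      have h6 : fderiv ℝ (fderiv ℝ F) z e e ≤ Lam := by
        refine (Real.le_norm_self _).trans ((ContinuousLinearMap.le_opNorm₂ _ _ _).trans ?_)
        calc _ ≤ ‖fderiv ℝ (fderiv ℝ F) z‖ * 1 * 1 := by gcongr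
          _ ≤ Lam := by simpa using h2 z hz1 hz2
      have h7 := hsymm e (b - a)
      have h8 : 0 ≤ lam * ‖b - a - τ • e‖ ^ 2 := by positivity
      have h9 : l (b - a - (2 * τ) • e) = _ := h
      replace h5 := h8.trans h5
      clear_value z
      generalize b - a = ξ at h5 h6 h7 h9 ⊢
      simp only [map_sub, map_smul, sub_apply, smul_apply, smul_eq_mul] at h5 h9
      rw [h7] at h5
      linarith [mul_le_mul_of_nonneg_left h6 (mul_self_nonneg τ)]
    have h5 := discrim_le_zero h4
    rw [discrim] at h5
    rw [← h3, Real.norm_eq_abs, sq_abs]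
    nlinarith
  · intro θ hθ
    set M' := max M κ
    have hM' : 0 < M' := hκ.trans_le (le_max_right _ _)
    set t := κ / (4 * M')
    have ht0 : 0 < t := by positivity
    have ht1 : t < 1 := by
      rw [div_lt_one (by positivity)]
      linarith [le_max_right M κ]
    have key : ∀ a b : Eucl n, ‖a‖ ≤ M → ‖b‖ ≤ M → κ ≤ ‖b‖ → θ ≤ ‖b - a‖ →
        lam * t * θ ^ 2 ≤ (fderiv ℝ F b - fderiv ℝ F a) (b - a) := by
      intro a b ha hb hb' hθ'
      set b' := a + (1 - t) • (b - a) with hb1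
      have hM : ‖b'‖ ≤ M := norm_line_le ha hb ⟨by linarith, by linarith⟩
      have e1 : b - b' = t • (b - a) := by rw [hb1]; module
      have e2 : b' - a = (1 - t) • (b - a) := by rw [hb1]; module
      have h3 := hcoer b' b hM hb (hb'.trans (le_max_right _ _)) (by
        rw [e1, norm_smul, Real.norm_of_nonneg ht0.le]
        have : ‖b - a‖ ≤ 2 * M' := (norm_sub_le _ _).trans (by linarith [le_max_left M κ])
        calc _ ≤ t * (2 * M') := by gcongr
          _ = κ / 2 := by simp only [t]; field_simp; norm_num)
      have h4 := hmono a b'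
      rw [e1, map_smul, norm_smul, mul_pow, smul_eq_mul, Real.norm_of_nonneg ht0.le] at h3
      have h5 : lam * t * ‖b - a‖ ^ 2 ≤
          (fderiv ℝ F b - fderiv ℝ F b') (b - a) := by
        refine le_of_mul_le_mul_left ?_ ht0
        linarith
      have h6 : 0 ≤ (fderiv ℝ F b' - fderiv ℝ F a) (b - a) := by
        rw [e2, map_smul, smul_eq_mul] at h4
        exact nonneg_of_mul_nonneg_right h4 (by linarith)
      have h7 : lam * t * θ ^ 2 ≤ lam * t * ‖b - a‖ ^ 2 := by gcongr
      simp only [sub_apply] at h5 h6 ⊢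
      linarith
    refine ⟨lam * t * θ ^ 2, by positivity, fun a b ha hb hκ' hθ' => ?_⟩
    rcases le_max_iff.1 hκ' with h | h
    · have := key b a hb ha h (by rwa [norm_sub_rev])
      rw [← neg_sub b a, map_neg, ← neg_sub (fderiv ℝ F b), neg_apply, neg_neg] at this
      exact this
    · exact key a b ha hb h hθ'

/-- The `(p,q)`-growth and ellipticity conditions on the integrand `F`. -/
structure PQGrowth {n : ℕ} (p q ν L μ : ℝ) (F : Eucl n → ℝ) : Prop where
  mem_Icc : μ ∈ Icc (0 : ℝ) 1
  convexOn : ConvexOn ℝ univ F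
  contDiffOn : ContDiffOn ℝ 2 F {0}ᶜ
  le_apply : ∀ z : Eucl n, z ≠ 0 → ν * (‖z‖ ^ 2 + μ ^ 2) ^ (p / 2) ≤ F z
  hessian_le : ∀ z : Eucl n, z ≠ 0 → (‖z‖ ^ 2 + μ ^ 2) * ‖fderiv ℝ (fderiv ℝ F) z‖ ≤
    L * (‖z‖ ^ 2 + μ ^ 2) ^ (q / 2) + L * (‖z‖ ^ 2 + μ ^ 2) ^ (p / 2)
  le_hessian : ∀ z : Eucl n, z ≠ 0 → ∀ ξ : Eucl n,
    ν * (‖z‖ ^ 2 + μ ^ 2) ^ ((p - 2) / 2) * ‖ξ‖ ^ 2 ≤ fderiv ℝ (fderiv ℝ F) z ξ ξ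

theorem rpow_mem_Icc_of_mem_Icc {K σ x B : ℝ} (hK : 1 ≤ K) (hσ : σ ∈ Icc K⁻¹ K) (hx : |x| ≤ B) :
    σ ^ x ∈ Icc (K ^ B)⁻¹ (K ^ B) := by
  have hK0 : 0 < K := by linarith
  have hσ0 : 0 < σ := (inv_pos.2 hK0).trans_le hσ.1
  have key : ∀ y : ℝ, |y| ≤ B → σ ^ y ≤ K ^ B := by
    intro y hy
    rcases le_total 0 y with h | h
    · calc σ ^ y ≤ K ^ y := Real.rpow_le_rpow hσ0.le hσ.2 h
        _ ≤ K ^ B := Real.rpow_le_rpow_of_exponent_le hK ((le_abs_self y).trans hy)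
    · calc σ ^ y ≤ K⁻¹ ^ y := Real.rpow_le_rpow_of_nonpos (inv_pos.2 hK0) hσ.1 h
        _ = K ^ (-y) := by rw [Real.inv_rpow hK0.le, Real.rpow_neg hK0.le]
        _ ≤ K ^ B := Real.rpow_le_rpow_of_exponent_le hK ((neg_le_abs y).trans hy)
  refine ⟨?_, key x hx⟩
  have := key (-x) (by rwa [abs_neg])
  rw [Real.rpow_neg hσ0.le] at this
  exact inv_le_of_inv_le₀ (Real.rpow_pos_of_pos hσ0 x) this

namespace PQGrowth

variable {n : ℕ} {p q ν L μ : ℝ} {F : Eucl n → ℝ}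

theorem norm_hessian_le (hF : PQGrowth p q ν L μ F) {z : Eucl n} (hz : z ≠ 0) :
    ‖fderiv ℝ (fderiv ℝ F) z‖ ≤
      L * (‖z‖ ^ 2 + μ ^ 2) ^ ((q - 2) / 2) + L * (‖z‖ ^ 2 + μ ^ 2) ^ ((p - 2) / 2) := by
  have hs : 0 < ‖z‖ ^ 2 + μ ^ 2 := by have := norm_pos_iff.2 hz; positivity
  refine le_of_mul_le_mul_left ((hF.hessian_le z hz).trans_eq ?_) hs
  have : ∀ x : ℝ, (‖z‖ ^ 2 + μ ^ 2) ^ (x / 2) =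
      (‖z‖ ^ 2 + μ ^ 2) * (‖z‖ ^ 2 + μ ^ 2) ^ ((x - 2) / 2) := fun x => by
    have h := Real.rpow_add hs 1 ((x - 2) / 2)
    rwa [Real.rpow_one, show 1 + (x - 2) / 2 = x / 2 by ring] at h
  rw [this q, this p]; ring

theorem differentiable (hn : 1 < n) (hp : 1 < p) (hpq : p ≤ q) (hL : 0 < L)
    (hF : PQGrowth p q ν L μ F) : Differentiable ℝ F := by
  intro z
  rcases eq_or_ne z 0 with rfl | hz
  swap
  · exact (hF.contDiffOn.contDiffAt (isOpen_compl_singleton.mem_nhds hz)).differentiableAt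
      (by norm_num)
  refine hF.convexOn.differentiableAt_zero hn hF.contDiffOn fun ε hε => ?_
  set η := min 1 (p - 1)
  have hη : 0 < η := lt_min one_pos (by linarith)
  set C := L * 2 ^ ((q - 1 - η) / 2) + L * 2 ^ ((p - 1 - η) / 2) with hC
  have hC0 : 0 < C := by positivity
  refine ⟨min 1 ((ε / C) ^ η⁻¹), by positivity, fun y hy hyρ => ?_⟩
  have hy0 : 0 < ‖y‖ := norm_pos_iff.2 hy
  set s := ‖y‖ ^ 2 + μ ^ 2
  have hys : ‖y‖ ≤ s ^ (1 / 2 : ℝ) := by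
    rw [← Real.sqrt_eq_rpow]
    exact Real.le_sqrt_of_sq_le (by simp only [s]; nlinarith [sq_nonneg μ])
  have hs : 0 < s := by positivity
  have hs2 : s ≤ 2 := by
    have h1 := hyρ.trans (min_le_left _ _)
    have := hF.mem_Icc.1
    have := hF.mem_Icc.2
    simp only [s]; nlinarith
  have key : ∀ x, p ≤ x → ‖y‖ * s ^ ((x - 2) / 2) ≤ ‖y‖ ^ η * 2 ^ ((x - 1 - η) / 2) := by
    intro x hx
    have h1 : ‖y‖ = ‖y‖ ^ η * ‖y‖ ^ (1 - η) := by
      rw [← Real.rpow_add hy0, add_sub_cancel, Real.rpow_one]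
    have h2 : ‖y‖ ^ (1 - η) ≤ s ^ ((1 - η) / 2) := by
      calc _ ≤ (s ^ (1 / 2 : ℝ)) ^ (1 - η) :=
            Real.rpow_le_rpow hy0.le hys (sub_nonneg.2 (min_le_left _ _))
        _ = _ := by rw [← Real.rpow_mul hs.le]; congr 1; ring
    calc ‖y‖ * s ^ ((x - 2) / 2) = ‖y‖ ^ η * (‖y‖ ^ (1 - η) * s ^ ((x - 2) / 2)) := by
          rw [← mul_assoc, ← h1]
      _ ≤ ‖y‖ ^ η * (s ^ ((1 - η) / 2) * s ^ ((x - 2) / 2)) := by gcongr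
      _ = ‖y‖ ^ η * s ^ ((x - 1 - η) / 2) := by
          rw [← Real.rpow_add hs]; congr 2; ring
      _ ≤ _ := by
          gcongr
          have := min_le_right 1 (p - 1)
          linarith
  calc ‖y‖ * ‖fderiv ℝ (fderiv ℝ F) y‖
      ≤ ‖y‖ * (L * s ^ ((q - 2) / 2) + L * s ^ ((p - 2) / 2)) := by
        gcongr; exact hF.norm_hessian_le hy
    _ = L * (‖y‖ * s ^ ((q - 2) / 2)) + L * (‖y‖ * s ^ ((p - 2) / 2)) := by ring
    _ ≤ L * (‖y‖ ^ η * 2 ^ ((q - 1 - η) / 2)) + L * (‖y‖ ^ η * 2 ^ ((p - 1 - η) / 2)) := by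
        exact add_le_add (mul_le_mul_of_nonneg_left (key q hpq) hL.le)
          (mul_le_mul_of_nonneg_left (key p le_rfl) hL.le)
    _ = ‖y‖ ^ η * C := by rw [hC]; ring
    _ ≤ ((ε / C) ^ η⁻¹) ^ η * C := by gcongr; exact hyρ.trans (min_le_right _ _)
    _ = ε := by
        rw [Real.rpow_inv_rpow (by positivity) hη.ne', div_mul_cancel₀ _ hC0.ne']

theorem mul_rpow_le_apply (hn : 1 < n) (hp : 0 < p) (hF : PQGrowth p q ν L μ F) (z : Eucl n) :
    ν * (‖z‖ ^ 2 + μ ^ 2) ^ (p / 2) ≤ F z := by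
  rcases eq_or_ne z 0 with rfl | hz
  swap
  · exact hF.le_apply z hz
  have : Nonempty (Fin n) := ⟨⟨0, by omega⟩⟩
  have hcont : Continuous F := hF.convexOn.locallyLipschitz.continuous
  have hcont' : Continuous fun z : Eucl n => ν * (‖z‖ ^ 2 + μ ^ 2) ^ (p / 2) := by
    refine continuous_const.mul (Continuous.rpow_const (by fun_prop) fun _ => Or.inr ?_)
    positivity
  exact le_of_tendsto_of_tendsto
    ((hcont'.tendsto 0).mono_left (nhdsWithin_le_nhds (s := {0}ᶜ)))
    ((hcont.tendsto 0).mono_left nhdsWithin_le_nhds)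
    (by filter_upwards [self_mem_nhdsWithin] with z hz using hF.le_apply z hz)

theorem mul_norm_rpow_le_apply (hn : 1 < n) (hp : 0 < p) (hν : 0 ≤ ν) (hF : PQGrowth p q ν L μ F)
    (z : Eucl n) : ν * ‖z‖ ^ p ≤ F z := by
  refine le_trans ?_ (hF.mul_rpow_le_apply hn hp z)
  gcongr
  calc ‖z‖ ^ p = (‖z‖ ^ 2) ^ (p / 2) := by
        rw [← Real.rpow_natCast, ← Real.rpow_mul (norm_nonneg _)]; congr 1; push_cast; ring
    _ ≤ _ := by gcongr; linarith [sq_nonneg μ]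

theorem mul_rpow_mu_le_apply (hn : 1 < n) (hp : 0 < p) (hν : 0 ≤ ν) (hF : PQGrowth p q ν L μ F)
    (z : Eucl n) : ν * μ ^ p ≤ F z := by
  refine le_trans ?_ (hF.mul_rpow_le_apply hn hp z)
  gcongr
  calc μ ^ p = (μ ^ 2) ^ (p / 2) := by
        rw [← Real.rpow_natCast, ← Real.rpow_mul hF.mem_Icc.1]; congr 1; push_cast; ring
    _ ≤ _ := by gcongr; linarith [sq_nonneg ‖z‖]

theorem apply_nonneg (hn : 1 < n) (hp : 0 < p) (hν : 0 ≤ ν) (hF : PQGrowth p q ν L μ F)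
    (z : Eucl n) : 0 ≤ F z :=
  le_trans (by positivity) (hF.mul_norm_rpow_le_apply hn hp hν z)

/-- On the annulus `m / 8 ≤ |z| ≤ Λ m`, with `m ≥ μ`, the field `DF` is uniformly elliptic with
ellipticity ratio comparable to `1 + m ^ (q - p)`. -/
theorem exists_ellipticField (hn : 1 < n) (hp : 1 < p) (hpq : p ≤ q) (hν : 0 < ν) (hν1 : ν ≤ 1)
    (hL : 1 ≤ L) (Λ : ℝ) : ∃ c C : ℝ, 0 < c ∧ c ≤ C ∧ ∀ (μ : ℝ) (F : Eucl n → ℝ),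
      PQGrowth p q ν L μ F → ∀ m, 0 < m → μ ≤ m →
        EllipticField (fderiv ℝ F) (Λ * m) (m / 8) (m / 4) (c * m ^ (p - 2))
          (C * (m ^ (q - 2) + m ^ (p - 2))) := by
  set K := max 64 (Λ ^ 2 + 1)
  set D := K ^ (|(p - 2) / 2| + |(q - 2) / 2|)
  have hK : 1 ≤ K := le_trans (by norm_num) (le_max_left _ _)
  have hD : 1 ≤ D := Real.one_le_rpow hK (by positivity)
  have hD0 : 0 < D := by linarith
  refine ⟨ν * D⁻¹, L * D, by positivity, ?_, fun μ F hF m hm hμ => ?_⟩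
  · have : D⁻¹ ≤ D := (inv_le_one_of_one_le₀ hD).trans hD
    gcongr
    linarith
  have hrp : ∀ z : Eucl n, m / 4 / 2 ≤ ‖z‖ → ‖z‖ ≤ Λ * m → ∀ x,
      |(x - 2) / 2| ≤ |(p - 2) / 2| + |(q - 2) / 2| →
      D⁻¹ * m ^ (x - 2) ≤ (‖z‖ ^ 2 + μ ^ 2) ^ ((x - 2) / 2) ∧
      (‖z‖ ^ 2 + μ ^ 2) ^ ((x - 2) / 2) ≤ D * m ^ (x - 2) := by
    intro z hz1 hz2 x hx
    have h1 : (‖z‖ ^ 2 + μ ^ 2) / m ^ 2 ∈ Icc K⁻¹ K := by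
      have hμ0 := hF.mem_Icc.1
      constructor
      · rw [le_div_iff₀ (by positivity)]
        have : K⁻¹ ≤ 1 / 64 := by
          rw [← one_div]; exact one_div_le_one_div_of_le (by norm_num) (le_max_left _ _)
        calc K⁻¹ * m ^ 2 ≤ 1 / 64 * m ^ 2 := by gcongr
          _ = (m / 4 / 2) ^ 2 := by ring
          _ ≤ ‖z‖ ^ 2 := by gcongr
          _ ≤ _ := by linarith [sq_nonneg μ]
      · rw [div_le_iff₀ (by positivity)]
        calc ‖z‖ ^ 2 + μ ^ 2 ≤ (Λ * m) ^ 2 + m ^ 2 := by gcongr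
          _ = (Λ ^ 2 + 1) * m ^ 2 := by ring
          _ ≤ K * m ^ 2 := by gcongr; exact le_max_right _ _
    have h2 := rpow_mem_Icc_of_mem_Icc hK h1 hx
    have h3 : (‖z‖ ^ 2 + μ ^ 2) ^ ((x - 2) / 2) =
        ((‖z‖ ^ 2 + μ ^ 2) / m ^ 2) ^ ((x - 2) / 2) * m ^ (x - 2) := by
      rw [Real.div_rpow (by positivity) (by positivity), ← Real.rpow_natCast m 2,
        ← Real.rpow_mul hm.le]
      rw [show ((2 : ℕ) : ℝ) * ((x - 2) / 2) = x - 2 by push_cast; ring,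
        div_mul_cancel₀ _ (Real.rpow_pos_of_pos hm _).ne']
    rw [h3]
    constructor
    · gcongr; exact h2.1
    · gcongr; exact h2.2
  have hq := le_add_of_nonneg_left (a := |(q - 2) / 2|) (abs_nonneg ((p - 2) / 2))
  have hp' := le_add_of_nonneg_right (a := |(p - 2) / 2|) (abs_nonneg ((q - 2) / 2))
  have hz0 : ∀ z : Eucl n, m / 4 / 2 ≤ ‖z‖ → z ≠ 0 := fun z hz =>
    norm_pos_iff.1 (lt_of_lt_of_le (by positivity) hz)
  rw [show m / 8 = m / 4 / 2 by ring]
  refine ellipticField_fderiv hF.convexOn (hF.differentiable hn hp hpq (by linarith)) hF.contDiffOn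
    (by positivity) (by positivity) ?_ ?_ ?_
  · have : D⁻¹ ≤ D := (inv_le_one_of_one_le₀ hD).trans hD
    calc ν * D⁻¹ * m ^ (p - 2) ≤ L * D * m ^ (p - 2) := by gcongr; linarith
      _ ≤ _ := by
        have : 0 ≤ m ^ (q - 2) := by positivity
        gcongr
        linarith
  · intro z hz1 hz2 ξ
    refine le_trans ?_ (hF.le_hessian z (hz0 z hz1) ξ)
    rw [mul_assoc ν]
    gcongr
    exact (hrp z hz1 hz2 p hp').1
  · intro z hz1 hz2
    refine (hF.norm_hessian_le (hz0 z hz1)).trans ?_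
    rw [← mul_add, mul_assoc, mul_add D]
    gcongr
    · exact (hrp z hz1 hz2 q hq).2
    · exact (hrp z hz1 hz2 p hp').2

end PQGrowth

section

variable {n : ℕ}

theorem LipSolution.mono_radius {S : Eucl n → Eucl n →L[ℝ] ℝ} {u f : Eucl n → ℝ} {x : Eucl n}
    {R M r : ℝ} {K N : ℝ≥0} (sol : LipSolution S u f x R M K N) (hr : r ≤ R) :
    LipSolution S u f x r M K N where
  lip := sol.lip
  grad_le := by
    filter_upwards [sol.grad_le] with y hy h using hy (ball_subset_ball hr h)
  meas_f := sol.meas_f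
  lintegral_le := sol.lintegral_le
  euler φ L hφ ρ hρ h := sol.euler φ L hφ ρ (hρ.trans_le hr) h

/-- Pointwise gradient bound by a nonlinear potential iteration: at a Lebesgue point of `∇u` the
component of `∇u` in direction `e` is controlled by its level energy and the Lorentz norm of `f`. -/
theorem exists_pointwise_bound (hn : 2 < n) : ∃ C : ℝ, 0 < C ∧
    ∀ {S : Eucl n → Eucl n →L[ℝ] ℝ} {u f : Eucl n → ℝ} {x : Eucl n} {R M δ κ lam Lam : ℝ}
      {K N : ℝ≥0}, LipSolution S u f x R M K N → EllipticField S M δ κ lam Lam →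
      0 < δ → 0 ≤ κ → 0 < R →
    ∀ B : Set (Eucl n), volume B ≠ ⊤ → lorentzNorm B f ≠ ⊤ → ball x R ⊆ B →
      Filter.Tendsto (fun r => (∫⁻ y in closedBall x r, ‖gradient u y - gradient u x‖ₑ) /
        volume (closedBall x r)) (nhdsWithin 0 (Ioi 0)) (nhds 0) →
    ∀ e : Eucl n, ‖e‖ ≤ 1 → ∀ k₀ b₀ : ℝ, κ < k₀ → 0 < b₀ →
      levelEnergy (fun y => inner ℝ (gradient u y) e) x R k₀ ≤ ENNReal.ofReal (R ^ n * b₀ ^ 2) →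
      inner ℝ (gradient u x) e ≤ k₀ + C * ((Lam / lam) ^ (n / 4 : ℝ) * b₀ +
        (Lam / lam) ^ (n / 4 - 1 / 2 : ℝ) / lam * (lorentzNorm B f).toReal) := by
  obtain ⟨C, hC, hpot⟩ := exists_potential_bound hn
  set Cs := SNormLESNormFDerivOfEqConst ℝ (volume : Measure (Eucl n)) 2
  set D : ℝ := (Cs + 1) ^ 2 * 352 * 2 ^ (n + 2)
  have hD : 0 < D := by positivity
  refine ⟨D ^ (n / 4 : ℝ) * (2 + C), by positivity, ?_⟩
  intro S u f x R M δ κ lam Lam K N sol ell hδ hκ hR B hB hfB hRB hx e he k₀ b₀ hk₀ hb₀ hW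
  have hn0 : (0 : ℝ) < n := by exact_mod_cast (by omega : 0 < n)
  have hn2 : (2 : ℝ) < n := by exact_mod_cast hn
  have hlam := ell.lam_pos
  set T := Lam / lam
  have hT : 0 < T := div_pos (hlam.trans_le ell.lam_le) hlam
  obtain ⟨g, hg0, hg, hgs⟩ := hpot f sol.meas_f B hB hfB x R hR hRB
  have hpp : 0 < (2 : ℝ)⁻¹ - (n : ℝ)⁻¹ := sub_pos.2 (inv_strictAnti₀ two_pos hn2)
  obtain ⟨p', hp'⟩ : ∃ p' : ℝ≥0, (p' : ℝ)⁻¹ = (2 : ℝ)⁻¹ - (n : ℝ)⁻¹ :=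
    ⟨((2 : ℝ)⁻¹ - (n : ℝ)⁻¹)⁻¹.toNNReal, by rw [Real.coe_toNNReal _ (by positivity), inv_inv]⟩
  set v : Eucl n → ℝ := fun y => fderiv ℝ u y e with hvdef
  have hvi : ∀ y, inner ℝ (gradient u y) e = v y := fun y => by
    rw [gradient, InnerProductSpace.toDual_symm_apply]
  have hv : Measurable v := measurable_fderiv_apply_const ℝ u e
  have hvl : ∀ᵐ y, lineDeriv ℝ u y e = v y := by
    filter_upwards [sol.lip.ae_differentiableAt] with y hy using hy.lineDeriv_eq_fderiv
  simp only [hvi] at hW ⊢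
  set γ : ℝ := T ^ (-(1 / 2) : ℝ) / lam with hγdef
  have hγ : 0 ≤ γ := by positivity
  set Θ : ℝ := (D * T) ^ (n / 4 : ℝ) with hΘdef
  have hΘ : 0 < Θ := by positivity
  have hG : 8 / lam ^ 2 ≤ 352 * T * γ ^ 2 := by
    have h1 : (T ^ (-(1 / 2) : ℝ)) ^ 2 = T⁻¹ := by
      rw [← Real.rpow_natCast, ← Real.rpow_mul hT.le, ← Real.rpow_neg_one]
      norm_num
    rw [hγdef, div_pow, h1]
    have : 352 * T * (T⁻¹ / lam ^ 2) = 352 / lam ^ 2 := by field_simp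
    rw [this]
    gcongr
    norm_num
  have H : ∀ r, 0 < r → r ≤ R → ∀ k, k₀ ≤ k →
      eLpNorm ((closedBall x (r / 2)).indicator fun y => max (v y - k) 0) p' volume ≤
      (Cs + 1 : ℝ≥0) * (ENNReal.ofReal (352 * T / r ^ 2) * levelEnergy v x r k +
        ENNReal.ofReal (8 / lam ^ 2) * ∫⁻ y in ball x r, ‖f y‖ₑ ^ 2) ^ (1 / 2 : ℝ) := by
    intro r hr hrR k hk
    have hf : ∫⁻ y in ball x r, ‖f y‖ₑ ^ 2 ≠ ⊤ := by
      exact ne_top_of_le_ne_top ENNReal.ofReal_ne_top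
        ((lintegral_mono_set (ball_subset_ball hrR)).trans (by simpa using hg 0))
    have := (sol.mono_radius hrR).reverse_holder hn hp' ell hf hδ hκ hr he (hk₀.trans_le hk)
    rw [eLpNorm_congr_ae (g := (closedBall x (r / 2)).indicator fun y => max (v y - k) 0) (by
        filter_upwards [hvl] with y hy
        simp only [indicator, hy]),
      setLIntegral_congr_fun_ae (g := fun y => ENNReal.ofReal (max (v y - k) 0 ^ 2))
        measurableSet_ball (by filter_upwards [hvl] with y hy _; rw [hy])] at this
    refine this.trans ?_
    rw [levelEnergy]
    gcongr
    exact le_self_add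
  have hiter := levelEnergy_iterate hn hp' hv hR (by positivity) hG hγ hg0 hb₀ hΘ (by
    rw [hΘdef, ← Real.rpow_mul (by positivity), show (n / 4 * (4 / n) : ℝ) = 1 by field_simp,
      Real.rpow_one]
    exact le_of_eq (by simp only [D]; push_cast; ring)) hg hW H
  have hsum := sum_iterBound_le hb₀ hγ hg0 hgs
  have hpos := fun i => (iterBound_pos hb₀ hγ hg0 i).le
  have hlim : Filter.Tendsto (iterBound b₀ γ g) Filter.atTop (nhds 0) :=
    (summable_of_sum_range_le hpos hsum).tendsto_atTop_zero
  have hle := le_of_levelEnergy_le hv hR hlim (c := v x)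
    (k := k₀ + Θ * (2 * b₀ + γ * (C * (lorentzNorm B f).toReal))) (fun m => by
      refine le_trans ?_ (hiter m)
      refine levelEnergy_anti ?_
      gcongr
      exact hsum m) (by
      refine tendsto_of_tendsto_of_tendsto_of_le_of_le tendsto_const_nhds hx
        (fun _ => zero_le) fun r => ?_
      dsimp only
      gcongr with y
      rw [← hvi, ← hvi, ← inner_sub_left]
      rw [← ofReal_norm, ← ofReal_norm]
      refine ENNReal.ofReal_le_ofReal ((norm_inner_le_norm _ _).trans ?_)
      exact mul_le_of_le_one_right (norm_nonneg _) he)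
  refine hle.trans ?_
  have e1 : Θ * γ = D ^ (n / 4 : ℝ) * (T ^ (n / 4 - 1 / 2 : ℝ) / lam) := by
    rw [hΘdef, hγdef, Real.mul_rpow hD.le hT.le, sub_eq_add_neg (n / 4 : ℝ), Real.rpow_add hT]
    ring
  have e2 : Θ = D ^ (n / 4 : ℝ) * T ^ (n / 4 : ℝ) := Real.mul_rpow hD.le hT.le
  have hΛ : 0 ≤ (lorentzNorm B f).toReal := ENNReal.toReal_nonneg
  set Λ := (lorentzNorm B f).toReal
  calc k₀ + Θ * (2 * b₀ + γ * (C * Λ)) = k₀ + (2 * (Θ * b₀) + C * (Θ * γ * Λ)) := by ring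
    _ ≤ k₀ + ((2 + C) * (Θ * b₀) + (2 + C) * (Θ * γ * Λ)) := by
        gcongr <;> linarith
    _ = _ := by rw [e1, e2]; ring

end

section

variable {n : ℕ}

theorem gradient_congr {u w : Eucl n → ℝ} {s : Set (Eucl n)} (hs : IsOpen s) (h : EqOn u w s)
    {y : Eucl n} (hy : y ∈ s) : gradient u y = gradient w y := by
  rw [gradient, gradient, (h.eventuallyEq_of_mem (hs.mem_nhds hy)).fderiv_eq]

theorem gradient_add_const_mul {u φ : Eucl n → ℝ} {y : Eucl n} (hu : DifferentiableAt ℝ u y)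
    (hφ : DifferentiableAt ℝ φ y) (t : ℝ) :
    gradient (fun z => u z + t * φ z) y = gradient u y + t • gradient φ y := by
  have h : fderiv ℝ (fun z => u z + t * φ z) y = fderiv ℝ u y + t • fderiv ℝ φ y :=
    (hu.hasFDerivAt.add (hφ.hasFDerivAt.const_mul t)).fderiv
  rw [gradient, gradient, gradient, h, map_add, map_smulₛₗ]
  simp

theorem lorentzNorm_mono {A B : Set (Eucl n)} (h : A ⊆ B) (f : Eucl n → ℝ) :
    lorentzNorm A f ≤ lorentzNorm B f := by
  rw [lorentzNorm, lorentzNorm]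
  gcongr

theorem lorentzNorm_indicator (B : Set (Eucl n)) (f : Eucl n → ℝ) :
    lorentzNorm B (B.indicator f) = lorentzNorm B f := by
  rw [lorentzNorm, lorentzNorm]
  refine lintegral_congr fun t => ?_
  congr 2
  ext x
  simp +contextual [and_congr_right_iff]

/-- Euler–Lagrange equation for Lipschitz test functions. -/
theorem IsLocMinimizer.integral_fderiv_eq {Ω : Set (Eucl n)} {F f u ut : Eucl n → ℝ}
    (hc : ConvexOn ℝ univ F) (hd : Differentiable ℝ F) (hu : LocLipOn Ω u)
    (hmin : IsLocMinimizer Ω F f u) {x₀ : Eucl n} {r : ℝ} (hB : closure (ball x₀ r) ⊆ Ω)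
    (hf : IntegrableOn f (ball x₀ r)) {K : ℝ≥0} (hut : LipschitzWith K ut)
    (heq : EqOn u ut (ball x₀ r)) {φ : Eucl n → ℝ} {ℓ : ℝ≥0} (hφ : LipschitzWith ℓ φ)
    {Z : Set (Eucl n)} (hZ : IsCompact Z) (hZB : Z ⊆ ball x₀ r) (hφZ : ∀ y ∉ Z, φ y = 0) :
    ∫ y in ball x₀ r, fderiv ℝ F (gradient ut y) (gradient φ y) = ∫ y in ball x₀ r, f y * φ y := by
  have hBc : IsCompact (closure (ball x₀ r)) :=
    (isCompact_closedBall x₀ r).of_isClosed_subset isClosed_closure closure_ball_subset_closedBall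
  set μ := (volume : Measure (Eucl n)).restrict (ball x₀ r)
  have : IsFiniteMeasure μ := ⟨by
    rw [Measure.restrict_apply_univ]; exact measure_ball_lt_top⟩
  have hφb : ∃ C, ∀ y, ‖φ y‖ ≤ C := by
    obtain ⟨C, hC⟩ := hZ.exists_bound_of_continuousOn hφ.continuous.continuousOn
    refine ⟨max C 0, fun y => ?_⟩
    by_cases hy : y ∈ Z
    · exact (hC y hy).trans (le_max_left _ _)
    · rw [hφZ y hy, norm_zero]; exact le_max_right _ _
  obtain ⟨Cφ, hCφ⟩ := hφb
  have hfφ : Integrable (fun y => f y * φ y) μ :=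
    hf.mul_bdd hφ.continuous.aestronglyMeasurable (ae_of_all _ hCφ)
  have hfu : Integrable (fun y => f y * ut y) μ := by
    obtain ⟨C, hC⟩ := hBc.exists_bound_of_continuousOn hut.continuous.continuousOn
    refine hf.mul_bdd hut.continuous.aestronglyMeasurable (c := C) ?_
    filter_upwards [ae_restrict_mem measurableSet_ball] with y hy using hC y (subset_closure hy)
  obtain ⟨KF, hKF⟩ := (hc.locallyLipschitz.locallyLipschitzOn (s := closedBall (0 : Eucl n)
    (K + ℓ))).exists_lipschitzOnWith_of_compact (isCompact_closedBall _ _)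
  have hmem : ∀ y : Eucl n, ∀ t : ℝ, |t| ≤ 1 →
      gradient ut y + t • gradient φ y ∈ closedBall (0 : Eucl n) (K + ℓ) := by
    intro y t ht
    rw [mem_closedBall_zero_iff]
    refine (norm_add_le _ _).trans (add_le_add (norm_gradient_le_of_lipschitz hut y) ?_)
    rw [norm_smul]
    calc _ ≤ 1 * (ℓ : ℝ) := by gcongr; exacts [ht, norm_gradient_le_of_lipschitz hφ y]
      _ = ℓ := one_mul _
  have hFcont : Continuous F := hd.continuous
  have hmeas : ∀ t : ℝ, AEStronglyMeasurable (fun y => F (gradient ut y + t • gradient φ y)) μ :=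
    fun t => (hFcont.measurable.comp ((measurable_gradient ut).add
      ((measurable_gradient φ).const_smul t))).aestronglyMeasurable
  have hF0 : Integrable (fun y => F (gradient ut y)) μ := by
    obtain ⟨C, hC⟩ := (isCompact_closedBall (0 : Eucl n) (K + ℓ)).exists_bound_of_continuousOn
      hFcont.continuousOn
    refine Integrable.of_bound (C := C) (by simpa using hmeas 0) (ae_of_all _ fun y => ?_)
    have := hmem y 0 (by simp)
    rw [zero_smul, add_zero] at this
    exact hC _ this
  set J : ℝ → Eucl n → ℝ := fun t y =>
    F (gradient ut y + t • gradient φ y) - f y * ut y - t * (f y * φ y) with hJ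
  have hder := hasDerivAt_integral_of_dominated_loc_of_lip (μ := μ) (F := J) (x₀ := 0)
    (F' := fun y => fderiv ℝ F (gradient ut y) (gradient φ y) - f y * φ y)
    (bound := fun y => KF * ℓ + ‖f y * φ y‖)
    (s := ball 0 1) (ball_mem_nhds _ one_pos)
    (Filter.Eventually.of_forall fun t => ((hmeas t).sub hfu.1).sub (hfφ.1.const_mul t))
    ((hF0.sub hfu).congr (ae_of_all _ fun y => by simp [hJ]))
    (by
      have h1 : Measurable fun y => fderiv ℝ F (gradient ut y) (gradient φ y) :=
        isBoundedBilinearMap_apply.continuous.measurable.comp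
          (((measurable_fderiv ℝ F).comp (measurable_gradient ut)).prodMk (measurable_gradient φ))
      exact h1.aestronglyMeasurable.sub hfφ.1)
    (ae_of_all _ fun y => by
      refine LipschitzOnWith.of_dist_le_mul fun s hs t ht => ?_
      rw [mem_ball_zero_iff, Real.norm_eq_abs] at hs ht
      have h1 := hKF.dist_le_mul _ (hmem y s hs.le) _ (hmem y t ht.le)
      have h0 : dist (s • gradient φ y) (t • gradient φ y) = dist s t * ‖gradient φ y‖ := by
        rw [dist_eq_norm, ← sub_smul, norm_smul, dist_eq_norm]
      rw [dist_add_left, h0, dist_eq_norm (F _)] at h1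
      have h2 := norm_gradient_le_of_lipschitz hφ y
      rw [Real.coe_nnabs, abs_of_nonneg (by positivity)]
      rw [dist_eq_norm]
      have e : J s y - J t y = (F (gradient ut y + s • gradient φ y) -
        F (gradient ut y + t • gradient φ y)) - (s - t) * (f y * φ y) := by simp only [hJ]; ring
      rw [e]
      refine (norm_sub_le _ _).trans ?_
      rw [norm_mul, ← dist_eq_norm s t, add_mul]
      refine add_le_add (h1.trans ?_) (le_of_eq (mul_comm _ _))
      calc (KF : ℝ) * (dist s t * ‖gradient φ y‖) ≤ KF * (dist s t * ℓ) := by gcongr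
        _ = _ := by ring)
    ((integrable_const _).add hfφ.norm)
    (ae_of_all _ fun y => by
      have h1 : HasDerivAt (fun t : ℝ => gradient ut y + t • gradient φ y) (gradient φ y) 0 := by
        simpa using ((hasDerivAt_id (0 : ℝ)).smul_const (gradient φ y)).const_add (gradient ut y)
      have h2 : HasFDerivAt F (fderiv ℝ F (gradient ut y))
          (gradient ut y + (0 : ℝ) • gradient φ y) := by
        rw [zero_smul, add_zero]; exact (hd _).hasFDerivAt
      have h3 := ((h2.comp_hasDerivAt 0 h1).sub_const (f y * ut y)).sub
        ((hasDerivAt_id (0 : ℝ)).mul_const (f y * φ y))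
      exact h3.congr_deriv (by rw [one_mul]))
  have hI : ∀ t : ℝ, ∫ y in ball x₀ r, (F (gradient (fun z => u z + t * φ z) y) -
      f y * (u y + t * φ y)) = ∫ y, J t y ∂μ := by
    intro t
    refine setIntegral_congr_ae measurableSet_ball ?_
    filter_upwards [hut.ae_differentiableAt, hφ.ae_differentiableAt] with y h1 h2 hy
    have h3 : EqOn (fun z => u z + t * φ z) (fun z => ut z + t * φ z) (ball x₀ r) :=
      fun z hz => by simp only [heq hz]
    rw [gradient_congr isOpen_ball h3 hy, gradient_add_const_mul h1 h2, heq hy]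
    simp only [hJ]; ring
  have hlm : IsLocalMin (fun t => ∫ y, J t y ∂μ) 0 := by
    refine Filter.Eventually.of_forall fun t => ?_
    dsimp only
    rw [← hI, ← hI]
    have hcl : closure {z | u z + t * φ z ≠ u z} ⊆ Z := by
      refine closure_minimal (fun z hz => ?_) hZ.isClosed
      by_contra h
      exact hz (by rw [hφZ z h, mul_zero, add_zero])
    have := hmin (ball x₀ r) isOpen_ball hBc hB (fun z => u z + t * φ z) (fun A hA hAΩ => by
      obtain ⟨C, hC⟩ := hu A hA hAΩ
      refine ⟨C + ‖t‖₊ * ℓ, ?_⟩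
      exact hC.add ((lipschitzWith_smul t).comp hφ).lipschitzOnWith)
      (hZ.of_isClosed_subset isClosed_closure hcl) (hcl.trans hZB)
    simpa using this
  have h0 := hlm.hasDerivAt_eq_zero hder.2
  have hint : Integrable (fun y => fderiv ℝ F (gradient ut y) (gradient φ y)) μ := by
    exact (hder.1.add hfφ).congr (ae_of_all _ fun y => by simp)
  rw [integral_sub hint hfφ] at h0
  exact sub_eq_zero.1 h0

end

section

variable {n : ℕ}

theorem volume_rpow_mul_lorentzNorm_ne_top (hn : 2 < n) {f : Eucl n → ℝ} {x₀ : Eucl n} {r : ℝ}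
    (hf : lorentzNorm (ball x₀ r) f ≠ ⊤) :
    volume (ball x₀ r) ^ (1 / 3 - 1 / n : ℝ) * lorentzNorm (ball x₀ r) f ≠ ⊤ := by
  have hn3 : (3 : ℝ) ≤ n := by exact_mod_cast hn
  have : 1 / (n : ℝ) ≤ 1 / 3 := one_div_le_one_div_of_le (by norm_num) hn3
  exact ENNReal.mul_ne_top (ENNReal.rpow_ne_top_of_nonneg (by linarith) measure_ball_lt_top.ne) hf

theorem integrableOn_of_lorentzNorm_ne_top (hn : 2 < n) {f : Eucl n → ℝ} (hfm : Measurable f)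
    {x₀ : Eucl n} {r : ℝ} (hf : lorentzNorm (ball x₀ r) f ≠ ⊤) : IntegrableOn f (ball x₀ r) := by
  refine ⟨hfm.aestronglyMeasurable, ?_⟩
  refine lt_of_le_of_lt (setLIntegral_enorm_le_lorentzNorm hn hfm subset_rfl) ?_
  exact ENNReal.mul_lt_top (volume_rpow_mul_lorentzNorm_ne_top hn hf).lt_top
    (ENNReal.rpow_lt_top_of_nonneg (by norm_num) measure_ball_lt_top.ne)

theorem IsLocMinimizer.lipSolution (hn : 2 < n) {Ω : Set (Eucl n)} {F f u ut : Eucl n → ℝ}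
    (hc : ConvexOn ℝ univ F) (hd : Differentiable ℝ F) (hu : LocLipOn Ω u)
    (hmin : IsLocMinimizer Ω F f u) {x₀ : Eucl n} {r : ℝ} (hB : closure (ball x₀ r) ⊆ Ω)
    (hfm : Measurable f) (hf : lorentzNorm (ball x₀ r) f ≠ ⊤) {K : ℝ≥0} (hut : LipschitzWith K ut)
    (heq : EqOn u ut (ball x₀ r)) {x : Eucl n} {R M : ℝ} (hsub : ball x R ⊆ ball x₀ r)
    (hM : ∀ᵐ y, y ∈ ball x R → ‖gradient ut y‖ ≤ M) :
    LipSolution (fderiv ℝ F) ut ((ball x₀ r).indicator f) x R M K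
      (volume (ball x₀ r) ^ (1 / 3 - 1 / n : ℝ) * lorentzNorm (ball x₀ r) f).toNNReal where
  lip := hut
  grad_le := hM
  meas_f := hfm.indicator measurableSet_ball
  lintegral_le A hA := by
    rw [ENNReal.coe_toNNReal (volume_rpow_mul_lorentzNorm_ne_top hn hf)]
    calc ∫⁻ y in A, ‖(ball x₀ r).indicator f y‖ₑ = ∫⁻ y in A ∩ ball x₀ r, ‖f y‖ₑ := by
          simp_rw [enorm_indicator_eq_indicator_enorm]
          rw [lintegral_indicator measurableSet_ball, Measure.restrict_restrict measurableSet_ball,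
            inter_comm]
      _ ≤ _ := setLIntegral_enorm_le_lorentzNorm hn hfm inter_subset_right
      _ ≤ _ := by gcongr; exact inter_subset_left
  euler φ ℓ hφ ρ hρ hφ0 := by
    have hZB : closedBall x ρ ⊆ ball x₀ r := (closedBall_subset_ball hρ).trans hsub
    have h := hmin.integral_fderiv_eq hc hd hu hB (integrableOn_of_lorentzNorm_ne_top hn hfm hf)
      hut heq hφ (isCompact_closedBall x ρ) hZB hφ0
    have hg : ∀ y ∉ ball x₀ r, gradient φ y = 0 := fun y hy => by
      have hy' : y ∈ (closedBall x ρ)ᶜ := fun h => hy (hZB h)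
      rw [gradient_congr (w := fun _ => 0) isClosed_closedBall.isOpen_compl
        (fun z hz => hφ0 z hz) hy', gradient]
      simp
    rw [setIntegral_eq_integral_of_forall_compl_eq_zero
      (fun y hy => by rw [hg y hy, map_zero])] at h
    rw [h, ← integral_indicator measurableSet_ball]
    refine integral_congr_ae (ae_of_all _ fun y => ?_)
    simp only [indicator]
    split_ifs <;> simp

end

section

variable {n : ℕ} {p q ν L μ : ℝ} {F : Eucl n → ℝ}

theorem PQGrowth.levelEnergy_le (hn : 1 < n) (hp : 0 < p) (hν : 0 < ν)
    (hF : PQGrowth p q ν L μ F) {u : Eucl n → ℝ} {x e : Eucl n} {R m k : ℝ} (he : ‖e‖ ≤ 1)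
    (hm : 0 < m) (hk : 2 ≤ k) (hM : ∀ᵐ y, y ∈ ball x R → ‖gradient u y‖ ≤ k * m) :
    levelEnergy (fun y => inner ℝ (gradient u y) e) x R (m / 2) ≤
      ENNReal.ofReal (k ^ |2 - p| / ν * m ^ (2 - p)) *
        ∫⁻ y in ball x R, ENNReal.ofReal (F (gradient u y)) := by
  have hF0 := hF.apply_nonneg hn hp hν.le
  rw [levelEnergy, ← lintegral_const_mul' _ _ ENNReal.ofReal_ne_top]
  refine setLIntegral_mono_ae' measurableSet_ball ?_
  filter_upwards [hM] with y hy hyx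
  have hy := hy hyx
  rw [← ENNReal.ofReal_mul (by positivity)]
  refine ENNReal.ofReal_le_ofReal ?_
  set g := gradient u y
  rcases le_or_gt (inner ℝ g e) (m / 2) with h | h
  · rw [max_eq_right (by linarith)]
    rw [zero_pow two_ne_zero]
    exact mul_nonneg (by positivity) (hF0 g)
  have hge : inner ℝ g e ≤ ‖g‖ :=
    (real_inner_le_norm g e).trans (mul_le_of_le_one_right (norm_nonneg _) he)
  have hg0 : 0 < ‖g‖ := by linarith
  rw [max_eq_left (by linarith)]
  have h1 : ‖g‖ / m ∈ Icc k⁻¹ k := by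
    constructor
    · rw [le_div_iff₀ hm]
      have : k⁻¹ ≤ 2⁻¹ := inv_anti₀ two_pos hk
      nlinarith
    · rwa [div_le_iff₀ hm]
  have h2 := (rpow_mem_Icc_of_mem_Icc (x := 2 - p) (by linarith) h1 le_rfl).2
  rw [Real.div_rpow hg0.le hm.le, div_le_iff₀ (by positivity)] at h2
  calc (inner ℝ g e - m / 2) ^ 2 ≤ ‖g‖ ^ 2 :=
        pow_le_pow_left₀ (by linarith) (by linarith) 2
    _ = ‖g‖ ^ (2 - p) * ‖g‖ ^ p := by
        rw [← Real.rpow_add hg0, sub_add_cancel, Real.rpow_two]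
    _ ≤ k ^ |2 - p| * m ^ (2 - p) * ‖g‖ ^ p := by gcongr
    _ = k ^ |2 - p| / ν * m ^ (2 - p) * (ν * ‖g‖ ^ p) := by field_simp
    _ ≤ _ := by
        gcongr
        exact hF.mul_norm_rpow_le_apply hn hp hν.le g

theorem PQGrowth.exists_norm_gradient_le (hn : 2 < n) (hp : 1 < p) (hpq : p ≤ q) (hν : 0 < ν)
    (hν1 : ν ≤ 1) (hL : 1 ≤ L) {k : ℝ} (hk : 2 ≤ k) : ∃ C : ℝ, 0 < C ∧
    ∀ {μ : ℝ} {F : Eucl n → ℝ}, PQGrowth p q ν L μ F →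
    ∀ {u f : Eucl n → ℝ} {x : Eucl n} {R m : ℝ} {K N : ℝ≥0},
      LipSolution (fderiv ℝ F) u f x R (k * m) K N → 0 < R →
    ∀ B : Set (Eucl n), volume B ≠ ⊤ → lorentzNorm B f ≠ ⊤ → ball x R ⊆ B →
      Filter.Tendsto (fun r => (∫⁻ y in closedBall x r, ‖gradient u y - gradient u x‖ₑ) /
        volume (closedBall x r)) (nhdsWithin 0 (Ioi 0)) (nhds 0) →
      ‖gradient u x‖ = m → 0 < m → μ ≤ m →
    ∀ Y : ℝ, 0 < Y → ∫⁻ y in ball x R, ENNReal.ofReal (F (gradient u y)) ≤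
        ENNReal.ofReal (R ^ n * Y) →
      m ≤ C * ((m ^ (q - p) + 1) ^ (n / 4 : ℝ) * (m ^ (1 - p / 2) * Y ^ (1 / 2 : ℝ)) +
        (m ^ (q - p) + 1) ^ (n / 4 - 1 / 2 : ℝ) * (m ^ (2 - p) * (lorentzNorm B f).toReal)) := by
  have hn1 : 1 < n := by omega
  have hp0 : 0 < p := by linarith
  obtain ⟨C₁, hC₁, hpw⟩ := exists_pointwise_bound hn
  obtain ⟨c, C₂, hc, hcC, hell⟩ := PQGrowth.exists_ellipticField hn1 hp hpq hν hν1 hL k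
  have hC₂ : 0 < C₂ := hc.trans_le hcC
  set D := √(k ^ |2 - p| / ν) with hD
  set a := (C₂ / c) ^ (n / 4 : ℝ)
  set b := (C₂ / c) ^ (n / 4 - 1 / 2 : ℝ)
  refine ⟨2 * C₁ * (a * D + b / c), by positivity, ?_⟩
  intro μ F hF u f x R m K N sol hR B hB hfB hRB hx hxm hm hμ Y hY hI
  set e : Eucl n := m⁻¹ • gradient u x with he
  have he1 : ‖e‖ ≤ 1 := by
    rw [he, norm_smul, norm_inv, Real.norm_of_nonneg hm.le, hxm, inv_mul_cancel₀ hm.ne']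
  have hxe : inner ℝ (gradient u x) e = m := by
    rw [he, inner_smul_right, real_inner_self_eq_norm_sq, hxm]
    field_simp
  have hlev := hF.levelEnergy_le hn1 hp0 hν he1 hm hk sol.grad_le
  have hb₀ : (0 : ℝ) < D * (m ^ (1 - p / 2) * Y ^ (1 / 2 : ℝ)) := by positivity
  have hsq : R ^ n * (D * (m ^ (1 - p / 2) * Y ^ (1 / 2 : ℝ))) ^ 2 =
      k ^ |2 - p| / ν * m ^ (2 - p) * (R ^ n * Y) := by
    have h1 : (m ^ (1 - p / 2)) ^ 2 = m ^ (2 - p) := by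
      rw [← Real.rpow_natCast, ← Real.rpow_mul hm.le]; congr 1; push_cast; ring
    have h2 : (Y ^ (1 / 2 : ℝ)) ^ 2 = Y := by
      rw [← Real.rpow_natCast, ← Real.rpow_mul hY.le]; norm_num
    rw [mul_pow, mul_pow, h1, h2, hD, Real.sq_sqrt (by positivity)]
    ring
  have hmain := hpw sol (hell μ F hF m hm hμ) (by positivity) (by positivity) hR B hB hfB hRB hx
    e he1 (m / 2) _ (by linarith) hb₀ (by
      rw [hsq, ENNReal.ofReal_mul (by positivity)]
      exact hlev.trans (by gcongr))
  have hT : C₂ * (m ^ (q - 2) + m ^ (p - 2)) / (c * m ^ (p - 2)) =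
      C₂ / c * (m ^ (q - p) + 1) := by
    have : m ^ (q - 2) = m ^ (q - p) * m ^ (p - 2) := by
      rw [← Real.rpow_add hm]; congr 1; ring
    rw [this]
    field_simp
  have hmp : (m ^ (p - 2))⁻¹ = m ^ (2 - p) := by rw [← Real.rpow_neg hm.le]; congr 1; ring
  have hS : 0 < m ^ (q - p) + 1 := by positivity
  rw [hT, hxe, Real.mul_rpow (by positivity) hS.le, Real.mul_rpow (by positivity) hS.le] at hmain
  have hΛ : 0 ≤ (lorentzNorm B f).toReal := ENNReal.toReal_nonneg
  set Λ := (lorentzNorm B f).toReal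
  set P := (m ^ (q - p) + 1) ^ (n / 4 : ℝ) * (m ^ (1 - p / 2) * Y ^ (1 / 2 : ℝ))
  set Q := (m ^ (q - p) + 1) ^ (n / 4 - 1 / 2 : ℝ) * (m ^ (2 - p) * Λ) with hQ
  have hP0 : 0 ≤ P := by positivity
  have hQ0 : 0 ≤ Q := by positivity
  have e1 : b * (m ^ (q - p) + 1) ^ (n / 4 - 1 / 2 : ℝ) / (c * m ^ (p - 2)) * Λ = b / c * Q := by
    rw [hQ, ← hmp]; field_simp
  have e2 : a * (m ^ (q - p) + 1) ^ (n / 4 : ℝ) * (D * (m ^ (1 - p / 2) * Y ^ (1 / 2 : ℝ))) =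
      a * D * P := by ring
  rw [e1, e2] at hmain
  have h1 : 0 ≤ a * D := by positivity
  have h2 : 0 ≤ b / c := by positivity
  have h3 : a * D * P + b / c * Q ≤ (a * D + b / c) * (P + Q) := by nlinarith
  have h4 := mul_le_mul_of_nonneg_left h3 hC₁.le
  linarith

end

theorem Real.le_of_le_mul_rpow {A Z m a s : ℝ} (hA : 0 ≤ A) (hZ : 0 ≤ Z) (hm : 0 < m) (ha : 0 < a)
    (h : m ≤ A * (m ^ (1 - a) * Z ^ s)) : m ≤ A ^ (1 / a) * Z ^ (s / a) := by
  have h1 : m ^ a ≤ A * Z ^ s := by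
    have : m = m ^ a * m ^ (1 - a) := by
      rw [← Real.rpow_add hm]; simp
    have h2 : m ^ a * m ^ (1 - a) ≤ A * Z ^ s * m ^ (1 - a) := by
      rw [← this]; linarith
    exact le_of_mul_le_mul_right h2 (by positivity)
  calc m = (m ^ a) ^ (1 / a) := by
        rw [← Real.rpow_mul hm.le, mul_one_div_cancel ha.ne', Real.rpow_one]
    _ ≤ (A * Z ^ s) ^ (1 / a) := by gcongr
    _ = _ := by
        rw [Real.mul_rpow hA (by positivity), ← Real.rpow_mul hZ, mul_one_div]

/-- Absorbing the nonuniform ellipticity ratio `m ^ τ + 1` in a superlinear inequality: the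
exponent of `m` deteriorates from `1 - a` to `1 - a + κ * τ`. -/
theorem Real.exists_le_of_le_mul_add_one_rpow {τ κ a s : ℝ} (hκ : 0 ≤ κ) (hτ : 0 ≤ τ)
    (ha : 0 < a) (haτ : κ * τ < a) (A : ℝ) (hA : 0 < A) : ∃ C : ℝ, 0 < C ∧
    ∀ m Z : ℝ, 0 < m → 0 ≤ Z → m ≤ A * ((m ^ τ + 1) ^ κ * (m ^ (1 - a) * Z ^ s)) →
      m ≤ C * (Z ^ (s / a) + Z ^ (s / (a - κ * τ))) := by
  have hb : 0 < a - κ * τ := by linarith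
  set A' := A * 2 ^ κ
  have hA' : 0 < A' := by positivity
  refine ⟨A' ^ (1 / a) + A' ^ (1 / (a - κ * τ)), by positivity, ?_⟩
  intro m Z hm hZ h
  have hZs : 0 ≤ Z ^ s := by positivity
  have hZ1 : 0 ≤ Z ^ (s / a) := by positivity
  have hZ2 : 0 ≤ Z ^ (s / (a - κ * τ)) := by positivity
  have hA1 : 0 ≤ A' ^ (1 / a) := by positivity
  have hA2 : 0 ≤ A' ^ (1 / (a - κ * τ)) := by positivity
  rcases le_total m 1 with h1 | h1
  · have h2 : m ^ τ + 1 ≤ 2 := by linarith [Real.rpow_le_one hm.le h1 hτ]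
    have h3 := Real.le_of_le_mul_rpow hA'.le hZ hm ha (s := s) (h.trans (by
      rw [mul_assoc]; gcongr))
    nlinarith [mul_nonneg hA1 hZ2, mul_nonneg hA2 hZ1, mul_nonneg hA2 hZ2]
  · have h2 : m ^ τ + 1 ≤ 2 * m ^ τ := by linarith [Real.one_le_rpow h1 hτ]
    have h3 := Real.le_of_le_mul_rpow hA'.le hZ hm hb (s := s) (h.trans (by
      calc A * ((m ^ τ + 1) ^ κ * (m ^ (1 - a) * Z ^ s))
          ≤ A * ((2 * m ^ τ) ^ κ * (m ^ (1 - a) * Z ^ s)) := by gcongr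
        _ = A' * (m ^ (κ * τ + (1 - a)) * Z ^ s) := by
            rw [Real.mul_rpow two_pos.le (by positivity), ← Real.rpow_mul hm.le, mul_comm τ κ,
              Real.rpow_add hm]
            ring
        _ ≤ _ := by rw [show κ * τ + (1 - a) = 1 - (a - κ * τ) by ring]))
    nlinarith [mul_nonneg hA1 hZ2, mul_nonneg hA2 hZ1, mul_nonneg hA1 hZ1]

theorem gap_iff_lt {n : ℕ} (hn : 2 < n) {p q : ℝ} (hp : 1 < p) :
    q / p < 1 + min (2 / (n : ℝ)) (4 * (p - 1) / (p * ((n : ℝ) - 2))) ↔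
      n * (q - p) < 2 * p ∧ (n - 2) * (q - p) < 4 * (p - 1) := by
  have hp0 : 0 < p := by linarith
  have hn0 : (2 : ℝ) < n := by exact_mod_cast hn
  have hn2 : (0 : ℝ) < n - 2 := by linarith
  rw [← sub_lt_iff_lt_add', lt_min_iff, show q / p - 1 = (q - p) / p by field_simp,
    div_lt_div_iff₀ hp0 (by linarith), div_lt_div_iff₀ hp0 (by positivity)]
  refine and_congr (by rw [mul_comm]) ?_
  rw [show (q - p) * (p * ((n : ℝ) - 2)) = (n - 2) * (q - p) * p by ring]
  exact mul_lt_mul_iff_left₀ hp0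

theorem exists_le_rpow_of_le {n : ℕ} (hn : 2 < n) {p q : ℝ} (hp : 1 < p) (hpq : p ≤ q)
    (h1 : n * (q - p) < 2 * p) (h2 : (n - 2) * (q - p) < 4 * (p - 1)) {A : ℝ} (hA : 0 < A) :
    ∃ C : ℝ, 0 < C ∧ ∀ m Y Λ : ℝ, 0 < m → 0 ≤ Y → 0 ≤ Λ →
      m ≤ A * ((m ^ (q - p) + 1) ^ (n / 4 : ℝ) * (m ^ (1 - p / 2) * Y ^ (1 / 2 : ℝ)) +
        (m ^ (q - p) + 1) ^ (n / 4 - 1 / 2 : ℝ) * (m ^ (2 - p) * Λ)) →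
      m ≤ C * (Y ^ (1 / p) + Y ^ (2 / (((n : ℝ) + 2) * p - n * q)) + Λ ^ (1 / (p - 1)) +
        Λ ^ (4 / (4 * (p - 1) - ((n : ℝ) - 2) * (q - p)))) := by
  have hn0 : (2 : ℝ) < n := by exact_mod_cast hn
  obtain ⟨C₁, hC₁, H₁⟩ := Real.exists_le_of_le_mul_add_one_rpow (τ := q - p) (κ := n / 4)
    (a := p / 2) (s := 1 / 2) (by positivity) (by linarith) (by linarith) (by linarith)
    (2 * A) (by positivity)
  obtain ⟨C₂, hC₂, H₂⟩ := Real.exists_le_of_le_mul_add_one_rpow (τ := q - p) (κ := n / 4 - 1 / 2)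
    (a := p - 1) (s := 1) (by linarith) (by linarith) (by linarith) (by linarith)
    (2 * A) (by positivity)
  refine ⟨C₁ + C₂, by positivity, ?_⟩
  intro m Y Λ hm hY hΛ h
  have e1 : (1 / 2 : ℝ) / (p / 2) = 1 / p := by field_simp
  have e2 : (1 / 2 : ℝ) / (p / 2 - n / 4 * (q - p)) = 2 / (((n : ℝ) + 2) * p - n * q) := by
    have : 0 < p / 2 - n / 4 * (q - p) := by linarith
    have : 0 < ((n : ℝ) + 2) * p - n * q := by linarith
    rw [div_eq_div_iff (by positivity) (by positivity)]
    ring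
  have e3 : (1 : ℝ) / (p - 1 - (n / 4 - 1 / 2) * (q - p)) =
      4 / (4 * (p - 1) - ((n : ℝ) - 2) * (q - p)) := by
    have : 0 < p - 1 - (n / 4 - 1 / 2) * (q - p) := by linarith
    have : 0 < 4 * (p - 1) - ((n : ℝ) - 2) * (q - p) := by linarith
    rw [div_eq_div_iff (by positivity) (by positivity)]
    ring
  have z1 : 0 ≤ Y ^ (1 / p) := by positivity
  have z2 : 0 ≤ Y ^ (2 / (((n : ℝ) + 2) * p - n * q)) := by positivity
  have z3 : 0 ≤ Λ ^ (1 / (p - 1)) := by positivity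
  have z4 : 0 ≤ Λ ^ (4 / (4 * (p - 1) - ((n : ℝ) - 2) * (q - p))) := by positivity
  rw [mul_add] at h
  rcases le_total (A * ((m ^ (q - p) + 1) ^ (n / 4 - 1 / 2 : ℝ) * (m ^ (2 - p) * Λ)))
    (A * ((m ^ (q - p) + 1) ^ (n / 4 : ℝ) * (m ^ (1 - p / 2) * Y ^ (1 / 2 : ℝ)))) with h' | h'
  · have := H₁ m Y hm hY (by linarith)
    rw [e1, e2] at this
    refine this.trans (mul_le_mul ?_ ?_ ?_ ?_) <;> linarith
  · have := H₂ m Λ hm hΛ (by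
      rw [Real.rpow_one, show 1 - (p - 1) = 2 - p by ring]; linarith)
    rw [e3] at this
    refine this.trans (mul_le_mul ?_ ?_ ?_ ?_) <;> linarith

section

variable {n : ℕ}

/-- Absorption of a weighted essential supremum: it suffices to bound `w` at almost every point
which almost dominates `w` on a surrounding ball of half the distance to the boundary. -/
theorem ae_rpow_mul_le_of_doubling {w : Eucl n → ℝ} (hw : ∀ x, 0 ≤ w x) {K : ℝ} (hwK : ∀ x, w x ≤ K)
    {α : ℝ} (hα : 0 ≤ α) {x₀ : Eucl n} {r T : ℝ} (hT : 0 ≤ T)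
    (H : ∀ᵐ x, x ∈ ball x₀ r → 0 < w x →
      (∀ᵐ y, y ∈ ball x ((r - dist x x₀) / 2) → w y ≤ 2 ^ (α + 1) * w x) →
      (r - dist x x₀) ^ α * w x ≤ T) :
    ∀ᵐ x, x ∈ ball x₀ r → (r - dist x x₀) ^ α * w x ≤ 2 * T := by
  set g : Eucl n → ℝ≥0∞ := fun x => ENNReal.ofReal ((r - dist x x₀) ^ α * w x) with hg
  set S := essSup g (volume.restrict (ball x₀ r)) with hS
  have hgS : ∀ᵐ x, x ∈ ball x₀ r → g x ≤ S :=
    (ae_restrict_iff' measurableSet_ball).1 (ENNReal.ae_le_essSup g)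
  suffices hST : S ≤ ENNReal.ofReal (2 * T) by
    filter_upwards [hgS] with x hx hxB
    exact (ENNReal.ofReal_le_ofReal_iff (by positivity)).1 ((hx hxB).trans hST)
  have hStop : S ≠ ⊤ := by
    refine ne_top_of_le_ne_top (ENNReal.ofReal_ne_top (r := r ^ α * K)) ?_
    refine essSup_le_of_ae_le _ ?_
    refine (ae_restrict_iff' measurableSet_ball).2 (ae_of_all _ fun x hx => ?_)
    have : 0 < r - dist x x₀ := sub_pos.2 hx
    have hr : 0 ≤ r := by linarith [dist_nonneg (x := x) (y := x₀)]
    refine ENNReal.ofReal_le_ofReal (mul_le_mul (Real.rpow_le_rpow this.le ?_ hα) (hwK x) (hw x)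
      (by positivity))
    linarith [dist_nonneg (x := x) (y := x₀)]
  rcases eq_or_ne S 0 with h0 | h0
  · rw [h0]; exact zero_le
  have hfreq : ∃ᵐ x, x ∈ ball x₀ r ∧ S / 2 < g x := by
    by_contra hcon
    rw [Filter.not_frequently] at hcon
    have : S ≤ S / 2 := by
      refine essSup_le_of_ae_le _ ((ae_restrict_iff' measurableSet_ball).2 ?_)
      filter_upwards [hcon] with x hx hxB
      exact not_lt.1 fun h => hx ⟨hxB, h⟩
    exact (ENNReal.half_lt_self h0 hStop).not_ge this
  obtain ⟨x, ⟨hxB, hxS⟩, hxH⟩ := (hfreq.and_eventually H).exists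
  set d := r - dist x x₀ with hd
  have hd0 : 0 < d := sub_pos.2 hxB
  have hwx : 0 < w x := by
    by_contra hcon
    have : g x = 0 := by
      rw [hg]; simp only [show w x = 0 by linarith [hw x], mul_zero, ENNReal.ofReal_zero]
    rw [this] at hxS
    exact not_lt_zero hxS
  have hS2 : S ≤ ENNReal.ofReal (2 * (d ^ α * w x)) := by
    rw [ENNReal.ofReal_mul two_pos.le, ENNReal.ofReal_ofNat]
    have := (ENNReal.div_lt_iff (Or.inl two_ne_zero) (Or.inl ENNReal.ofNat_ne_top)).1 hxS
    rw [mul_comm]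
    exact this.le
  refine hS2.trans (ENNReal.ofReal_le_ofReal ?_)
  refine mul_le_mul_of_nonneg_left (hxH hxB hwx ?_) two_pos.le
  filter_upwards [hgS] with y hy hyx
  have hyd : d / 2 ≤ r - dist y x₀ := by
    have h1 : dist y x < d / 2 := hyx
    have h2 := dist_triangle y x x₀
    linarith
  have hyB : y ∈ ball x₀ r := by
    rw [mem_ball]; linarith
  have h3 := (ENNReal.ofReal_le_ofReal_iff (by positivity)).1 ((hy hyB).trans hS2)
  have h4 : (d / 2) ^ α * w y ≤ 2 * (d ^ α * w x) :=
    (mul_le_mul_of_nonneg_right (Real.rpow_le_rpow (by positivity) hyd hα) (hw y)).trans h3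
  rw [Real.div_rpow hd0.le two_pos.le, div_mul_eq_mul_div, div_le_iff₀ (by positivity)] at h4
  rw [Real.rpow_add_one two_ne_zero]
  refine le_of_mul_le_mul_left ?_ (show 0 < d ^ α by positivity)
  linarith

theorem rpow_mul_le_of_le_scaled {n : ℕ} {p β γ t m Y A Λ C c₀ : ℝ} (hp : 1 < p)
    (hβ : 1 / p ≤ β) (ht : 0 < t) (ht1 : t ≤ 1) (hA : 0 ≤ A) (hΛ : 0 ≤ Λ) (hC : 0 ≤ C)
    (hc₀ : 0 ≤ c₀) (hY : 0 ≤ Y) (htY : t ^ n * Y = c₀ * A)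
    (h : m ≤ C * (Y ^ (1 / p) + Y ^ β + Λ ^ (1 / (p - 1)) + Λ ^ γ)) :
    t ^ (n * β) * m ≤ C * (c₀ ^ (1 / p) + c₀ ^ β + 1) *
      ((A + Λ ^ (p / (p - 1))) ^ (1 / p) + (A + Λ ^ (p / (p - 1))) ^ β + Λ ^ γ) := by
  have hp0 : 0 < p := by linarith
  have hp1 : 0 < p - 1 := by linarith
  have hβ0 : 0 < β := lt_of_lt_of_le (by positivity) hβ
  have hscale : ∀ s : ℝ, t ^ (n * s) * Y ^ s = c₀ ^ s * A ^ s := fun s => by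
    rw [Real.rpow_mul ht.le, Real.rpow_natCast, ← Real.mul_rpow (by positivity) hY, htY,
      Real.mul_rpow hc₀ hA]
  have hL0 : 0 ≤ Λ ^ (p / (p - 1)) := by positivity
  set M := A + Λ ^ (p / (p - 1)) with hM
  have hM0 : 0 ≤ M := by positivity
  have hAM : A ≤ M := by linarith
  have h1 : t ^ (n * β) * Y ^ (1 / p) ≤ c₀ ^ (1 / p) * M ^ (1 / p) := by
    calc t ^ (n * β) * Y ^ (1 / p) ≤ t ^ (n * (1 / p)) * Y ^ (1 / p) :=
          mul_le_mul_of_nonneg_right (Real.rpow_le_rpow_of_exponent_ge ht ht1 (by gcongr))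
            (by positivity)
      _ = c₀ ^ (1 / p) * A ^ (1 / p) := hscale _
      _ ≤ _ := by gcongr
  have h2 : t ^ (n * β) * Y ^ β ≤ c₀ ^ β * M ^ β := by
    rw [hscale]; gcongr
  have ht2 : t ^ (n * β) ≤ 1 := Real.rpow_le_one ht.le ht1 (by positivity)
  have h3 : t ^ (n * β) * Λ ^ (1 / (p - 1)) ≤ M ^ (1 / p) := by
    calc t ^ (n * β) * Λ ^ (1 / (p - 1)) ≤ Λ ^ (1 / (p - 1)) :=
          mul_le_of_le_one_left (by positivity) ht2
      _ = (Λ ^ (p / (p - 1))) ^ (1 / p) := by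
          rw [← Real.rpow_mul hΛ]; congr 1; field_simp
      _ ≤ _ := by gcongr; linarith
  have h4 : t ^ (n * β) * Λ ^ γ ≤ Λ ^ γ := mul_le_of_le_one_left (by positivity) ht2
  have z1 : 0 ≤ M ^ (1 / p) := by positivity
  have z2 : 0 ≤ M ^ β := by positivity
  have z3 : 0 ≤ Λ ^ γ := by positivity
  have c1 : 0 ≤ c₀ ^ (1 / p) := by positivity
  have c2 : 0 ≤ c₀ ^ β := by positivity
  calc t ^ (n * β) * m
      ≤ t ^ (n * β) * (C * (Y ^ (1 / p) + Y ^ β + Λ ^ (1 / (p - 1)) + Λ ^ γ)) := by gcongr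
    _ = C * (t ^ (n * β) * Y ^ (1 / p) + t ^ (n * β) * Y ^ β + t ^ (n * β) * Λ ^ (1 / (p - 1)) +
          t ^ (n * β) * Λ ^ γ) := by ring
    _ ≤ C * ((c₀ ^ (1 / p) + c₀ ^ β + 1) * (M ^ (1 / p) + M ^ β + Λ ^ γ)) := by
        gcongr
        nlinarith [mul_nonneg c1 z2, mul_nonneg c1 z3, mul_nonneg c2 z1, mul_nonneg c2 z3]
    _ = _ := by ring

theorem integrableOn_ball_comp_gradient {F u : Eucl n → ℝ} (hF : Continuous F) {K : ℝ≥0}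
    (hu : LipschitzWith K u) (x₀ : Eucl n) (r : ℝ) :
    IntegrableOn (fun y => F (gradient u y)) (ball x₀ r) := by
  obtain ⟨b, hb⟩ := (isCompact_closedBall (0 : Eucl n) K).exists_bound_of_continuousOn
    hF.continuousOn
  refine Measure.integrableOn_of_bounded (M := b) measure_ball_lt_top.ne
    (hF.measurable.comp (measurable_gradient u)).aestronglyMeasurable (ae_of_all _ fun y => hb _ ?_)
  rw [mem_closedBall_zero_iff]
  exact norm_gradient_le_of_lipschitz hu y

theorem ae_tendsto_setLIntegral_gradient_sub {u : Eucl n → ℝ} {K : ℝ≥0} (hu : LipschitzWith K u) :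
    ∀ᵐ x, Filter.Tendsto (fun r => (∫⁻ y in closedBall x r, ‖gradient u y - gradient u x‖ₑ) /
      volume (closedBall x r)) (nhdsWithin 0 (Ioi 0)) (nhds 0) := by
  have hloc : LocallyIntegrable (gradient u) volume := by
    refine (locallyIntegrable_const (K : ℝ)).mono (measurable_gradient u).aestronglyMeasurable
      (ae_of_all _ fun y => ?_)
    exact (norm_gradient_le_of_lipschitz hu y).trans (Real.le_norm_self _)
  filter_upwards [VitaliFamily.ae_tendsto_lintegral_enorm_sub_div
    (Besicovitch.vitaliFamily volume) hloc] with x hx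
  exact hx.comp (Besicovitch.tendsto_filterAt volume x)

end

section

variable {n : ℕ} {p q ν L μ : ℝ} {F : Eucl n → ℝ}

theorem one_div_le_two_div_gap {n : ℕ} {p q : ℝ} (hp : 1 < p) (hpq : p ≤ q)
    (h : n * (q - p) < 2 * p) : 1 / p ≤ 2 / (((n : ℝ) + 2) * p - n * q) := by
  rw [div_le_div_iff₀ (by linarith) (by linarith)]
  have : 0 ≤ n * (q - p) := mul_nonneg (Nat.cast_nonneg n) (by linarith)
  linarith

/-- Weighted gradient bound at a Lebesgue point of the gradient whose value almost dominates the
gradient on the ball of half the distance to the boundary. -/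
theorem PQGrowth.exists_rpow_mul_norm_gradient_le (hn : 2 < n) (hp : 1 < p) (hpq : p ≤ q)
    (hν : 0 < ν) (hν1 : ν ≤ 1) (hL : 1 ≤ L) (h1 : n * (q - p) < 2 * p)
    (h2 : (n - 2) * (q - p) < 4 * (p - 1)) {α : ℝ}
    (hα : α = n * (2 / (((n : ℝ) + 2) * p - n * q))) : ∃ C : ℝ, 0 < C ∧
    ∀ {μ : ℝ} {F : Eucl n → ℝ}, PQGrowth p q ν L μ F →
    ∀ {u f : Eucl n → ℝ} {x₀ x : Eucl n} {r : ℝ} {K N : ℝ≥0},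
      LipSolution (fderiv ℝ F) u f x ((r - dist x x₀) / 2) (2 ^ (α + 1) * ‖gradient u x‖) K N →
      x ∈ ball x₀ r → lorentzNorm (ball x₀ r) f ≠ ⊤ →
      Filter.Tendsto (fun r => (∫⁻ y in closedBall x r, ‖gradient u y - gradient u x‖ₑ) /
        volume (closedBall x r)) (nhdsWithin 0 (Ioi 0)) (nhds 0) →
      0 < ‖gradient u x‖ → 0 < ⨍ y in ball x₀ r, F (gradient u y) →
      (r - dist x x₀) ^ α * ‖gradient u x‖ ≤ C * (r ^ α *
        (((⨍ y in ball x₀ r, F (gradient u y)) +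
            (lorentzNorm (ball x₀ r) f).toReal ^ (p / (p - 1))) ^ (1 / p) +
          ((⨍ y in ball x₀ r, F (gradient u y)) +
            (lorentzNorm (ball x₀ r) f).toReal ^ (p / (p - 1))) ^
            (2 / (((n : ℝ) + 2) * p - n * q)) +
          (lorentzNorm (ball x₀ r) f).toReal ^
            (4 / (4 * (p - 1) - ((n : ℝ) - 2) * (q - p))))) := by
  have hn1 : 1 < n := by omega
  have hn0 : (0 : ℝ) < n := by exact_mod_cast (by omega : 0 < n)
  have hp0 : 0 < p := by linarith
  have hβ := one_div_le_two_div_gap hp hpq h1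
  set β := 2 / (((n : ℝ) + 2) * p - n * q)
  set γ := 4 / (4 * (p - 1) - ((n : ℝ) - 2) * (q - p))
  have hβ0 : 0 < β := lt_of_lt_of_le (by positivity) hβ
  have hα0 : 0 < α := by rw [hα]; positivity
  have hk : (2 : ℝ) ≤ 2 ^ (α + 1) := by
    simpa using Real.rpow_le_rpow_of_exponent_le one_le_two (show (1 : ℝ) ≤ α + 1 by linarith)
  obtain ⟨C₁, hC₁, hmain⟩ := PQGrowth.exists_norm_gradient_le hn hp hpq hν hν1 hL hk
  obtain ⟨C₂, hC₂, halg⟩ := exists_le_rpow_of_le hn hp hpq h1 h2 hC₁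
  set ω : ℝ := volume.real (ball (0 : Eucl n) 1) with hω
  have hω0 : 0 < ω :=
    ENNReal.toReal_pos (measure_ball_pos volume _ one_pos).ne' measure_ball_lt_top.ne
  set c₀ := 2 ^ n * ω
  have hc₀ : 0 < c₀ := by positivity
  have hb : 0 ≤ (1 / ν) ^ (1 / p) := by positivity
  refine ⟨C₂ * (c₀ ^ (1 / p) + c₀ ^ β + 1) + (1 / ν) ^ (1 / p), by positivity, ?_⟩
  intro μ F hF u f x₀ x r K N sol hx hf hleb hm hA
  have hFc : Continuous F := (hF.differentiable hn1 hp hpq (by linarith)).continuous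
  have hint := integrableOn_ball_comp_gradient hFc sol.lip x₀ r
  have hF0 := hF.apply_nonneg hn1 hp0 hν.le
  have hd : 0 < r - dist x x₀ := sub_pos.2 hx
  have hdr : r - dist x x₀ ≤ r := by linarith [dist_nonneg (x := x) (y := x₀)]
  have hr : 0 < r := hd.trans_le hdr
  have hvol : volume.real (ball x₀ r) = r ^ n * ω := by
    rw [hω, Measure.real, Measure.real, Measure.addHaar_ball_of_pos _ _ hr, ENNReal.toReal_mul,
      ENNReal.toReal_ofReal (by positivity), finrank_euclideanSpace_fin]
  set A := ⨍ y in ball x₀ r, F (gradient u y) with hAdef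
  have hI : ∫ y in ball x₀ r, F (gradient u y) = r ^ n * ω * A := by
    rw [hAdef, setAverage_eq, hvol, smul_eq_mul]
    field_simp
  have hΛ : 0 ≤ (lorentzNorm (ball x₀ r) f).toReal := ENNReal.toReal_nonneg
  set Λ := (lorentzNorm (ball x₀ r) f).toReal with hΛdef
  set m := ‖gradient u x‖
  set d := r - dist x x₀ with hddef
  have hL0 : 0 ≤ Λ ^ (p / (p - 1)) := by positivity
  set M := A + Λ ^ (p / (p - 1)) with hM
  have hM0 : 0 < M := by positivity
  have z1 : 0 ≤ M ^ (1 / p) := by positivity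
  have z2 : 0 ≤ M ^ β := by positivity
  have z3 : 0 ≤ Λ ^ γ := by positivity
  set X := M ^ (1 / p) + M ^ β + Λ ^ γ with hX
  have hc1 : 0 ≤ C₂ * (c₀ ^ (1 / p) + c₀ ^ β + 1) := by positivity
  have hX0 : 0 ≤ X := by positivity
  have hrα : 0 < r ^ α := by positivity
  rcases le_total μ m with hμ | hμ
  · set t := d / r with ht
    have ht0 : 0 < t := by positivity
    have ht1 : t ≤ 1 := (div_le_one hr).2 hdr
    set Y := c₀ * A / t ^ n with hY
    have hY0 : 0 < Y := by positivity
    have htY : t ^ n * Y = c₀ * A := by rw [hY]; field_simp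
    have hsub : ball x (d / 2) ⊆ ball x₀ r := ball_subset_ball' (by linarith)
    have hRY : (d / 2) ^ n * Y = r ^ n * ω * A := by
      rw [show (d / 2) ^ n = t ^ n * (r ^ n / 2 ^ n) by rw [ht, div_pow, div_pow]; field_simp,
        mul_right_comm, htY]
      simp only [c₀]
      field_simp
    have hE : ∫⁻ y in ball x (d / 2), ENNReal.ofReal (F (gradient u y)) ≤
        ENNReal.ofReal ((d / 2) ^ n * Y) := by
      rw [hRY, ← hI, ofReal_integral_eq_lintegral_ofReal hint (ae_of_all _ fun y => hF0 _)]
      exact lintegral_mono_set hsub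
    have h3 := hmain hF sol (by positivity) (ball x₀ r) measure_ball_lt_top.ne hf hsub hleb rfl hm
      hμ Y hY0 hE
    have h4 := rpow_mul_le_of_le_scaled hp hβ ht0 ht1 hA.le hΛ hC₂.le hc₀.le hY0.le htY
      (halg m Y Λ hm hY0.le hΛ h3)
    rw [← hα, ht, Real.div_rpow hd.le hr.le, div_mul_eq_mul_div, div_le_iff₀ hrα] at h4
    refine h4.trans ?_
    rw [add_mul]
    have : 0 ≤ (1 / ν) ^ (1 / p) * (r ^ α * X) := by positivity
    linarith
  · have hle : ν * m ^ p ≤ A := by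
      have h5 : ν * m ^ p * (r ^ n * ω) ≤ r ^ n * ω * A := by
        rw [← hI, ← hvol]
        have : ∫ _ in ball x₀ r, ν * m ^ p = ν * m ^ p * volume.real (ball x₀ r) := by
          rw [setIntegral_const, smul_eq_mul, mul_comm]
        rw [← this]
        refine setIntegral_mono_on (integrableOn_const measure_ball_lt_top.ne) hint
          measurableSet_ball fun y _ => ?_
        refine le_trans ?_ (hF.mul_rpow_mu_le_apply hn1 hp0 hν.le (gradient u y))
        gcongr
      refine le_of_mul_le_mul_right ?_ (show 0 < r ^ n * ω by positivity)
      linarith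
    have hm' : m ≤ (1 / ν) ^ (1 / p) * M ^ (1 / p) := by
      calc m = (m ^ p) ^ (1 / p) := by
            rw [← Real.rpow_mul hm.le, mul_one_div_cancel hp0.ne', Real.rpow_one]
        _ ≤ (1 / ν * M) ^ (1 / p) := by
            gcongr
            rw [one_div, ← div_eq_inv_mul, le_div_iff₀ hν]
            linarith
        _ = _ := Real.mul_rpow (by positivity) hM0.le
    calc d ^ α * m ≤ r ^ α * ((1 / ν) ^ (1 / p) * X) := by
          gcongr
          exact hm'.trans (by gcongr; linarith)
      _ = (1 / ν) ^ (1 / p) * (r ^ α * X) := by ring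
      _ ≤ _ := by gcongr; linarith

theorem PQGrowth.ae_gradient_eq_zero (hn : 1 < n) (hp : 1 < p) (hpq : p ≤ q) (hν : 0 < ν)
    (hL : 0 < L) (hF : PQGrowth p q ν L μ F) {u : Eucl n → ℝ} {K : ℝ≥0} (hu : LipschitzWith K u)
    {x₀ : Eucl n} {r : ℝ} (hr : 0 < r) (hA : ⨍ y in ball x₀ r, F (gradient u y) = 0) :
    ∀ᵐ y, y ∈ ball x₀ r → gradient u y = 0 := by
  have hp0 : 0 < p := by linarith
  have hF0 := hF.apply_nonneg hn hp0 hν.le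
  have hvol : volume.real (ball x₀ r) ≠ 0 :=
    (ENNReal.toReal_pos (measure_ball_pos volume _ hr).ne' measure_ball_lt_top.ne).ne'
  rw [setAverage_eq, smul_eq_zero, or_iff_right (inv_ne_zero hvol),
    setIntegral_eq_zero_iff_of_nonneg_ae (ae_of_all _ fun y => hF0 _)
    (integrableOn_ball_comp_gradient (hF.differentiable hn hp hpq hL).continuous hu x₀ r)] at hA
  filter_upwards [(ae_restrict_iff' measurableSet_ball).1 hA] with y hy hyB
  have h1 : ν * ‖gradient u y‖ ^ p ≤ 0 :=
    (hF.mul_norm_rpow_le_apply hn hp0 hν.le _).trans (hy hyB).le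
  have h2 : ‖gradient u y‖ ^ p ≤ 0 := nonpos_of_mul_nonpos_right h1 hν
  have h3 := (Real.rpow_eq_zero (norm_nonneg _) hp0.ne').1 (le_antisymm h2 (by positivity))
  exact norm_eq_zero.1 h3

end

section

variable {n : ℕ} {p q ν L μ : ℝ} {F : Eucl n → ℝ}

theorem PQGrowth.exists_ae_norm_gradient_le (hn : 2 < n) (hp : 1 < p) (hpq : p ≤ q)
    (hν : 0 < ν) (hν1 : ν ≤ 1) (hL : 1 ≤ L) (h1 : n * (q - p) < 2 * p)
    (h2 : (n - 2) * (q - p) < 4 * (p - 1)) : ∃ C : ℝ, 0 < C ∧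
    ∀ {μ : ℝ} {F : Eucl n → ℝ}, PQGrowth p q ν L μ F →
    ∀ {Ω : Set (Eucl n)} {u ut f : Eucl n → ℝ} {x₀ : Eucl n} {r : ℝ} {K : ℝ≥0},
      LocLipOn Ω u → IsLocMinimizer Ω F f u → Measurable f → 0 < r → closure (ball x₀ r) ⊆ Ω →
      lorentzNorm (ball x₀ r) f ≠ ⊤ → LipschitzWith K ut → EqOn u ut (ball x₀ r) →
      ∀ᵐ x, x ∈ ball x₀ (r / 2) → ‖gradient ut x‖ ≤ C *
        (((⨍ y in ball x₀ r, F (gradient ut y)) +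
            (lorentzNorm (ball x₀ r) f).toReal ^ (p / (p - 1))) ^ (1 / p) +
          ((⨍ y in ball x₀ r, F (gradient ut y)) +
            (lorentzNorm (ball x₀ r) f).toReal ^ (p / (p - 1))) ^
            (2 / (((n : ℝ) + 2) * p - n * q)) +
          (lorentzNorm (ball x₀ r) f).toReal ^
            (4 / (4 * (p - 1) - ((n : ℝ) - 2) * (q - p)))) := by
  have hn1 : 1 < n := by omega
  have hp0 : 0 < p := by linarith
  obtain ⟨C, hC, hmain⟩ := PQGrowth.exists_rpow_mul_norm_gradient_le hn hp hpq hν hν1 hL h1 h2 rfl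
  set α := n * (2 / (((n : ℝ) + 2) * p - n * q)) with hα
  have hα0 : 0 ≤ α := by
    have : 0 < ((n : ℝ) + 2) * p - n * q := by linarith
    positivity
  refine ⟨2 ^ α * (2 * C), by positivity, ?_⟩
  intro μ F hF Ω u ut f x₀ r K hu hmin hfm hr hB hf hut heq
  have hd := hF.differentiable hn1 hp hpq (by linarith)
  have hF0 := hF.apply_nonneg hn1 hp0 hν.le
  have hA : 0 ≤ ⨍ y in ball x₀ r, F (gradient ut y) := by
    rw [setAverage_eq]
    exact smul_nonneg (by positivity) (integral_nonneg fun y => hF0 _)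
  have hΛ : 0 ≤ (lorentzNorm (ball x₀ r) f).toReal := ENNReal.toReal_nonneg
  have hhalf : ball x₀ (r / 2) ⊆ ball x₀ r := ball_subset_ball (by linarith)
  rcases hA.eq_or_lt with hA0 | hA0
  · filter_upwards [hF.ae_gradient_eq_zero hn1 hp hpq hν (by linarith) hut hr hA0.symm]
      with x hx hxB
    rw [hx (hhalf hxB), norm_zero]
    positivity
  have hind := lorentzNorm_indicator (ball x₀ r) f
  set X := ((⨍ y in ball x₀ r, F (gradient ut y)) +
            (lorentzNorm (ball x₀ r) f).toReal ^ (p / (p - 1))) ^ (1 / p) +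
          ((⨍ y in ball x₀ r, F (gradient ut y)) +
            (lorentzNorm (ball x₀ r) f).toReal ^ (p / (p - 1))) ^
            (2 / (((n : ℝ) + 2) * p - n * q)) +
          (lorentzNorm (ball x₀ r) f).toReal ^
            (4 / (4 * (p - 1) - ((n : ℝ) - 2) * (q - p))) with hX
  have hX0 : 0 ≤ X := by positivity
  have hsup := ae_rpow_mul_le_of_doubling (w := fun x => ‖gradient ut x‖) (fun _ => norm_nonneg _)
    (norm_gradient_le_of_lipschitz hut) hα0 (x₀ := x₀) (r := r) (T := C * (r ^ α * X))
    (by positivity) (by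
      filter_upwards [ae_tendsto_setLIntegral_gradient_sub hut] with x hleb hx hm hdoub
      have hdist : 0 < r - dist x x₀ := sub_pos.2 hx
      have := hmain hF (hmin.lipSolution hn hF.convexOn hd hu hB hfm hf hut heq
        (ball_subset_ball' (by linarith)) hdoub) hx (by rwa [hind]) hleb hm hA0
      rwa [hind] at this)
  filter_upwards [hsup] with x hx hxB
  have hdist : r / 2 ≤ r - dist x x₀ := by linarith [mem_ball.1 hxB]
  have h3 : (r / 2) ^ α * ‖gradient ut x‖ ≤ 2 * (C * (r ^ α * X)) :=
    (mul_le_mul_of_nonneg_right (Real.rpow_le_rpow (by positivity) hdist hα0)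
      (norm_nonneg _)).trans (hx (hhalf hxB))
  rw [Real.div_rpow hr.le two_pos.le, div_mul_eq_mul_div, div_le_iff₀ (by positivity)] at h3
  refine le_of_mul_le_mul_left ?_ (show 0 < r ^ α by positivity)
  linarith

end

/-- Scalar `(p,q)`-growth Lipschitz estimate (Theorem 1 of the paper):
under the `(p,q)`-growth and ellipticity assumptions on `F`, the gap bound
`q/p < 1 + min{2/n, 4(p−1)/(p(n−2))}` and `f ∈ L(n,1)`, any locally Lipschitz local minimizer
`u` of `w ↦ ∫ [F(Dw) − f·w]` satisfies, with `M = ⨍_B F(Du) + ‖f‖_{L(n,1)(B)}^{p/(p−1)}`,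
`‖Du‖_{L^∞(B/2)} ≤ cM^{1/p} + cM^{2/((n+2)p−nq)} + c‖f‖_{L(n,1)(B)}^{4/(4(p−1)−(n−2)(q−p))}`. -/
theorem scalar_pq_lipschitz_estimate (n : ℕ) (hn : 2 < n) (p q ν L : ℝ)
    (hp : 1 < p) (hpq : p ≤ q) (hν : 0 < ν) (hν1 : ν ≤ 1) (hL : 1 ≤ L)
    (hgap : q / p < 1 + min (2 / (n : ℝ)) (4 * (p - 1) / (p * ((n : ℝ) - 2)))) :
    ∃ c : ℝ, 0 < c ∧
      ∀ (Ω : Set (EuclideanSpace ℝ (Fin n))), IsOpen Ω →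
      ∀ F : EuclideanSpace ℝ (Fin n) → ℝ, ∀ μ : ℝ, μ ∈ Icc (0:ℝ) 1 →
        ConvexOn ℝ univ F → ContDiffOn ℝ 2 F {(0 : EuclideanSpace ℝ (Fin n))}ᶜ →
        (∀ z : EuclideanSpace ℝ (Fin n), z ≠ 0 →
          ν * (‖z‖ ^ 2 + μ ^ 2) ^ (p / 2) ≤ F z ∧
          F z ≤ L * (‖z‖ ^ 2 + μ ^ 2) ^ (q / 2) + L * (‖z‖ ^ 2 + μ ^ 2) ^ (p / 2)) →
        (∀ z : EuclideanSpace ℝ (Fin n), z ≠ 0 →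
          (‖z‖ ^ 2 + μ ^ 2) * ‖fderiv ℝ (fderiv ℝ F) z‖ ≤
            L * (‖z‖ ^ 2 + μ ^ 2) ^ (q / 2) + L * (‖z‖ ^ 2 + μ ^ 2) ^ (p / 2)) →
        (∀ z : EuclideanSpace ℝ (Fin n), z ≠ 0 → ∀ ξ : EuclideanSpace ℝ (Fin n),
          ν * (‖z‖ ^ 2 + μ ^ 2) ^ ((p - 2) / 2) * ‖ξ‖ ^ 2 ≤ fderiv ℝ (fderiv ℝ F) z ξ ξ) →
      ∀ f : EuclideanSpace ℝ (Fin n) → ℝ, Measurable f → lorentzNorm Ω f < ⊤ →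
      ∀ u : EuclideanSpace ℝ (Fin n) → ℝ, LocLipOn Ω u → IsLocMinimizer Ω F f u →
      ∀ (x₀ : EuclideanSpace ℝ (Fin n)) (r : ℝ), 0 < r → closure (ball x₀ r) ⊆ Ω →
        essSup (fun x => (‖gradient u x‖₊ : ℝ≥0∞)) (volume.restrict (ball x₀ (r / 2))) ≤
          ENNReal.ofReal
            (c * ((⨍ x in ball x₀ r, F (gradient u x)) +
                  (lorentzNorm (ball x₀ r) f).toReal ^ (p / (p - 1))) ^ (1 / p) +
              c * ((⨍ x in ball x₀ r, F (gradient u x)) +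
                  (lorentzNorm (ball x₀ r) f).toReal ^ (p / (p - 1))) ^
                (2 / (((n : ℝ) + 2) * p - (n : ℝ) * q)) +
              c * (lorentzNorm (ball x₀ r) f).toReal ^
                (4 / (4 * (p - 1) - ((n : ℝ) - 2) * (q - p)))) := by
  obtain ⟨h1, h2⟩ := (gap_iff_lt hn hp).1 hgap
  obtain ⟨c, hc, hmain⟩ := PQGrowth.exists_ae_norm_gradient_le hn hp hpq hν hν1 hL h1 h2
  refine ⟨c, hc, ?_⟩
  intro Ω hΩ F μ hμ hconv hdiff hgrowth hhess hell f hfm hf u hu hmin x₀ r hr hB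
  have hF : PQGrowth p q ν L μ F := ⟨hμ, hconv, hdiff, fun z hz => (hgrowth z hz).1, hhess, hell⟩
  obtain ⟨K, hK⟩ := hu _ isBounded_ball.isCompact_closure hB
  obtain ⟨ut, hut, heq⟩ := hK.extend_real
  have heq' : EqOn u ut (ball x₀ r) := heq.mono subset_closure
  have hgrad : ∀ y ∈ ball x₀ r, gradient u y = gradient ut y :=
    fun y hy => gradient_congr isOpen_ball heq' hy
  have hfB : lorentzNorm (ball x₀ r) f ≠ ⊤ :=
    ((lorentzNorm_mono (subset_closure.trans hB) f).trans_lt hf).ne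
  have havg : ⨍ y in ball x₀ r, F (gradient u y) = ⨍ y in ball x₀ r, F (gradient ut y) := by
    rw [setAverage_eq, setAverage_eq,
      setIntegral_congr_fun measurableSet_ball fun y hy => congrArg F (hgrad y hy)]
  refine essSup_le_of_ae_le _ ((ae_restrict_iff' measurableSet_ball).2 ?_)
  filter_upwards [hmain hF hu hmin hfm hr hB hfB hut heq'] with x hx hxB
  rw [hgrad x (ball_subset_ball (by linarith) hxB), havg]
  change ‖gradient ut x‖ₑ ≤ _
  rw [← ofReal_norm]
  refine ENNReal.ofReal_le_ofReal ((hx hxB).trans_eq ?_)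
  ring
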